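/- arXiv:1607.01758 — 2 statements merged into one kernel-verified Lean document; each statement's English description precedes it below -/
import Mathlib

section
/- If E ⊂ ℝⁿ is Hᵐ-measurable with Hᵐ(E) < ∞ and there exist η > 0 and a sequence of Lipschitz maps ψᵢ : ℝⁿ → ℝⁿ with Lipschitz constants uniformly bounded by some L, such that ψᵢ converges uniformly to the identity and Hᵐ(ψᵢ(E)) < Hᵐ(E) − η for all i, then E is not m-rectifiable. -/
open MeasureTheory Metric Set Filter ENNReal

noncomputable section

abbrev En (n : ℕ) := EuclideanSpace ℝ (Fin n)

/-- A set `E ⊆ ℝⁿ` is `m`-rectifiable if it is covered, up to an `Hᵐ`-null set,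
by countably many Lipschitz images of `ℝᵐ`. -/
def IsRectifiable (n m : ℕ) (E : Set (En n)) : Prop :=
  ∃ f : ℕ → EuclideanSpace ℝ (Fin m) → En n,
    (∀ i, ∃ L : NNReal, LipschitzWith L (f i)) ∧
    μH[m] (E \ ⋃ i, Set.range (f i)) = 0

open scoped NNReal Topology

/-! ### Lipschitz maps equal to the identity far away are surjective -/

section Surjectivity

/-- Extrapolation weights: the value at `1` of a polynomial of bounded degree is a fixed linear
combination of its values at finitely many points of any interval `(0, t₀]`. -/
lemma exists_extrapolation_weights (d : ℕ) {t₀ : ℝ} (ht₀ : 0 < t₀) :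
    ∃ w t : ℕ → ℝ, (∀ j, 0 < t j ∧ t j ≤ t₀) ∧ ∀ p : Polynomial ℝ, p.natDegree ≤ d →
      p.eval 1 = ∑ j ∈ Finset.range (d + 1), w j * p.eval (t j) := by
  set t : ℕ → ℝ := fun j => t₀ / (j + 1) with ht
  refine ⟨fun j => (Lagrange.basis (Finset.range (d + 1)) t j).eval 1, t, fun j => ⟨by positivity,
    div_le_self ht₀.le (by linarith [(Nat.cast_nonneg j : (0 : ℝ) ≤ j)])⟩, fun p hp => ?_⟩
  have hinj : Set.InjOn t (Finset.range (d + 1)) := by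
    intro a _ b _ hab
    simp only [ht] at hab
    field_simp at hab
    exact_mod_cast (add_right_cancel hab).symm
  have hdeg : p.degree < (Finset.range (d + 1)).card := by
    rw [Finset.card_range]
    exact (Polynomial.degree_le_of_natDegree_le hp).trans_lt (by exact_mod_cast Nat.lt_succ_self d)
  conv_lhs => rw [Lagrange.eq_interpolate hinj hdeg]
  simp [Lagrange.interpolate_apply, Polynomial.eval_finsetSum, mul_comm]

variable {V : Type*} [NormedAddCommGroup V] [InnerProductSpace ℝ V] [FiniteDimensional ℝ V]

lemma exists_polynomial_det_one_add_smul (M : V →L[ℝ] V) :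
    ∃ p : Polynomial ℝ, p.natDegree ≤ Module.finrank ℝ V ∧
      ∀ t : ℝ, p.eval t = (1 + t • M).det := by
  let b := Module.finBasis ℝ V
  let A := LinearMap.toMatrix b b (M : V →ₗ[ℝ] V)
  refine ⟨Matrix.det ((Polynomial.X : Polynomial ℝ) • A.map Polynomial.C
    + (1 : Matrix _ _ ℝ).map Polynomial.C), ?_, fun t => ?_⟩
  · simpa using Polynomial.natDegree_det_X_add_C_le A 1
  · rw [← Polynomial.coe_evalRingHom, RingHom.map_det]
    have : (1 + t • M).det = LinearMap.det (1 + t • (M : V →ₗ[ℝ] V)) := rfl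
    rw [this, ← LinearMap.det_toMatrix b]
    congr 1
    ext i j
    have h1 : (LinearMap.toMatrix b b) (1 + t • (M : V →ₗ[ℝ] V)) = 1 + t • A := by
      rw [map_add, map_smul, LinearMap.toMatrix_one]
    rw [h1]
    by_cases hij : i = j
    · simp [hij, mul_comm t, add_comm]
    · simp [hij, mul_comm t]

lemma det_one_add_pos {M : V →L[ℝ] V} (hM : ‖M‖ < 1) : 0 < (1 + M).det := by
  have hne : ∀ s ∈ Set.Icc (0 : ℝ) 1, (1 + s • M).det ≠ 0 := by
    intro s hs h0
    have hlt : ‖-(s • M)‖ < 1 := by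
      rw [norm_neg, norm_smul, Real.norm_of_nonneg hs.1]
      nlinarith [norm_nonneg M, hs.2]
    have hu := isUnit_one_sub_of_norm_lt_one hlt
    rw [sub_neg_eq_add] at hu
    have := hu.map (ContinuousLinearMap.toLinearMapRingHom (R₁ := ℝ) (M₁ := V))
    exact (LinearMap.isUnit_iff_isUnit_det _ |>.1 this).ne_zero h0
  have hcont : Continuous fun s : ℝ => (1 + s • M).det :=
    ContinuousLinearMap.continuous_det.comp (by fun_prop)
  by_contra hneg
  obtain ⟨s, hs, h0⟩ := intermediate_value_Icc' (zero_le_one' ℝ) hcont.continuousOn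
    (show (0 : ℝ) ∈ _ by simpa using ⟨not_lt.1 hneg, by simp [ContinuousLinearMap.det]⟩)
  exact hne s hs h0

section Jacobian

variable [MeasurableSpace V] [BorelSpace V] (μ : Measure V) [μ.IsAddHaarMeasure]

/-- The integral of the Jacobian of a small Lipschitz perturbation of the identity supported in a
ball is the volume of the ball. -/
lemma integral_det_one_add_smul_fderiv_of_lt_one {u : V → V} {K : ℝ≥0} (hu : LipschitzWith K u)
    {y : V} {R : ℝ} (hout : ∀ x, R ≤ dist x y → u x = 0) {t : ℝ} (ht : 0 < t) (htK : t * K < 1) :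
    ∫ x in ball y R, (1 + t • fderiv ℝ u x).det ∂μ = μ.real (ball y R) := by
  set g : V → V := fun x => x + t • u x with hg
  have happ : ApproximatesLinearOn g ((ContinuousLinearEquiv.refl ℝ V : V ≃L[ℝ] V) : V →L[ℝ] V)
      univ (t.toNNReal * K) := by
    intro x _ z _
    have : g x - g z - ((ContinuousLinearEquiv.refl ℝ V : V ≃L[ℝ] V) : V →L[ℝ] V) (x - z)
        = t • (u x - u z) := by simp [hg, smul_sub]; abel
    rw [this, norm_smul, Real.norm_of_nonneg ht.le, NNReal.coe_mul, Real.coe_toNNReal _ ht.le,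
      mul_assoc]
    gcongr
    exact hu.norm_sub_le x z
  have hc : Subsingleton V ∨ t.toNNReal * K <
      ‖((ContinuousLinearEquiv.refl ℝ V).symm : V →L[ℝ] V)‖₊⁻¹ := by
    rcases subsingleton_or_nontrivial V with h | h
    · exact Or.inl h
    · right
      have : ‖((ContinuousLinearEquiv.refl ℝ V).symm : V →L[ℝ] V)‖₊ = 1 :=
        ContinuousLinearMap.nnnorm_id (𝕜 := ℝ) (E := V)
      rw [this, inv_one, ← NNReal.coe_lt_coe]
      simpa [ht.le] using htK
  have hinj : Function.Injective g := injOn_univ.1 (happ.injOn hc)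
  have hsurj : Function.Surjective g := happ.surjective hc
  have hgout : ∀ x, R ≤ dist x y → g x = x := fun x hx => by simp [hg, hout x hx]
  have himg : g '' ball y R = ball y R := by
    ext z
    constructor
    · rintro ⟨x, hx, rfl⟩
      by_contra hz
      have := hinj (hgout (g x) (not_lt.1 hz))
      rw [this] at hz
      exact hz hx
    · intro hz
      obtain ⟨x, rfl⟩ := hsurj z
      refine ⟨x, ?_, rfl⟩
      by_contra hx
      rw [hgout x (not_lt.1 hx)] at hz
      exact hx hz
  set D : Set V := {x | DifferentiableAt ℝ u x}
  have hDae : ∀ᵐ x ∂μ, x ∈ D := hu.ae_differentiableAt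
  have hDm : MeasurableSet D := measurableSet_of_differentiableAt ℝ u
  have hgL : LipschitzWith (1 + t.toNNReal * K) g := by
    refine LipschitzWith.id.add ?_
    have h2 : LipschitzWith (‖t‖₊ * K) (fun x => t • u x) := (lipschitzWith_smul t).comp hu
    rwa [show ‖t‖₊ = t.toNNReal from by
      ext; simp [ht.le, abs_of_pos ht]] at h2
  have hderiv : ∀ x ∈ D, HasFDerivAt g (1 + t • fderiv ℝ u x) x := fun x hx =>
    (hasFDerivAt_id x).add ((DifferentiableAt.hasFDerivAt hx).const_smul t)
  have hpos : ∀ x, 0 < (1 + t • fderiv ℝ u x).det := fun x => by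
    apply det_one_add_pos
    rw [norm_smul, Real.norm_of_nonneg ht.le]
    refine lt_of_le_of_lt ?_ htK
    gcongr
    exact norm_fderiv_le_of_lipschitz ℝ hu
  have hcov := lintegral_abs_det_fderiv_eq_addHaar_image μ (measurableSet_ball.inter hDm)
    (fun x hx => (hderiv x hx.2).hasFDerivWithinAt) (hinj.injOn (s := ball y R ∩ D))
  have hball : (ball y R ∩ D : Set V) =ᵐ[μ] ball y R := by
    filter_upwards [hDae] with x hx
    exact propext ⟨fun h => h.1, fun h => ⟨h, hx⟩⟩
  have himgD : μ (g '' (ball y R ∩ D)) = μ (ball y R) := by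
    apply le_antisymm
    · exact (measure_mono (image_mono inter_subset_left)).trans_eq (by rw [himg])
    · have hnull : μ (g '' (Dᶜ)) = 0 := by
        have h0 : μH[Module.finrank ℝ V] Dᶜ = 0 :=
          Measure.absolutelyContinuous_isAddHaarMeasure _ μ hDae
        refine Measure.absolutelyContinuous_isAddHaarMeasure μ μH[Module.finrank ℝ V] ?_
        have h1 := hgL.hausdorffMeasure_image_le (Nat.cast_nonneg (Module.finrank ℝ V)) Dᶜ
        rwa [h0, mul_zero, nonpos_iff_eq_zero] at h1
      calc μ (ball y R) = μ (g '' ball y R) := by rw [himg]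
        _ ≤ μ (g '' (ball y R ∩ D) ∪ g '' Dᶜ) := by
          apply measure_mono
          rw [← image_union]
          apply image_mono
          intro x hx
          by_cases h : x ∈ D
          · exact Or.inl ⟨hx, h⟩
          · exact Or.inr h
        _ ≤ _ := (measure_union_le _ _).trans_eq (by rw [hnull, add_zero])
  rw [himgD, setLIntegral_congr hball] at hcov
  have hmeas : Measurable fun x => (1 + t • fderiv ℝ u x).det :=
    ContinuousLinearMap.continuous_det.measurable.comp
      (((measurable_fderiv ℝ u).const_smul t).const_add 1)
  rw [integral_eq_lintegral_of_nonneg_ae (Eventually.of_forall fun x => (hpos x).le)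
    hmeas.aestronglyMeasurable, Measure.real, ← hcov]
  simp_rw [abs_of_pos (hpos _)]

lemma integral_det_fderiv_of_eq_id_outside_ball {g : V → V} {K : ℝ≥0} (hg : LipschitzWith K g)
    {y : V} {R : ℝ} (hout : ∀ x, R ≤ dist x y → g x = x) :
    ∫ x in ball y R, (fderiv ℝ g x).det ∂μ = μ.real (ball y R) := by
  set u : V → V := fun x => g x - x with hu
  have huL : LipschitzWith (K + 1) u := hg.sub LipschitzWith.id
  have huout : ∀ x, R ≤ dist x y → u x = 0 := fun x hx => by simp [hu, hout x hx]
  obtain ⟨w, t, ht, hw⟩ := exists_extrapolation_weights (Module.finrank ℝ V)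
    (t₀ := 1 / (K + 2)) (by positivity)
  have htK : ∀ j, t j * (K + 1 : ℝ≥0) < 1 := fun j => by
    calc t j * (K + 1 : ℝ≥0) ≤ 1 / (K + 2) * (K + 1) := by
          push_cast
          gcongr
          exact (ht j).2
      _ < 1 := by
        rw [one_div, inv_mul_lt_iff₀ (by positivity)]
        linarith
  have hkey : ∀ x, (1 + (1 : ℝ) • fderiv ℝ u x).det
      = ∑ j ∈ Finset.range (Module.finrank ℝ V + 1), w j * (1 + t j • fderiv ℝ u x).det := by
    intro x
    obtain ⟨p, hp, hpe⟩ := exists_polynomial_det_one_add_smul (fderiv ℝ u x)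
    simp_rw [← hpe]
    exact hw p hp
  have hdetint : ∀ j, ∫ x in ball y R, (1 + t j • fderiv ℝ u x).det ∂μ = μ.real (ball y R) :=
    fun j => integral_det_one_add_smul_fderiv_of_lt_one μ huL huout (ht j).1 (htK j)
  have hbdd : ∀ s : ℝ, IntegrableOn (fun x => (1 + s • fderiv ℝ u x).det) (ball y R) μ := by
    intro s
    have hcpt : IsCompact (closedBall (0 : V →L[ℝ] V) (K + 1)) := isCompact_closedBall _ _
    have hcont : Continuous fun M : V →L[ℝ] V => (1 + s • M).det :=
      ContinuousLinearMap.continuous_det.comp (by fun_prop)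
    obtain ⟨C, hC⟩ := hcpt.exists_bound_of_continuousOn hcont.continuousOn
    refine Measure.integrableOn_of_bounded (M := C) measure_ball_lt_top.ne
      (hcont.measurable.comp (measurable_fderiv ℝ u)).aestronglyMeasurable
      (Eventually.of_forall fun x => hC _ ?_)
    simpa using norm_fderiv_le_of_lipschitz ℝ huL (x₀ := x)
  have hone : ∑ j ∈ Finset.range (Module.finrank ℝ V + 1), w j = 1 := by
    simpa using (hw 1 (by simp)).symm
  have hae : ∀ᵐ x ∂μ.restrict (ball y R), (fderiv ℝ g x).det =
      ∑ j ∈ Finset.range (Module.finrank ℝ V + 1), w j * (1 + t j • fderiv ℝ u x).det := by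
    filter_upwards [ae_restrict_of_ae (hg.ae_differentiableAt (μ := μ))] with x hx
    have : fderiv ℝ u x = fderiv ℝ g x - 1 :=
      (hx.hasFDerivAt.sub (hasFDerivAt_id x)).fderiv
    rw [← hkey, this]
    simp
  rw [integral_congr_ae hae, integral_finsetSum _ fun j _ => (hbdd (t j)).const_mul (w j)]
  simp_rw [integral_const_mul, hdetint, ← Finset.sum_mul, hone, one_mul]

end Jacobian

lemma det_eq_zero_of_hasFDerivAt_of_dist_const {r : V → V} {r' : V →L[ℝ] V} {x y : V} {R : ℝ}
    (hR : 0 < R) (hr : HasFDerivAt r r' x) (hdist : ∀ᶠ z in 𝓝 x, dist (r z) y = R) :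
    r'.det = 0 := by
  by_contra hdet
  have hsq : (fun z => ‖r z - y‖ ^ 2) =ᶠ[𝓝 x] fun _ => R ^ 2 := by
    filter_upwards [hdist] with z hz
    rw [← dist_eq_norm, hz]
  have h1 := (hr.sub_const y).norm_sq
  have h2 : HasFDerivAt (fun z => ‖r z - y‖ ^ 2) (0 : V →L[ℝ] ℝ) x :=
    (hasFDerivAt_const (R ^ 2) x).congr_of_eventuallyEq hsq
  have h3 := h1.unique h2
  have hunit : IsUnit (r' : V →ₗ[ℝ] V) :=
    (LinearMap.isUnit_iff_isUnit_det _).2 (isUnit_iff_ne_zero.2 hdet)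
  obtain ⟨v, hv⟩ := (Module.End.isUnit_iff _).1 hunit |>.2 (r x - y)
  have h4 := DFunLike.congr_fun h3 v
  have hv' : r' v = r x - y := hv
  have h5 : ‖r x - y‖ = R := by rw [← dist_eq_norm, hdist.self_of_nhds]
  simp only [smul_apply, ContinuousLinearMap.comp_apply, innerSL_apply_apply, hv',
    real_inner_self_eq_norm_sq, h5, zero_apply, nsmul_eq_mul] at h4
  exact (by positivity : (0 : ℝ) < (2 : ℕ) * R ^ 2).ne' h4

/-- There is no Lipschitz retraction of a ball onto its boundary sphere. -/
lemma not_lipschitz_retraction_sphere {r : V → V} {K : ℝ≥0} (hr : LipschitzWith K r) {y : V}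
    {R : ℝ} (hR : 0 < R) (hout : ∀ x, R ≤ dist x y → r x = x)
    (hin : ∀ x ∈ ball y R, dist (r x) y = R) : False := by
  borelize V
  let μ : Measure V := μH[Module.finrank ℝ V]
  have h1 := integral_det_fderiv_of_eq_id_outside_ball μ hr hout
  have h2 : ∀ᵐ x ∂μ.restrict (ball y R), (fderiv ℝ r x).det = 0 := by
    filter_upwards [ae_restrict_of_ae (hr.ae_differentiableAt (μ := μ)),
      ae_restrict_mem measurableSet_ball] with x hx hxb
    exact det_eq_zero_of_hasFDerivAt_of_dist_const hR hx.hasFDerivAt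
      (by filter_upwards [isOpen_ball.mem_nhds hxb] with z hz using hin z hz)
  rw [integral_congr_ae h2, integral_zero] at h1
  have h3 : 0 < μ.real (ball y R) :=
    ENNReal.toReal_pos (measure_ball_pos μ y hR).ne' measure_ball_lt_top.ne
  exact h3.ne h1

/-- The radial map pushing the complement of the origin out of the ball of radius `R`. -/
lemma lipschitz_radial_push {V : Type*} [NormedAddCommGroup V] [NormedSpace ℝ V] {R δ : ℝ}
    (hR : 0 < R) (hδ : 0 < δ) {z w : V} (hz : δ ≤ ‖z‖)
    (hz' : δ ≤ ‖w‖) :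
    ‖max 1 (R / ‖z‖) • z - max 1 (R / ‖w‖) • w‖ ≤ (1 + 2 * (R / δ)) * ‖z - w‖ := by
  have hzp : 0 < ‖z‖ := hδ.trans_le hz
  have hzp' : 0 < ‖w‖ := hδ.trans_le hz'
  set k := max 1 (R / ‖z‖) with hk
  set k' := max 1 (R / ‖w‖) with hk'
  have hRz : R / ‖z‖ ≤ R / δ := by gcongr
  have hk0 : 0 ≤ k := zero_le_one.trans (le_max_left _ _)
  have hkle : k ≤ 1 + R / δ := max_le (by linarith [div_pos hR hδ]) (by linarith)
  have hkk : |k - k'| ≤ |R / ‖z‖ - R / ‖w‖| := by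
    have := abs_max_sub_max_le_max 1 (R / ‖z‖) 1 (R / ‖w‖)
    simpa using this
  have heq : R / ‖z‖ - R / ‖w‖ = R / ‖z‖ * (‖w‖ - ‖z‖) / ‖w‖ := by
    field_simp
  have hmul : |k - k'| * ‖w‖ ≤ R / δ * ‖z - w‖ := by
    calc |k - k'| * ‖w‖ ≤ |R / ‖z‖ - R / ‖w‖| * ‖w‖ := by gcongr
      _ = R / ‖z‖ * |‖w‖ - ‖z‖| := by
        rw [heq, abs_div, abs_mul, abs_of_pos hzp', abs_of_pos (div_pos hR hzp)]
        field_simp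
      _ ≤ R / δ * ‖z - w‖ := by
        gcongr
        rw [abs_sub_comm]
        exact abs_norm_sub_norm_le z w
  calc ‖k • z - k' • w‖ = ‖k • (z - w) + (k - k') • w‖ := by
        congr 1; rw [smul_sub, sub_smul]; abel
    _ ≤ k * ‖z - w‖ + |k - k'| * ‖w‖ := by
        refine (norm_add_le _ _).trans_eq ?_
        rw [norm_smul, norm_smul, Real.norm_of_nonneg hk0, Real.norm_eq_abs]
    _ ≤ (1 + 2 * (R / δ)) * ‖z - w‖ := by nlinarith [norm_nonneg (z - w)]

/-- A Lipschitz map of a Euclidean space that is the identity off a ball is surjective. -/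
lemma surjective_of_lipschitz_of_eq_id_outside_ball {G : V → V} {K : ℝ≥0}
    (hG : LipschitzWith K G) {a : V} {ρ : ℝ} (hout : ∀ x, ρ ≤ dist x a → G x = x) :
    Function.Surjective G := by
  intro y
  by_contra! hy
  have hya : dist y a < ρ := by
    by_contra h
    exact hy y (hout y (not_lt.1 h))
  have hρ : 0 < ρ := dist_nonneg.trans_lt hya
  have hcpt : IsCompact (G '' closedBall a ρ) := (isCompact_closedBall a ρ).image hG.continuous
  have hne : (G '' closedBall a ρ).Nonempty := ⟨G a, a, mem_closedBall_self hρ.le, rfl⟩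
  have hynot : y ∉ G '' closedBall a ρ := fun ⟨x, _, hx⟩ => hy x hx
  obtain ⟨δ, hδ, hδG⟩ : ∃ δ > 0, ∀ x, δ ≤ ‖G x - y‖ := by
    refine ⟨min (infDist y (G '' closedBall a ρ)) (ρ - dist y a), lt_min
      ((hcpt.isClosed.notMem_iff_infDist_pos hne).1 hynot) (sub_pos.2 hya), fun x => ?_⟩
    by_cases hx : ρ ≤ dist x a
    · rw [hout x hx, ← dist_eq_norm]
      have := dist_triangle x y a
      exact (min_le_right _ _).trans (by linarith)
    · refine (min_le_left _ _).trans ?_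
      rw [← dist_eq_norm, dist_comm]
      exact infDist_le_dist_of_mem ⟨x, (not_le.1 hx).le, rfl⟩
  obtain ⟨C, hC⟩ := hcpt.isBounded.subset_closedBall y
  set R := max (2 * ρ) C with hRdef
  have hR : 0 < R := lt_max_of_lt_left (by linarith)
  set r : V → V := fun x => y + max 1 (R / ‖G x - y‖) • (G x - y) with hr
  have hrL : LipschitzWith ((1 + 2 * (R / δ)).toNNReal * K) r := by
    refine LipschitzWith.of_dist_le_mul fun x x' => ?_
    rw [hr, dist_add_left, dist_eq_norm, NNReal.coe_mul, Real.coe_toNNReal _ (by positivity),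
      mul_assoc]
    refine (lipschitz_radial_push hR hδ (hδG x) (hδG x')).trans ?_
    gcongr
    rw [sub_sub_sub_cancel_right, ← dist_eq_norm]
    exact hG.dist_le_mul x x'
  refine not_lipschitz_retraction_sphere hrL hR (y := y) (fun x hx => ?_) fun x hx => ?_
  · have hxa : ρ ≤ dist x a := by
      have := dist_triangle x a y
      rw [dist_comm a y] at this
      linarith [le_max_left (2 * ρ) C]
    have hle : R / ‖x - y‖ ≤ 1 := by
      rw [← dist_eq_norm]
      exact (div_le_one (hR.trans_le hx)).2 hx
    simp [hr, hout x hxa, max_eq_left hle]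
  · have hle : ‖G x - y‖ ≤ R := by
      rw [← dist_eq_norm]
      by_cases hxa : ρ ≤ dist x a
      · rw [hout x hxa]
        exact (mem_ball.1 hx).le
      · exact (hC ⟨x, (not_le.1 hxa).le, rfl⟩).trans (le_max_right _ _)
    have hpos : 0 < ‖G x - y‖ := hδ.trans_le (hδG x)
    have hk : max 1 (R / ‖G x - y‖) = R / ‖G x - y‖ := max_eq_right ((one_le_div hpos).2 hle)
    rw [hr, dist_eq_norm]
    simp only [add_sub_cancel_left, hk, norm_smul, Real.norm_of_nonneg (div_pos hR hpos).le]
    field_simp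

/-- A Lipschitz map close to the identity on a ball covers every slightly smaller ball. -/
lemma ball_subset_image_of_dist_le {g : V → V} {K : ℝ≥0} (hg : LipschitzWith K g) {a : V}
    {ρ e σ : ℝ} (hσ : 0 < σ) (he : 0 ≤ e) (hclose : ∀ x ∈ ball a ρ, dist (g x) x ≤ e) :
    ball a (ρ - σ - e) ⊆ g '' ball a ρ := by
  intro y hy
  set χ : V → ℝ := fun x => max 0 (min 1 ((ρ - dist x a) / σ)) with hχ
  have hχ0 : ∀ x, 0 ≤ χ x := fun x => le_max_left _ _
  have hχ1 : ∀ x, χ x ≤ 1 := fun x => max_le zero_le_one (min_le_left _ _)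
  have hχout : ∀ x, ρ ≤ dist x a → χ x = 0 := fun x hx =>
    max_eq_left ((min_le_right _ _).trans (div_nonpos_of_nonpos_of_nonneg (by linarith) hσ.le))
  have hχin : ∀ x, dist x a ≤ ρ - σ → χ x = 1 := fun x hx => by
    have : 1 ≤ (ρ - dist x a) / σ := (one_le_div hσ).2 (by linarith)
    simp [hχ, min_eq_left this]
  have hχL : ∀ x x', |χ x - χ x'| ≤ σ⁻¹ * dist x x' := fun x x' => by
    have h1 := abs_max_sub_max_le_max 0 (min 1 ((ρ - dist x a) / σ)) 0
      (min 1 ((ρ - dist x' a) / σ))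
    have h2 := abs_min_sub_min_le_max 1 ((ρ - dist x a) / σ) 1 ((ρ - dist x' a) / σ)
    have h3 : |(ρ - dist x a) / σ - (ρ - dist x' a) / σ| ≤ σ⁻¹ * dist x x' := by
      rw [← sub_div, abs_div, abs_of_pos hσ, div_eq_inv_mul]
      gcongr
      rw [sub_sub_sub_comm, sub_self, zero_sub, abs_neg]
      exact abs_dist_sub_le x x' a
    rw [sub_self, abs_zero, max_eq_right (a := (0 : ℝ)) (abs_nonneg (_ - _))] at h1 h2
    exact h1.trans (h2.trans h3)
  set w : V → V := fun x => g x - x with hw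
  have hwL : LipschitzWith (K + 1) w := hg.sub LipschitzWith.id
  have hwe : ∀ x ∈ ball a ρ, ‖w x‖ ≤ e := fun x hx => by
    rw [hw, ← dist_eq_norm]
    exact hclose x hx
  have hbase : ∀ x ∈ ball a ρ, ∀ x', ‖χ x • w x - χ x' • w x'‖
      ≤ (σ⁻¹ * e + (K + 1)) * dist x x' := fun x hx x' => by
    calc ‖χ x • w x - χ x' • w x'‖ = ‖(χ x - χ x') • w x + χ x' • (w x - w x')‖ := by
          congr 1; module
      _ ≤ |χ x - χ x'| * ‖w x‖ + χ x' * ‖w x - w x'‖ := by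
          refine (norm_add_le _ _).trans_eq ?_
          rw [norm_smul, norm_smul, Real.norm_of_nonneg (hχ0 x'), Real.norm_eq_abs]
      _ ≤ (σ⁻¹ * dist x x') * e + 1 * ((K + 1) * dist x x') := by
          gcongr
          · exact hχL x x'
          · exact hwe x hx
          · exact hχ1 x'
          · rw [← dist_eq_norm]
            simpa using hwL.dist_le_mul x x'
      _ = _ := by ring
  have hχwL : LipschitzWith (σ⁻¹ * e + (K + 1)).toNNReal (fun x => χ x • w x) := by
    refine LipschitzWith.of_dist_le_mul fun x x' => ?_
    rw [Real.coe_toNNReal _ (by positivity)]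
    by_cases hx : x ∈ ball a ρ
    · rw [dist_eq_norm]
      exact hbase x hx x'
    by_cases hx' : x' ∈ ball a ρ
    · rw [dist_comm, dist_eq_norm, dist_comm x]
      exact hbase x' hx' x
    · rw [hχout x (not_lt.1 hx), hχout x' (not_lt.1 hx')]
      simp only [zero_smul, dist_self]
      positivity
  obtain ⟨x, hx⟩ := surjective_of_lipschitz_of_eq_id_outside_ball
    (LipschitzWith.id.add hχwL) (a := a) (ρ := ρ)
    (fun x hx => by simp [hχout x hx]) y
  have hx' : x + χ x • w x = y := hx
  have hnorm : ‖χ x • w x‖ ≤ e := by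
    by_cases hxb : x ∈ ball a ρ
    · rw [norm_smul, Real.norm_of_nonneg (hχ0 x)]
      exact (mul_le_of_le_one_left (norm_nonneg _) (hχ1 x)).trans (hwe x hxb)
    · simpa [hχout x (not_lt.1 hxb)] using he
  have hdist : dist x a ≤ ρ - σ := by
    have h1 := dist_triangle x y a
    have h2 : dist x y ≤ e := by rw [← hx', dist_self_add_right]; exact hnorm
    have h3 := mem_ball.1 hy
    linarith
  refine ⟨x, mem_ball.2 (by linarith), ?_⟩
  rw [← hx', hχin x hdist, one_smul, add_sub_cancel]

end Surjectivity

/-! ### Lower semicontinuity in the top-dimensional case -/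

section TopDimensional

instance isAddHaarMeasure_hausdorffMeasure_En (m : ℕ) :
    (μH[(m : ℝ)] : Measure (En m)).IsAddHaarMeasure := by
  have := isAddHaarMeasure_hausdorffMeasure (E := En m)
  rwa [finrank_euclideanSpace_fin] at this

lemma hausdorffMeasure_closedBall_mul {m : ℕ} (x y : En m) {s r : ℝ} (hs : 0 ≤ s) (hr : 0 ≤ r) :
    μH[m] (closedBall y (s * r)) = ENNReal.ofReal (s ^ m) * μH[m] (closedBall x r) := by
  rw [Measure.addHaar_closedBall_mul _ _ hs hr, Measure.addHaar_closedBall_center _ x,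
    finrank_euclideanSpace_fin]

/-- A Lipschitz map which is close to the identity on a set of almost full measure in a ball has an
image of almost full measure in this ball. -/
lemma measure_closedBall_le_image_inter {m : ℕ} {C : ℝ≥0} {h : En m → En m}
    (hh : LipschitzWith C h) {K : Set (En m)} {x : En m} {r ε δ : ℝ} (hr : 0 < r) (hε : 0 < ε)
    (hεC : (C + 4) * ε < 1) (hδε : δ < ε ^ m)
    (hK : μH[m] (closedBall x r \ K) ≤ ENNReal.ofReal δ * μH[m] (closedBall x r))
    (hclose : ∀ z ∈ K ∩ closedBall x r, dist (h z) z ≤ ε * r) :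
    ENNReal.ofReal ((1 - (C + 4) * ε) ^ m) * μH[m] (closedBall x r) ≤
      μH[m] (h '' (K ∩ closedBall x r) ∩ closedBall x r) +
        ENNReal.ofReal (C ^ m * δ) * μH[m] (closedBall x r) := by
  have hC0 : (0 : ℝ) ≤ C := C.2
  have hεr : 0 < ε * r := by positivity
  have hBpos : μH[m] (closedBall x r) ≠ 0 := (measure_closedBall_pos _ x hr).ne'
  have hBtop : μH[m] (closedBall x r) ≠ ⊤ := measure_closedBall_lt_top.ne
  have hdense : ∀ y ∈ ball x ((1 - ε) * r), ∃ k ∈ K ∩ closedBall x r, dist y k ≤ ε * r := by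
    intro y hy
    by_contra! hfar
    have hsub : closedBall y (ε * r) ⊆ closedBall x r \ K := by
      intro z hz
      have hzB : z ∈ closedBall x r := by
        have h1 := dist_triangle z y x
        have h2 := mem_ball.1 hy
        have h3 := mem_closedBall.1 hz
        exact mem_closedBall.2 (by linarith)
      refine ⟨hzB, fun hzK => ?_⟩
      have := hfar z ⟨hzK, hzB⟩
      rw [dist_comm] at this
      exact this.not_ge hz
    have hle := (measure_mono hsub).trans hK
    rw [hausdorffMeasure_closedBall_mul x y hε.le hr.le,
      ENNReal.mul_le_mul_iff_left hBpos hBtop,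
      ENNReal.ofReal_le_ofReal_iff'] at hle
    rcases hle with hle | hle
    · linarith
    · exact (pow_pos hε m).not_ge hle
  have hnear : ∀ y ∈ ball x ((1 - ε) * r), dist (h y) y ≤ (C + 2) * (ε * r) := by
    intro y hy
    obtain ⟨k, hk, hyk⟩ := hdense y hy
    have h1 := dist_triangle4 (h y) (h k) k y
    have h2 := hh.dist_le_mul y k
    have h3 := hclose k hk
    have h4 : C * dist y k ≤ C * (ε * r) := by gcongr
    rw [dist_comm k y] at h1
    linarith
  have hcover := ball_subset_image_of_dist_le hh hεr (by positivity) hnear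
  have hrad : (1 - ε) * r - ε * r - (C + 2) * (ε * r) = (1 - (C + 4) * ε) * r := by ring
  rw [hrad] at hcover
  have hsub : ball x ((1 - (C + 4) * ε) * r) ⊆
      (h '' (K ∩ closedBall x r) ∩ closedBall x r) ∪ h '' (closedBall x r \ K) := by
    intro y hy
    have hyB : y ∈ closedBall x r := by
      have := mem_ball.1 hy
      refine mem_closedBall.2 (this.le.trans ?_)
      have : 0 ≤ (C + 4) * ε := by positivity
      nlinarith
    obtain ⟨z, hz, rfl⟩ := hcover hy
    have hzB : z ∈ closedBall x r := by
      have := mem_ball.1 hz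
      exact mem_closedBall.2 (by nlinarith)
    by_cases hzK : z ∈ K
    · exact Or.inl ⟨⟨z, ⟨hzK, hzB⟩, rfl⟩, hyB⟩
    · exact Or.inr ⟨z, ⟨hzB, hzK⟩, rfl⟩
  rw [← hausdorffMeasure_closedBall_mul x x (by linarith) hr.le,
    Measure.addHaar_closedBall _ _ (mul_nonneg (by linarith) hr.le),
    ← Measure.addHaar_ball_of_pos _ x (mul_pos (by linarith) hr)]
  refine (measure_mono hsub).trans ((measure_union_le _ _).trans ?_)
  gcongr
  refine (hh.hausdorffMeasure_image_le (Nat.cast_nonneg m) _).trans ?_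
  rw [ENNReal.ofReal_mul (by positivity), mul_assoc, ENNReal.rpow_natCast,
    ENNReal.ofReal_pow hC0, ENNReal.ofReal_coe_nnreal]
  gcongr

lemma exists_mul_measure_closedBall_le_image_inter (m : ℕ) (C : ℝ≥0) {θ : ℝ} (hθ0 : 0 ≤ θ)
    (hθ : θ < 1) : ∃ ε > 0, ∃ δ > 0, ∀ (h : En m → En m), LipschitzWith C h →
      ∀ (K : Set (En m)) (x : En m) (r : ℝ), 0 < r →
      μH[m] (closedBall x r \ K) ≤ ENNReal.ofReal δ * μH[m] (closedBall x r) →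
      (∀ z ∈ K ∩ closedBall x r, dist (h z) z ≤ ε * r) →
      ENNReal.ofReal θ * μH[m] (closedBall x r) ≤
        μH[m] (h '' (K ∩ closedBall x r) ∩ closedBall x r) := by
  have hC0 : (0 : ℝ) ≤ C := C.2
  have hcont : Tendsto (fun ε : ℝ => (1 - (C + 4) * ε) ^ m) (𝓝[>] 0) (𝓝 1) := by
    have : Continuous fun ε : ℝ => (1 - ((C : ℝ) + 4) * ε) ^ m := by fun_prop
    simpa using (this.tendsto 0).mono_left nhdsWithin_le_nhds
  have hcont' : Tendsto (fun ε : ℝ => (C + 4) * ε) (𝓝[>] 0) (𝓝 0) := by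
    have : Continuous fun ε : ℝ => ((C : ℝ) + 4) * ε := by fun_prop
    simpa using (this.tendsto 0).mono_left nhdsWithin_le_nhds
  obtain ⟨ε, hε1, hε2, hε⟩ := ((hcont.eventually_const_lt (show (1 + θ) / 2 < 1 by linarith)).and
    ((hcont'.eventually_lt_const zero_lt_one).and self_mem_nhdsWithin)).exists
  have hε : 0 < ε := hε
  set δ := min (ε ^ m / 2) ((1 - θ) / 2 / (C ^ m + 1)) with hδ
  have hδpos : 0 < δ := lt_min (by positivity) (div_pos (by linarith) (by positivity))
  have hδε : δ < ε ^ m := (min_le_left _ _).trans_lt (half_lt_self (by positivity))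
  have hδC : C ^ m * δ ≤ (1 - θ) / 2 := by
    have h1 : δ * (C ^ m + 1) ≤ (1 - θ) / 2 :=
      (le_div_iff₀ (by positivity)).1 (min_le_right _ _)
    nlinarith
  refine ⟨ε, hε, δ, hδpos, fun h hh K x r hr hK hclose => ?_⟩
  have hmain := measure_closedBall_le_image_inter hh hr hε hε2 hδε hK hclose
  have hBtop : μH[m] (closedBall x r) ≠ ⊤ := measure_closedBall_lt_top.ne
  refine (ENNReal.add_le_add_iff_right
    (ENNReal.mul_ne_top (ENNReal.ofReal_ne_top (r := C ^ m * δ)) hBtop)).1 (le_trans ?_ hmain)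
  rw [← add_mul, ← ENNReal.ofReal_add hθ0 (by positivity)]
  gcongr
  linarith

/-- Lower semicontinuity of the measure of the images of a compact set under uniformly Lipschitz
self-maps of `ℝᵐ` converging to the identity on this set. -/
lemma eventually_lt_hausdorffMeasure_image {m : ℕ} {C : ℝ≥0} {h : ℕ → En m → En m}
    (hh : ∀ i, LipschitzWith C (h i)) {K : Set (En m)} (hK : IsCompact K)
    (hconv : TendstoUniformlyOn h id atTop K) {c : ℝ≥0∞} (hc : c < μH[m] K) :
    ∀ᶠ i in atTop, c < μH[m] (h i '' K) := by
  obtain ⟨θ, hθ0, hθ, hθc⟩ : ∃ θ : ℝ, 0 < θ ∧ θ < 1 ∧ c < ENNReal.ofReal θ * μH[m] K := by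
    have hKtop : μH[m] K ≠ ⊤ := hK.measure_lt_top.ne
    have htend : Tendsto (fun θ : ℝ => ENNReal.ofReal θ * μH[m] K) (𝓝[<] 1)
        (𝓝 (ENNReal.ofReal 1 * μH[m] K)) :=
      (ENNReal.Tendsto.mul_const (ENNReal.tendsto_ofReal tendsto_id) (Or.inr hKtop)).mono_left
        nhdsWithin_le_nhds
    rw [ENNReal.ofReal_one, one_mul] at htend
    obtain ⟨θ, h1, h2, h3⟩ := ((htend.eventually_const_lt hc).and
      (Ioo_mem_nhdsLT (zero_lt_one' ℝ))).exists
    exact ⟨θ, h2, h3, h1⟩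
  obtain ⟨ε, hε, δ, hδ, hball⟩ := exists_mul_measure_closedBall_le_image_inter m C hθ0.le hθ
  set good : En m → Set ℝ := fun x =>
    {r | μH[m] (closedBall x r \ K) ≤ ENNReal.ofReal δ * μH[m] (closedBall x r)} with hgood
  set K₀ : Set (En m) := {x ∈ K | ∀ᶠ r in 𝓝[>] (0 : ℝ), r ∈ good x} with hK₀
  have hK₀ae : μH[m] (K \ K₀) = 0 := by
    have hdens := Besicovitch.ae_tendsto_measure_inter_div (μH[m] : Measure (En m)) K
    rw [ae_restrict_iff' hK.measurableSet] at hdens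
    refine measure_mono_null (fun x hx => ?_) hdens
    intro himp
    refine hx.2 ⟨hx.1, ?_⟩
    have hev := (himp hx.1).eventually_const_lt
      (show 1 - ENNReal.ofReal δ < 1 from
        ENNReal.sub_lt_self ENNReal.one_ne_top one_ne_zero (by simpa using hδ))
    filter_upwards [hev, self_mem_nhdsWithin] with r hr hr0
    have hBpos : μH[m] (closedBall x r) ≠ 0 := (measure_closedBall_pos _ x hr0).ne'
    have hBtop : μH[m] (closedBall x r) ≠ ⊤ := measure_closedBall_lt_top.ne
    have hsplit := measure_inter_add_sdiff (μ := (μH[m] : Measure (En m))) (closedBall x r)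
      hK.measurableSet
    have hle : μH[m] (closedBall x r) ≤ μH[m] (closedBall x r ∩ K) +
        ENNReal.ofReal δ * μH[m] (closedBall x r) := by
      have h1 : (1 - ENNReal.ofReal δ) * μH[m] (closedBall x r) ≤ μH[m] (closedBall x r ∩ K) := by
        rw [inter_comm]
        exact ((ENNReal.lt_div_iff_mul_lt (Or.inl hBpos) (Or.inl hBtop)).1 hr).le
      calc μH[m] (closedBall x r) = 1 * μH[m] (closedBall x r) := (one_mul _).symm
        _ ≤ ((1 - ENNReal.ofReal δ) + ENNReal.ofReal δ) * μH[m] (closedBall x r) := by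
          gcongr
          exact le_tsub_add
        _ ≤ _ := by rw [add_mul]; gcongr
    have hfin : μH[m] (closedBall x r ∩ K) ≠ ⊤ :=
      measure_ne_top_of_subset inter_subset_left hBtop
    exact (ENNReal.add_le_add_iff_left hfin).1 (hsplit.le.trans hle)
  obtain ⟨t, r, htc, htK, htr, hcov, hdisj⟩ :=
    Besicovitch.exists_disjoint_closedBall_covering_ae (μH[m] : Measure (En m)) good K₀
      (fun x hx δ' hδ' => (hx.2.and (Ioo_mem_nhdsGT hδ')).exists) (fun _ => 1)
      (fun _ _ => zero_lt_one)
  have hsum : μH[m] K ≤ ∑' x : t, μH[m] (closedBall (x : En m) (r x)) := by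
    have : Countable t := htc.to_subtype
    calc μH[m] K ≤ μH[m] ((K \ K₀) ∪ ((K₀ \ ⋃ x ∈ t, closedBall x (r x)) ∪
          ⋃ x ∈ t, closedBall x (r x))) := by
          apply measure_mono
          intro x hx
          by_cases h0 : x ∈ K₀
          · by_cases h1 : x ∈ ⋃ x ∈ t, closedBall x (r x)
            · exact Or.inr (Or.inr h1)
            · exact Or.inr (Or.inl ⟨h0, h1⟩)
          · exact Or.inl ⟨hx, h0⟩
      _ ≤ 0 + (0 + μH[m] (⋃ x ∈ t, closedBall x (r x))) := by
          refine (measure_union_le _ _).trans (add_le_add hK₀ae.le ?_)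
          exact (measure_union_le _ _).trans (add_le_add hcov.le le_rfl)
      _ ≤ _ := by
          rw [zero_add, zero_add]
          exact measure_biUnion_le _ htc _
  have hlt : c < ∑' x : t, ENNReal.ofReal θ * μH[m] (closedBall (x : En m) (r x)) := by
    rw [ENNReal.tsum_mul_left]
    exact hθc.trans_le (by gcongr)
  obtain ⟨T, hT⟩ := ((ENNReal.summable.hasSum (α := ℝ≥0∞)).eventually_const_lt hlt).exists
  have hclose : ∀ᶠ i in atTop, ∀ x ∈ T, ∀ z ∈ K, dist (h i z) z ≤ ε * r x := by
    rw [Finset.eventually_all]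
    intro x _
    filter_upwards [Metric.tendstoUniformlyOn_iff.1 hconv (ε * r x)
      (mul_pos hε (htr x x.2).2.1)] with i hi z hz
    rw [dist_comm]
    exact (hi z hz).le
  filter_upwards [hclose] with i hi
  calc c < ∑ x ∈ T, ENNReal.ofReal θ * μH[m] (closedBall (x : En m) (r x)) := hT
    _ ≤ ∑ x ∈ T, μH[m] (h i '' (K ∩ closedBall (x : En m) (r x)) ∩ closedBall (x : En m) (r x)) :=
      Finset.sum_le_sum fun x hx => hball (h i) (hh i) K x (r x) (htr x x.2).2.1 (htr x x.2).1
        fun z hz => hi x hx z hz.1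
    _ = μH[m] (⋃ x ∈ T, h i '' (K ∩ closedBall (x : En m) (r x)) ∩
        closedBall (x : En m) (r x)) := by
      refine (measure_biUnion_finset (fun x _ y _ hxy => ?_) fun x _ => ?_).symm
      · exact (hdisj x.2 y.2 (Subtype.coe_injective.ne hxy)).mono inter_subset_right
          inter_subset_right
      · exact (((hK.inter_right isClosed_closedBall).image (hh i).continuous).inter_right
          isClosed_closedBall).measurableSet
    _ ≤ μH[m] (h i '' K) := by
      apply measure_mono
      exact iUnion₂_subset fun x _ => inter_subset_left.trans (image_mono inter_subset_left)

end TopDimensional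

/-! ### Decomposition of rectifiable sets into flat pieces -/

section Decomposition

/-- `F` is the graph, over a subset of an `m`-dimensional subspace, of a function whose graph map
is `lam`-Lipschitz. -/
def IsFlat {n : ℕ} (m : ℕ) (lam : ℝ≥0) (F : Set (En n)) : Prop :=
  ∃ P : En n →L[ℝ] En m, LipschitzWith 1 P ∧
    ∀ p ∈ F, ∀ q ∈ F, dist p q ≤ lam * dist (P p) (P q)

lemma IsFlat.mono {n m : ℕ} {lam : ℝ≥0} {F G : Set (En n)} (hG : IsFlat m lam G) (h : F ⊆ G) :
    IsFlat m lam F := by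
  obtain ⟨P, hP, hPG⟩ := hG
  exact ⟨P, hP, fun p hp q hq => hPG p (h hp) q (h hq)⟩

lemma isFlat_closure {n m : ℕ} {lam : ℝ≥0} {F : Set (En n)} (hF : IsFlat m lam F) :
    IsFlat m lam (closure F) := by
  obtain ⟨P, hP, hPF⟩ := hF
  have hc : Continuous P := P.continuous
  refine ⟨P, hP, fun p hp q hq => ?_⟩
  have h1 : ∀ p ∈ F, ∀ q ∈ closure F, dist p q ≤ lam * dist (P p) (P q) := fun p hp q hq =>
    le_on_closure (f := fun x => dist p x) (g := fun x => lam * dist (P p) (P x))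
      (hPF p hp) (continuous_const.dist continuous_id).continuousOn
      (continuous_const.mul (continuous_const.dist hc)).continuousOn hq
  exact le_on_closure (f := fun x => dist x q) (g := fun x => lam * dist (P x) (P q))
      (fun p hp => h1 p hp q hq) (continuous_id.dist continuous_const).continuousOn
      (continuous_const.mul (hc.dist continuous_const)).continuousOn hp

lemma exists_lipschitzWith_one_isometric_on_range {n m : ℕ} (A : En m →L[ℝ] En n)
    (hA : Function.Injective A) :
    ∃ P : En n →L[ℝ] En m, LipschitzWith 1 P ∧ ∀ v, ‖P (A v)‖ = ‖A v‖ := by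
  let S := LinearMap.range (A : En m →ₗ[ℝ] En n)
  have hS : Module.finrank ℝ S = m := by
    rw [LinearMap.finrank_range_of_inj hA, finrank_euclideanSpace_fin]
  let b : OrthonormalBasis (Fin m) ℝ S := (stdOrthonormalBasis ℝ S).reindex (finCongr hS)
  refine ⟨(b.repr.toContinuousLinearEquiv : S →L[ℝ] En m) ∘L S.orthogonalProjectionOnto, ?_, ?_⟩
  · have h := b.repr.lipschitz.comp S.lipschitzWith_orthogonalProjectionOnto
    rw [one_mul] at h
    exact h
  · intro v
    have hv : A v ∈ S := ⟨v, rfl⟩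
    have h1 : S.orthogonalProjectionOnto (A v) = ⟨A v, hv⟩ :=
      Submodule.orthogonalProjectionOnto_mem_subspace_eq_self (⟨A v, hv⟩ : S)
    simp [h1]

lemma exists_isFlat_image_of_injective {n m : ℕ} {lam : ℝ≥0} (hlam : 1 < lam)
    (A : En m →L[ℝ] En n) (hA : Function.Injective A) :
    ∃ c : ℝ≥0, c ≠ 0 ∧ ∀ (f : En m → En n) (s : Set (En m)),
      ApproximatesLinearOn f A s c → IsFlat m lam (f '' s) := by
  obtain ⟨P, hP, hPA⟩ := exists_lipschitzWith_one_isometric_on_range A hA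
  obtain ⟨k, hk, hAk⟩ := (A : En m →ₗ[ℝ] En n).exists_antilipschitzWith (LinearMap.ker_eq_bot.2 hA)
  have hlam' : (1 : ℝ) < lam := hlam
  have hk' : (0 : ℝ) < k := hk
  set τ : ℝ := (lam - 1) / (lam + 1) with hτ
  have hτ0 : 0 < τ := div_pos (by linarith) (by linarith)
  have hτlam : 1 + τ = lam * (1 - τ) := by
    rw [hτ]; field_simp; ring
  refine ⟨(τ / k).toNNReal, by simpa using div_pos hτ0 hk', fun f s hf => ⟨P, hP, ?_⟩⟩
  rintro _ ⟨x, hx, rfl⟩ _ ⟨y, hy, rfl⟩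
  have herr : ‖f x - f y - A (x - y)‖ ≤ τ * ‖A (x - y)‖ := by
    have h1 := hf x hx y hy
    rw [Real.coe_toNNReal _ (by positivity)] at h1
    have h2 : ‖x - y‖ ≤ k * ‖A (x - y)‖ := by
      simpa [dist_eq_norm] using hAk.le_mul_dist (x - y) 0
    calc _ ≤ τ / k * ‖x - y‖ := h1
      _ ≤ τ / k * (k * ‖A (x - y)‖) := by gcongr
      _ = τ * ‖A (x - y)‖ := by field_simp
  set e := f x - f y - A (x - y) with he
  have hfe : f x - f y = A (x - y) + e := by rw [he]; abel
  have hPe : ‖P e‖ ≤ ‖e‖ := by simpa using hP.norm_sub_le e 0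
  rw [dist_eq_norm, dist_eq_norm, ← map_sub, hfe, map_add]
  calc ‖A (x - y) + e‖ ≤ ‖A (x - y)‖ + ‖e‖ := norm_add_le _ _
    _ ≤ lam * ((1 - τ) * ‖A (x - y)‖) := by rw [← mul_assoc, ← hτlam]; linarith
    _ ≤ lam * ‖P (A (x - y)) + P e‖ := by
      gcongr
      have := norm_sub_le_norm_add (P (A (x - y))) (P e)
      rw [hPA] at this
      linarith

lemma exists_hausdorffMeasure_image_le_of_not_injective {n m : ℕ} (A : En m →L[ℝ] En n)
    (hA : ¬ Function.Injective A) {ε : ℝ≥0} (hε : ε ≠ 0) :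
    ∃ c : ℝ≥0, c ≠ 0 ∧ ∀ (f : En m → En n) (s : Set (En m)),
      ApproximatesLinearOn f A s c → μH[m] (f '' s) ≤ ε * μH[m] s := by
  obtain ⟨v, hv1, hAv⟩ : ∃ v : En m, ‖v‖ = 1 ∧ A v = 0 := by
    obtain ⟨v, hv, hv0⟩ : ∃ v, A v = 0 ∧ v ≠ 0 := by
      by_contra! h
      exact hA ((injective_iff_map_eq_zero A).2 h)
    exact ⟨(‖v‖⁻¹ : ℝ) • v, norm_smul_inv_norm hv0, by simp [hv]⟩
  set T : ℝ → (En m →L[ℝ] En m) := fun c => 1 - (1 - c) • (innerSL ℝ v).smulRight v with hT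
  have hTapp : ∀ c z, T c z = z - ((1 - c) * inner ℝ v z) • v := fun c z => by
    simp [hT, smul_smul]
  have hT0 : (T 0).det = 0 := by
    by_contra hdet
    have hunit : IsUnit (T 0 : En m →ₗ[ℝ] En m) :=
      (LinearMap.isUnit_iff_isUnit_det _).2 (isUnit_iff_ne_zero.2 hdet)
    have hinj := ((Module.End.isUnit_iff _).1 hunit).1
    have h0 : (T 0 : En m →ₗ[ℝ] En m) v = (T 0 : En m →ₗ[ℝ] En m) 0 := by
      rw [map_zero]
      change T 0 v = 0
      rw [hTapp]
      simp [hv1]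
    have := hinj h0
    simp [this] at hv1
  have hTcont : Tendsto (fun c : ℝ => (‖A‖ + 1) ^ m * |(T c).det|) (𝓝[>] 0) (𝓝 0) := by
    have hc : Continuous fun c : ℝ => (‖A‖ + 1) ^ m * |(T c).det| := by
      have : Continuous T := by fun_prop
      exact continuous_const.mul (ContinuousLinearMap.continuous_det.comp this).abs
    simpa [hT0] using (hc.tendsto 0).mono_left nhdsWithin_le_nhds
  obtain ⟨c, hcε, hc0, hc1⟩ := ((hTcont.eventually_lt_const
    (show (0 : ℝ) < ε from NNReal.coe_pos.2 (pos_iff_ne_zero.2 hε))).and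
    (Ioo_mem_nhdsGT (zero_lt_one' ℝ))).exists
  refine ⟨c.toNNReal, by simpa using hc0, fun f s hf => ?_⟩
  have hlow : ∀ z, c * ‖z‖ ≤ ‖T c z‖ := by
    intro z
    rcases eq_or_ne z 0 with rfl | hz
    · simp
    have h1 : inner ℝ (T c z) z = ‖z‖ ^ 2 - (1 - c) * inner ℝ v z ^ 2 := by
      rw [hTapp, inner_sub_left, inner_smul_left, real_inner_self_eq_norm_sq]
      simp
      ring
    have h2 := real_inner_le_norm (T c z) z
    have h3 := abs_real_inner_le_norm v z
    rw [hv1, one_mul] at h3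
    have h4 : inner ℝ v z ^ 2 ≤ ‖z‖ ^ 2 := sq_le_sq' (abs_le.1 h3).1 (abs_le.1 h3).2
    have hzpos : 0 < ‖z‖ := norm_pos_iff.2 hz
    refine le_of_mul_le_mul_right ?_ hzpos
    nlinarith
  have hTinj : Function.Injective (T c) := by
    refine (injective_iff_map_eq_zero _).2 fun z hz => ?_
    have := hlow z
    rw [hz, norm_zero] at this
    exact norm_le_zero_iff.1 (nonpos_of_mul_nonpos_right this hc0)
  set g : En m → En n := f ∘ Function.invFun (T c) with hg
  have hgT : ∀ x, g (T c x) = f x := fun x => by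
    rw [hg, Function.comp_apply, Function.leftInverse_invFun hTinj x]
  have hgL : LipschitzOnWith (‖A‖₊ + 1) g (T c '' s) := by
    refine LipschitzOnWith.of_dist_le_mul ?_
    rintro _ ⟨x, hx, rfl⟩ _ ⟨y, hy, rfl⟩
    rw [hgT, hgT, dist_eq_norm, dist_eq_norm, ← map_sub]
    have h1 := hf x hx y hy
    rw [Real.coe_toNNReal _ hc0.le] at h1
    have h2 : A (x - y) = A (T c (x - y)) := by
      rw [hTapp c (x - y), A.map_sub _ (_ • v), A.map_smul, hAv, smul_zero, sub_zero]
    calc ‖f x - f y‖ = ‖A (x - y) + (f x - f y - A (x - y))‖ := by congr 1; abel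
      _ ≤ ‖A (T c (x - y))‖ + c * ‖x - y‖ := by
        refine (norm_add_le _ _).trans ?_
        rw [← h2]
        gcongr
      _ ≤ ‖A‖ * ‖T c (x - y)‖ + ‖T c (x - y)‖ := add_le_add (A.le_opNorm _) (hlow _)
      _ = _ := by push_cast; ring
  have himg : f '' s = g '' (T c '' s) := by
    rw [image_image]
    simp_rw [hgT]
  rw [himg]
  refine (hgL.hausdorffMeasure_image_le (Nat.cast_nonneg m)).trans ?_
  rw [Measure.addHaar_image_continuousLinearMap, ← mul_assoc]
  gcongr
  rw [ENNReal.rpow_natCast, ← ENNReal.ofReal_coe_nnreal, ← ENNReal.ofReal_pow (by positivity),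
    ← ENNReal.ofReal_mul (by positivity), ← ENNReal.ofReal_coe_nnreal]
  exact ENNReal.ofReal_le_ofReal (by push_cast; exact hcε.le)

/-- The image of the set of points where the derivative is not injective is negligible. -/
lemma hausdorffMeasure_image_eq_zero_of_fderiv_not_injective {n m : ℕ} {f : En m → En n}
    {Z : Set (En m)} (hd : ∀ x ∈ Z, DifferentiableAt ℝ f x)
    (hZ : ∀ x ∈ Z, ¬ Function.Injective (fderiv ℝ f x)) : μH[m] (f '' Z) = 0 := by
  have hbounded : ∀ (R : ℕ) (ε : ℝ≥0), ε ≠ 0 →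
      μH[m] (f '' (Z ∩ ball 0 R)) ≤ ε * μH[m] (ball (0 : En m) R) := by
    intro R ε hε
    have hex : ∀ A : En m →L[ℝ] En n, ∃ c : ℝ≥0, c ≠ 0 ∧ (¬ Function.Injective A →
        ∀ s : Set (En m), ApproximatesLinearOn f A s c → μH[m] (f '' s) ≤ ε * μH[m] s) := by
      intro A
      by_cases hA : Function.Injective A
      · exact ⟨1, one_ne_zero, fun h => absurd hA h⟩
      · obtain ⟨c, hc, h⟩ := exists_hausdorffMeasure_image_le_of_not_injective A hA hε
        exact ⟨c, hc, fun _ => h f⟩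
    choose c hc0 hc using hex
    rcases (Z ∩ ball 0 (R : ℝ)).eq_empty_or_nonempty with hempty | hne
    · simp [hempty]
    obtain ⟨t, A, htd, htm, hcov, happ, hAy⟩ :=
      exists_partition_approximatesLinearOn_of_hasFDerivWithinAt f (Z ∩ ball 0 (R : ℝ))
        (fderiv ℝ f) (fun x hx => (hd x hx.1).hasFDerivAt.hasFDerivWithinAt) c hc0
    have hAinj : ∀ k, ¬ Function.Injective (A k) := fun k => by
      obtain ⟨y, hy, hAk⟩ := hAy hne k
      rw [hAk]
      exact hZ y hy.1
    calc μH[m] (f '' (Z ∩ ball 0 R)) ≤ μH[m] (⋃ k, f '' (Z ∩ ball 0 R ∩ t k)) := by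
          rw [← image_iUnion, ← inter_iUnion]
          exact measure_mono (image_mono (subset_inter Subset.rfl hcov))
      _ ≤ ∑' k, μH[m] (f '' (Z ∩ ball 0 R ∩ t k)) := measure_iUnion_le _
      _ ≤ ∑' k, ε * μH[m] (ball 0 R ∩ t k) := by
          refine ENNReal.tsum_le_tsum fun k => (hc (A k) (hAinj k) _ (happ k)).trans ?_
          gcongr
          exact inter_subset_right
      _ = ε * μH[m] (⋃ k, ball (0 : En m) R ∩ t k) := by
          rw [ENNReal.tsum_mul_left, measure_iUnion
            (fun i j hij => (htd hij).mono inter_subset_right inter_subset_right)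
            fun k => measurableSet_ball.inter (htm k)]
      _ ≤ ε * μH[m] (ball (0 : En m) R) := by
          gcongr
          exact iUnion_subset fun k => inter_subset_left
  have hzero : ∀ R : ℕ, μH[m] (f '' (Z ∩ ball 0 R)) = 0 := by
    intro R
    have hfin : μH[m] (ball (0 : En m) R) ≠ ⊤ := measure_ball_lt_top.ne
    have hlim : Tendsto (fun ε : ℝ≥0 => (ε : ℝ≥0∞) * μH[m] (ball (0 : En m) R)) (𝓝[>] 0)
        (𝓝 ((0 : ℝ≥0) * μH[m] (ball (0 : En m) R))) :=
      (ENNReal.Tendsto.mul_const (ENNReal.tendsto_coe.2 tendsto_id) (Or.inr hfin)).mono_left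
        nhdsWithin_le_nhds
    rw [ENNReal.coe_zero, zero_mul] at hlim
    exact nonpos_iff_eq_zero.1 (ge_of_tendsto hlim
      (eventually_nhdsWithin_of_forall fun ε hε => hbounded R ε (ne_of_gt hε)))
  have hunion : f '' Z ⊆ ⋃ R : ℕ, f '' (Z ∩ ball 0 R) := by
    rw [← image_iUnion, ← inter_iUnion, iUnion_ball_nat, inter_univ]
  exact measure_mono_null hunion (measure_iUnion_null hzero)

lemma exists_isClosed_isFlat_cover_range {n m : ℕ} {lam : ℝ≥0} (hlam : 1 < lam)
    {f : En m → En n} {L : ℝ≥0} (hf : LipschitzWith L f) :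
    ∃ F : ℕ → Set (En n), (∀ k, IsClosed (F k)) ∧ (∀ k, IsFlat m lam (F k)) ∧
      μH[m] (range f \ ⋃ k, F k) = 0 := by
  set D : Set (En m) := {x | DifferentiableAt ℝ f x}
  set S : Set (En m) := {x ∈ D | Function.Injective (fderiv ℝ f x)}
  have hnull : μH[m] (f '' Dᶜ) = 0 := by
    have h0 : μH[m] Dᶜ = 0 := hf.ae_differentiableAt (μ := (μH[m] : Measure (En m)))
    have h1 := hf.hausdorffMeasure_image_le (Nat.cast_nonneg m) Dᶜ
    rwa [h0, mul_zero, nonpos_iff_eq_zero] at h1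
  have hsing : μH[m] (f '' (D \ S)) = 0 :=
    hausdorffMeasure_image_eq_zero_of_fderiv_not_injective (fun x hx => hx.1)
      fun x hx h => hx.2 ⟨hx.1, h⟩
  have hex : ∀ A : En m →L[ℝ] En n, ∃ c : ℝ≥0, c ≠ 0 ∧ (Function.Injective A →
      ∀ s : Set (En m), ApproximatesLinearOn f A s c → IsFlat m lam (f '' s)) := by
    intro A
    by_cases hA : Function.Injective A
    · obtain ⟨c, hc, h⟩ := exists_isFlat_image_of_injective hlam A hA
      exact ⟨c, hc, fun _ => h f⟩
    · exact ⟨1, one_ne_zero, fun h => absurd h hA⟩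
  choose c hc0 hc using hex
  obtain ⟨t, A, -, -, hcov, happ, hAy⟩ :=
    exists_partition_approximatesLinearOn_of_hasFDerivWithinAt f S (fderiv ℝ f)
      (fun x hx => (DifferentiableAt.hasFDerivAt hx.1).hasFDerivWithinAt) c hc0
  refine ⟨fun k => closure (f '' (S ∩ t k)), fun k => isClosed_closure, fun k => ?_, ?_⟩
  · refine isFlat_closure ?_
    rcases S.eq_empty_or_nonempty with hempty | hne
    · rw [hempty, empty_inter, image_empty]
      exact ⟨0, LipschitzWith.const' 0, fun p hp => absurd hp (notMem_empty p)⟩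
    · obtain ⟨y, hy, hAk⟩ := hAy hne k
      exact hc (A k) (hAk ▸ hy.2) _ (happ k)
  · refine measure_mono_null ?_ (measure_union_null hnull hsing)
    rintro _ ⟨⟨x, rfl⟩, hx⟩
    by_cases hxD : x ∈ D
    · refine Or.inr ⟨x, ⟨hxD, fun hxS => hx ?_⟩, rfl⟩
      obtain ⟨k, hk⟩ := mem_iUnion.1 (hcov hxS)
      exact mem_iUnion.2 ⟨k, subset_closure ⟨x, ⟨hxS, hk⟩, rfl⟩⟩
    · exact Or.inl ⟨x, hxD, rfl⟩

lemma IsRectifiable.exists_isClosed_isFlat_cover {n m : ℕ} {E : Set (En n)}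
    (hE : IsRectifiable n m E) {lam : ℝ≥0} (hlam : 1 < lam) :
    ∃ F : ℕ → Set (En n), (∀ k, IsClosed (F k)) ∧ (∀ k, IsFlat m lam (F k)) ∧
      μH[m] (E \ ⋃ k, F k) = 0 := by
  obtain ⟨f, hf, hnull⟩ := hE
  have hex : ∀ i, ∃ F : ℕ → Set (En n), (∀ k, IsClosed (F k)) ∧ (∀ k, IsFlat m lam (F k)) ∧
      μH[m] (range (f i) \ ⋃ k, F k) = 0 := fun i => by
    obtain ⟨L, hL⟩ := hf i
    exact exists_isClosed_isFlat_cover_range hlam hL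
  choose F hFc hFf hF0 using hex
  refine ⟨fun k => F k.unpair.1 k.unpair.2, fun k => hFc _ _, fun k => hFf _ _, ?_⟩
  refine measure_mono_null ?_ (measure_union_null hnull (measure_iUnion_null hF0))
  rintro x ⟨hxE, hx⟩
  by_cases hxf : x ∈ ⋃ i, range (f i)
  · obtain ⟨i, hi⟩ := mem_iUnion.1 hxf
    refine Or.inr (mem_iUnion.2 ⟨i, hi, fun hxF => hx ?_⟩)
    obtain ⟨k, hk⟩ := mem_iUnion.1 hxF
    exact mem_iUnion.2 ⟨Nat.pair i k, by simpa using hk⟩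
  · exact Or.inl ⟨hxE, hxf⟩

end Decomposition

/-! ### Lower semicontinuity of the measure of images -/

section LowerSemicontinuity

variable {n m : ℕ} {lam L : ℝ≥0} {ψ : ℕ → En n → En n}

lemma eventually_hausdorffMeasure_le_of_isFlat (hlip : ∀ i, LipschitzWith L (ψ i))
    (hconv : TendstoUniformly ψ id atTop) {K : Set (En n)} (hK : IsCompact K)
    (hflat : IsFlat m lam K) {ε : ℝ≥0∞} (hε : ε ≠ 0) :
    ∀ᶠ i in atTop, μH[m] K ≤ (lam : ℝ≥0∞) ^ m * μH[m] (ψ i '' K) + ε := by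
  obtain ⟨P, hP, hPK⟩ := hflat
  have hinj : InjOn P K := fun p hp q hq hpq => by
    have := hPK p hp q hq
    rw [hpq, dist_self, mul_zero] at this
    exact dist_le_zero.1 this
  have hinv : ∀ p ∈ K, Function.invFunOn P K (P p) = p := hinj.leftInvOn_invFunOn
  have hlipinv : LipschitzOnWith lam (Function.invFunOn P K) (P '' K) := by
    refine LipschitzOnWith.of_dist_le_mul ?_
    rintro _ ⟨p, hp, rfl⟩ _ ⟨q, hq, rfl⟩
    rw [hinv p hp, hinv q hq]
    exact hPK p hp q hq
  obtain ⟨g, hg, hgeq⟩ := hlipinv.extend_finite_dimension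
  have hgP : ∀ p ∈ K, g (P p) = p := fun p hp => by
    rw [← hgeq (mem_image_of_mem P hp), hinv p hp]
  have hKle : μH[m] K ≤ (lam : ℝ≥0∞) ^ m * μH[m] (P '' K) := by
    have h := hlipinv.hausdorffMeasure_image_le (Nat.cast_nonneg m)
    rwa [hinj.invFunOn_image Subset.rfl, ENNReal.rpow_natCast] at h
  rcases eq_or_ne (μH[m] (P '' K)) 0 with h0 | h0
  · refine Eventually.of_forall fun i => ?_
    rw [h0, mul_zero] at hKle
    exact hKle.trans zero_le
  have hPKc : IsCompact (P '' K) := hK.image P.continuous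
  have hδ : ε / ((lam : ℝ≥0∞) ^ m + 1) ≠ 0 :=
    (ENNReal.div_pos hε (by finiteness)).ne'
  have hlt := ENNReal.sub_lt_self hPKc.measure_lt_top.ne h0 hδ
  have hconv' : TendstoUniformlyOn (fun i => P ∘ ψ i ∘ g) id atTop (P '' K) := by
    refine Metric.tendstoUniformlyOn_iff.2 fun r hr => ?_
    filter_upwards [Metric.tendstoUniformly_iff.1 hconv r hr] with i hi
    rintro _ ⟨p, hp, rfl⟩
    simp only [Function.comp_apply, hgP p hp, id]
    exact (by simpa using hP.dist_le_mul p (ψ i p) : _ ≤ dist p (ψ i p)).trans_lt (hi p)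
  filter_upwards [eventually_lt_hausdorffMeasure_image
    (fun i => hP.comp ((hlip i).comp hg)) hPKc hconv' hlt] with i hi
  have himg : (P ∘ ψ i ∘ g) '' (P '' K) = P '' (ψ i '' K) := by
    simp only [image_image, Function.comp_apply]
    exact image_congr fun p hp => by rw [hgP p hp]
  have hle : μH[m] (P '' (ψ i '' K)) ≤ μH[m] (ψ i '' K) := by
    simpa using hP.hausdorffMeasure_image_le (Nat.cast_nonneg m) (ψ i '' K)
  rw [himg] at hi
  calc μH[m] K ≤ (lam : ℝ≥0∞) ^ m * μH[m] (P '' K) := hKle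
    _ ≤ (lam : ℝ≥0∞) ^ m * (μH[m] (ψ i '' K) + ε / ((lam : ℝ≥0∞) ^ m + 1)) := by
      gcongr
      exact tsub_le_iff_right.1 (hi.le.trans hle)
    _ ≤ (lam : ℝ≥0∞) ^ m * μH[m] (ψ i '' K) + ε := by
      rw [mul_add]
      gcongr
      calc _ ≤ ((lam : ℝ≥0∞) ^ m + 1) * (ε / ((lam : ℝ≥0∞) ^ m + 1)) := by
            gcongr
            exact le_self_add
        _ ≤ ε := ENNReal.mul_div_le

lemma eventually_disjoint_image (hconv : TendstoUniformly ψ id atTop) {K K' : Set (En n)}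
    (hK : IsCompact K) (hK' : IsClosed K') (hdisj : Disjoint K K') :
    ∀ᶠ i in atTop, Disjoint (ψ i '' K) (ψ i '' K') := by
  obtain ⟨δ, hδ, hthick⟩ := hdisj.exists_thickenings hK hK'
  filter_upwards [Metric.tendstoUniformly_iff.1 hconv δ hδ] with i hi
  have hsub : ∀ s : Set (En n), ψ i '' s ⊆ thickening δ s := by
    rintro s _ ⟨x, hx, rfl⟩
    exact mem_thickening_iff.2 ⟨x, hx, by simpa [dist_comm] using hi x⟩
  exact hthick.mono (hsub K) (hsub K')

lemma eventually_hausdorffMeasure_le_of_isFlat_cover (hlip : ∀ i, LipschitzWith L (ψ i))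
    (hconv : TendstoUniformly ψ id atTop) {E : Set (En n)} (hE : MeasurableSet E)
    (hfin : μH[m] E < ⊤) {F : ℕ → Set (En n)} (hFc : ∀ k, IsClosed (F k))
    (hFf : ∀ k, IsFlat m lam (F k)) (hF : μH[m] (E \ ⋃ k, F k) = 0) {ε : ℝ≥0∞} (hε : ε ≠ 0) :
    ∀ᶠ i in atTop, μH[m] E ≤ (lam : ℝ≥0∞) ^ m * μH[m] (ψ i '' E) + ε := by
  have hε3 : ε / 3 ≠ 0 := (ENNReal.div_pos hε (by finiteness)).ne'
  set D : ℕ → Set (En n) := fun k => E ∩ disjointed F k with hD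
  have hDm : ∀ k, MeasurableSet (D k) := fun k =>
    hE.inter (MeasurableSet.disjointed (fun k => (hFc k).measurableSet) k)
  have hDd : Pairwise (Function.onFun Disjoint D) := fun j k hjk =>
    (disjoint_disjointed F hjk).mono inter_subset_right inter_subset_right
  have hsum : μH[m] E ≤ ∑' k, μH[m] (D k) := by
    rw [← measure_iUnion hDd hDm, hD, ← inter_iUnion, iUnion_disjointed]
    calc μH[m] E ≤ μH[m] (E ∩ ⋃ k, F k) + μH[m] (E \ ⋃ k, F k) := measure_le_inter_add_sdiff _ _ _
      _ = _ := by rw [hF, add_zero]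
  obtain ⟨N, hN⟩ : ∃ N, μH[m] E ≤ ∑ k ∈ Finset.range N, μH[m] (D k) + ε / 3 := by
    rcases eq_or_ne (μH[m] E) 0 with h0 | h0
    · exact ⟨0, h0 ▸ zero_le⟩
    have hlt := (ENNReal.sub_lt_self hfin.ne h0 hε3).trans_le hsum
    obtain ⟨N, hN⟩ :=
      ((ENNReal.tendsto_nat_tsum fun k => μH[m] (D k)).eventually_const_lt hlt).exists
    exact ⟨N, tsub_le_iff_right.1 hN.le⟩
  obtain ⟨e, he0, he⟩ := ENNReal.exists_pos_sum_of_countable' hε3 ℕ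
  have hcompact : ∀ k, ∃ K ⊆ D k, IsCompact K ∧ μH[m] (D k) ≤ μH[m] K + e k := by
    intro k
    have : IsFiniteMeasure ((μH[m] : Measure (En n)).restrict E) := ⟨by simpa using hfin⟩
    obtain ⟨K, hKD, hK, hlt⟩ := (hDm k).exists_isCompact_lt_add
      (measure_ne_top ((μH[m] : Measure (En n)).restrict E) (D k)) (he0 k).ne'
    rw [Measure.restrict_eq_self _ inter_subset_left,
      Measure.restrict_eq_self _ (hKD.trans inter_subset_left)] at hlt
    exact ⟨K, hKD, hK, hlt.le⟩
  choose K hKD hK hKe using hcompact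
  have hflat : ∀ k, IsFlat m lam (K k) := fun k =>
    (hFf k).mono ((hKD k).trans (inter_subset_right.trans (disjointed_subset F k)))
  have hmeas : ∀ᶠ i in atTop, ∀ k ∈ Finset.range N,
      μH[m] (K k) ≤ (lam : ℝ≥0∞) ^ m * μH[m] (ψ i '' K k) + e k :=
    (Finset.eventually_all _).2 fun k _ =>
      eventually_hausdorffMeasure_le_of_isFlat hlip hconv (hK k) (hflat k) (he0 k).ne'
  have hdisj : ∀ᶠ i in atTop, ∀ j ∈ Finset.range N, ∀ k ∈ Finset.range N, j ≠ k →
      Disjoint (ψ i '' K j) (ψ i '' K k) := by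
    refine (Finset.eventually_all _).2 fun j _ => (Finset.eventually_all _).2 fun k _ => ?_
    rcases eq_or_ne j k with rfl | hjk
    · simp
    · filter_upwards [eventually_disjoint_image hconv (hK j) (hK k).isClosed
        ((hDd hjk).mono (hKD j) (hKD k))] with i hi _ using hi
  filter_upwards [hmeas, hdisj] with i hi hid
  have hesum : ∑ k ∈ Finset.range N, e k ≤ ε / 3 := (ENNReal.sum_le_tsum _).trans he.le
  have himage : ∑ k ∈ Finset.range N, μH[m] (ψ i '' K k) ≤ μH[m] (ψ i '' E) := by
    rw [← measure_biUnion_finset (fun j hj k hk hjk => hid j hj k hk hjk)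
      fun k _ => ((hK k).image (hlip i).continuous).measurableSet]
    exact measure_mono (iUnion₂_subset fun k _ =>
      image_mono ((hKD k).trans inter_subset_left))
  calc μH[m] E ≤ ∑ k ∈ Finset.range N, μH[m] (D k) + ε / 3 := hN
    _ ≤ ∑ k ∈ Finset.range N, ((lam : ℝ≥0∞) ^ m * μH[m] (ψ i '' K k) + e k + e k) + ε / 3 := by
      gcongr with k hk
      exact (hKe k).trans (by gcongr; exact hi k hk)
    _ = (lam : ℝ≥0∞) ^ m * ∑ k ∈ Finset.range N, μH[m] (ψ i '' K k) +
        (∑ k ∈ Finset.range N, e k + ∑ k ∈ Finset.range N, e k + ε / 3) := by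
      rw [Finset.sum_add_distrib, Finset.sum_add_distrib, Finset.mul_sum]
      ring
    _ ≤ (lam : ℝ≥0∞) ^ m * μH[m] (ψ i '' E) + (ε / 3 + ε / 3 + ε / 3) := by gcongr
    _ = (lam : ℝ≥0∞) ^ m * μH[m] (ψ i '' E) + ε := by rw [ENNReal.add_thirds]

end LowerSemicontinuity

theorem stmt0 (n m : ℕ) (E : Set (En n)) (hE : MeasurableSet E)
    (hfin : μH[m] E < ⊤) (η : ℝ≥0∞) (hη : 0 < η)
    (ψ : ℕ → En n → En n) (L : NNReal) (hlip : ∀ i, LipschitzWith L (ψ i))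
    (hconv : TendstoUniformly ψ id atTop)
    (hdec : ∀ i, μH[m] (ψ i '' E) < μH[m] E - η) :
    ¬ IsRectifiable n m E := by
  intro hrect
  have hη' : μH[m] E - η < μH[m] E := by
    refine ENNReal.sub_lt_self hfin.ne (fun h0 => ?_) hη.ne'
    simpa [h0] using hdec 0
  have hle : ∀ lam : ℝ≥0, 1 < lam → μH[m] E ≤ (lam : ℝ≥0∞) ^ m * (μH[m] E - η) := by
    intro lam hlam
    obtain ⟨F, hFc, hFf, hF⟩ := hrect.exists_isClosed_isFlat_cover hlam
    refine ENNReal.le_of_forall_pos_le_add fun ε hε _ => ?_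
    obtain ⟨i, hi⟩ := (eventually_hausdorffMeasure_le_of_isFlat_cover hlip hconv hE hfin hFc hFf hF
      (ENNReal.coe_ne_zero.2 hε.ne')).exists
    exact hi.trans (by gcongr; exact (hdec i).le)
  have hlim : Tendsto (fun lam : ℝ≥0 => (lam : ℝ≥0∞) ^ m * (μH[m] E - η)) (𝓝[>] 1)
      (𝓝 (((1 : ℝ≥0) : ℝ≥0∞) ^ m * (μH[m] E - η))) := by
    refine Tendsto.mono_left ?_ nhdsWithin_le_nhds
    refine ENNReal.Tendsto.mul_const ?_ (Or.inr (hη'.trans hfin).ne)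
    exact ENNReal.Tendsto.pow (ENNReal.tendsto_coe.2 tendsto_id)
  rw [ENNReal.coe_one, one_pow, one_mul] at hlim
  exact (ge_of_tendsto hlim (eventually_nhdsWithin_of_forall hle)).not_gt hη'
end
end

section
/- Let E ⊂ ℝⁿ be Hᵐ-measurable with Hᵐ(E) < ∞ and Hᵐ⁺¹(closure E) = 0, and let U ⊂ E be Hᵐ-measurable and purely m-unrectifiable. Then for every ε > 0 there exists a Lipschitz map ψ : ℝⁿ → ℝⁿ such that (1) sup_x |ψ(x) − x| < ε, (2) ψ(x) = x for all x outside the ε-neighborhood of U, (3) Hᵐ(ψ(E \ U)) < Hᵐ(E \ U) + ε, and (4) Hᵐ(ψ(U)) < ε. -/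
open MeasureTheory Metric Set Filter ENNReal

noncomputable section

/-- A set `U` is purely `m`-unrectifiable if `Hᵐ(U ∩ F) = 0` for every `m`-rectifiable `F`. -/
def PurelyUnrectifiable (n m : ℕ) (U : Set (En n)) : Prop :=
  ∀ F : Set (En n), IsRectifiable n m F → μH[m] (U ∩ F) = 0

lemma measure_eq_zero_of_forall_slice_null {G V : Type*} [AddCommGroup G] [MeasurableSpace G]
    [MeasurableAdd₂ G] [MeasurableSpace V] (μ : Measure G) [SFinite μ] [μ.IsAddLeftInvariant]
    (ν : Measure V) [SFinite ν] (hν : ν ≠ 0) {T : V → G} (hT : Measurable T) {S : Set G}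
    (hS : MeasurableSet S) (h : ∀ w, ν {v | w + T v ∈ S} = 0) : μ S = 0 := by
  have hP : MeasurableSet {p : G × V | p.1 + T p.2 ∈ S} :=
    (measurable_fst.add (hT.comp measurable_snd)) hS
  have h0 : (μ.prod ν) {p : G × V | p.1 + T p.2 ∈ S} = 0 := by
    rw [Measure.measure_prod_null hP]
    exact Eventually.of_forall h
  rw [Measure.prod_apply_symm hP] at h0
  have h1 : ∀ v, μ ((fun x => (x, v)) ⁻¹' {p : G × V | p.1 + T p.2 ∈ S}) = μ S := fun v =>
    measure_preimage_add_right μ (T v) S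
  simp only [h1, lintegral_const, mul_eq_zero, Measure.measure_univ_eq_zero] at h0
  exact h0.resolve_right hν

/-- Vitali covering estimate: if the enlarged balls of a family carry little mass of `ξ` compared
with the volume of the balls, then `ξ` is controlled by the volume of their union. -/
lemma outerMeasure_le_of_vitali {m : ℕ} {α ι : Type*} (ξ : OuterMeasure α) (t : Set ι)
    (x : ι → Fin m → ℝ) (r : ι → ℝ) (R : ℝ) (hr : ∀ a ∈ t, 0 < r a ∧ r a ≤ R)
    {G : Set (Fin m → ℝ)} (hG : ∀ a ∈ t, closedBall (x a) (r a) ⊆ G) (p : α → Fin m → ℝ)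
    {Z : Set α} {c : ℝ≥0∞}
    (hC : ∀ a ∈ t, ξ (p ⁻¹' closedBall (x a) (5 * r a) ∩ Z) ≤ c * ENNReal.ofReal ((2 * r a) ^ m))
    (hZ : ∀ z ∈ Z, ∃ a ∈ t, p z ∈ closedBall (x a) (r a)) : ξ Z ≤ c * volume G := by
  obtain ⟨u, hut, hdisj, hcov⟩ := Vitali.exists_disjoint_subfamily_covering_enlargement_closedBall
    t x r R (fun a ha => (hr a ha).2) 5 (by norm_num)
  have hcount : u.Countable := hdisj.countable_of_nonempty_interior fun i hi => by
    refine ⟨x i, interior_maximal ball_subset_closedBall isOpen_ball ?_⟩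
    exact mem_ball_self (hr i (hut hi)).1
  have hsub : Z ⊆ ⋃ a ∈ u, (p ⁻¹' closedBall (x a) (5 * r a) ∩ Z) := by
    intro z hz
    obtain ⟨a, ha, hza⟩ := hZ z hz
    obtain ⟨b, hb, hab⟩ := hcov a ha
    exact mem_biUnion hb ⟨hab hza, hz⟩
  have : Countable u := hcount.to_subtype
  calc ξ Z ≤ ξ (⋃ a ∈ u, (p ⁻¹' closedBall (x a) (5 * r a) ∩ Z)) := measure_mono hsub
    _ ≤ ∑' a : u, ξ (p ⁻¹' closedBall (x a) (5 * r a) ∩ Z) := measure_biUnion_le ξ hcount _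
    _ ≤ ∑' a : u, c * volume (closedBall (x a) (r a)) := by
        refine ENNReal.tsum_le_tsum fun a => ?_
        rw [Real.volume_pi_closedBall _ (hr a (hut a.2)).1.le, Fintype.card_fin]
        exact hC a (hut a.2)
    _ = c * volume (⋃ a ∈ u, closedBall (x a) (r a)) := by
        rw [ENNReal.tsum_mul_left, measure_biUnion hcount hdisj
          fun a _ => measurableSet_closedBall]
    _ ≤ c * volume G := by
        gcongr
        exact iUnion₂_subset fun a ha => hG a (hut ha)

/-- The points at which `ν` has growth of order `m` at small scales, with constant `k`. -/
def growthSet {m : ℕ} (ν : OuterMeasure (Fin m → ℝ)) (k : ℕ) : Set (Fin m → ℝ) :=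
  {v | ∀ t : ℝ, 0 < t → t < 1 / (k + 1) → ν (ball v t) ≤ ENNReal.ofReal (k * t ^ m)}

lemma isClosed_growthSet {m : ℕ} (ν : OuterMeasure (Fin m → ℝ)) (k : ℕ) :
    IsClosed (growthSet ν k) := by
  refine isClosed_of_closure_subset fun v hv t ht htk => ?_
  have hlim : Tendsto (fun s : ℝ => ENNReal.ofReal (k * s ^ m)) (nhdsWithin t (Ioi t))
      (nhds (ENNReal.ofReal (k * t ^ m))) := by
    apply Tendsto.mono_left _ nhdsWithin_le_nhds
    exact (ENNReal.continuous_ofReal.comp (by fun_prop)).tendsto t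
  refine ge_of_tendsto hlim ?_
  filter_upwards [Ioo_mem_nhdsGT htk] with s hs
  obtain ⟨w, hw, hvw⟩ := Metric.mem_closure_iff.1 hv (s - t) (sub_pos.2 hs.1)
  refine (measure_mono ?_).trans (hw s (ht.trans hs.1) hs.2)
  apply ball_subset_ball'
  linarith

lemma outerMeasure_ball_le_of_mem_growthSet {m : ℕ} {ν : OuterMeasure (Fin m → ℝ)} {k : ℕ}
    {H : Set (Fin m → ℝ)} (hν : ν Hᶜ = 0) {v : Fin m → ℝ} (hv : v ∈ growthSet ν k) {t : ℝ}
    (htk : 5 * t < 1 / (k + 1)) (ht : 0 < t) :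
    ν (ball v t) ≤ ENNReal.ofReal (k * 5 ^ m) * volume (ball v (2 * t) \ (growthSet ν k \ H)) := by
  set F := growthSet ν k
  set N := ball v (2 * t) \ (F \ H)
  have hNfin : volume N ≠ ⊤ := ((measure_mono sdiff_subset).trans_lt measure_ball_lt_top).ne
  have key : ν (ball v t) ≤ ν (ball v t \ (F \ H)) := by
    calc ν (ball v t) ≤ ν ((ball v t \ (F \ H)) ∪ Hᶜ) := measure_mono fun y hy => by
          by_cases h : y ∈ F \ H
          · exact Or.inr h.2
          · exact Or.inl ⟨hy, h⟩
      _ ≤ _ := by simpa [hν] using measure_union_le (μ := ν) (ball v t \ (F \ H)) Hᶜ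
  refine key.trans ?_
  have hmain : ∀ ε : ℝ≥0∞, ε ≠ 0 →
      ν (ball v t \ (F \ H)) ≤ ENNReal.ofReal (k * 5 ^ m) * (volume N + ε) := by
    intro ε hε
    obtain ⟨G, hNG, hGo, hGm⟩ := Set.exists_isOpen_lt_add N hNfin hε
    refine le_trans ?_ (mul_le_mul_right hGm.le _)
    have hrad : ∀ y, y ∈ ball v t \ (F \ H) → ∃ ρ : ℝ, 0 < ρ ∧ ρ ≤ t ∧ ball y ρ ⊆ G ∧
        ∃ z ∈ F, dist y z ≤ 2 * ρ := by
      intro y hy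
      by_cases hyF : y ∈ F
      · have hyN : y ∈ N := ⟨ball_subset_ball (by linarith) hy.1, hy.2⟩
        obtain ⟨ρ, hρ, hsub⟩ := Metric.isOpen_iff.1 hGo y (hNG hyN)
        exact ⟨min ρ t, lt_min hρ ht, min_le_right _ _,
          (ball_subset_ball (min_le_left _ _)).trans hsub, y, hyF, by
            rw [dist_self]; linarith [lt_min hρ ht]⟩
      · have hne : F.Nonempty := ⟨v, hv⟩
        have hpos : 0 < infDist y F :=
          ((isClosed_growthSet ν k).notMem_iff_infDist_pos hne).1 hyF
        have hlt : infDist y F < t := (infDist_le_dist_of_mem hv).trans_lt hy.1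
        refine ⟨infDist y F, hpos, hlt.le, fun w hw => hNG ⟨?_, ?_⟩, ?_⟩
        · have := hy.1
          rw [mem_ball] at *
          linarith [dist_triangle w y v]
        · rintro ⟨hwF, -⟩
          have := infDist_le_dist_of_mem (x := y) hwF
          rw [mem_ball, dist_comm] at hw
          linarith
        · obtain ⟨z, hz, hyz⟩ := (infDist_lt_iff hne).1
            (show infDist y F < 2 * infDist y F by linarith)
          exact ⟨z, hz, hyz.le⟩
    choose! ρ hρ0 hρt hρG z hzF hyz using hrad
    refine outerMeasure_le_of_vitali ν (ball v t \ (F \ H)) id (fun y => ρ y / 2) t ?_ ?_ id ?_ ?_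
    · intro y hy
      exact ⟨half_pos (hρ0 y hy), by linarith [hρt y hy, hρ0 y hy]⟩
    · intro y hy
      exact (closedBall_subset_ball (by simpa using hρ0 y hy)).trans (hρG y hy)
    · intro y hy
      have h0 := hρ0 y hy
      have hsub : id ⁻¹' closedBall (id y) (5 * (ρ y / 2)) ∩ (ball v t \ (F \ H)) ⊆
          ball (z y) (5 * ρ y) := by
        rintro w ⟨hw, -⟩
        simp only [preimage_id, id, mem_closedBall] at hw
        rw [mem_ball]
        linarith [dist_triangle w y (z y), hyz y hy]
      refine (measure_mono hsub).trans ((hzF y hy (5 * ρ y) (by positivity) ?_).trans ?_)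
      · linarith [hρt y hy]
      · rw [← ENNReal.ofReal_mul (by positivity)]
        apply ENNReal.ofReal_le_ofReal
        rw [mul_pow]
        apply le_of_eq
        ring_nf
    · intro y hy
      exact ⟨y, hy, mem_closedBall_self (half_pos (hρ0 y hy)).le⟩
  refine ge_of_tendsto (x := nhdsWithin (0 : ℝ≥0∞) (Ioi 0))
    (f := fun ε => ENNReal.ofReal (k * 5 ^ m) * (volume N + ε)) ?_ ?_
  · have : Tendsto (fun ε : ℝ≥0∞ => ENNReal.ofReal (k * 5 ^ m) * (volume N + ε)) (nhds 0)
        (nhds (ENNReal.ofReal (k * 5 ^ m) * (volume N + 0))) :=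
      ENNReal.Tendsto.const_mul (tendsto_const_nhds.add tendsto_id) (Or.inr ENNReal.ofReal_ne_top)
    rw [add_zero] at this
    exact this.mono_left nhdsWithin_le_nhds
  · filter_upwards [self_mem_nhdsWithin] with ε hε
    exact hmain ε (ne_of_gt hε)

/-- An outer measure carried by `H` has, at almost every point off `H`, upper density `0` or
`∞`. -/
lemma ae_mem_or_density_zero_or_top {m : ℕ} (ν : OuterMeasure (Fin m → ℝ))
    {H : Set (Fin m → ℝ)} (hH : MeasurableSet H) (hν : ν Hᶜ = 0) :
    ∀ᵐ v : Fin m → ℝ, v ∈ H ∨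
      (∀ c : ℝ, 0 < c → ∃ t₀ > 0, ∀ t : ℝ, 0 < t → t < t₀ →
        ν (ball v t) ≤ ENNReal.ofReal (c * t ^ m)) ∨
      (∀ k : ℕ, ∃ t : ℝ, 0 < t ∧ t < 1 / (k + 1) ∧ ENNReal.ofReal (k * t ^ m) < ν (ball v t)) := by
  have hae : ∀ᵐ v : Fin m → ℝ, ∀ k : ℕ, Tendsto (fun r =>
      volume ((growthSet ν k \ H)ᶜ ∩ closedBall v r) / volume (closedBall v r))
      (nhdsWithin 0 (Ioi 0)) (nhds ((growthSet ν k \ H)ᶜ.indicator 1 v)) :=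
    ae_all_iff.2 fun k => Besicovitch.ae_tendsto_measure_inter_div_of_measurableSet volume
      ((isClosed_growthSet ν k).measurableSet.diff hH).compl
  filter_upwards [hae] with v hv
  by_cases hvH : v ∈ H
  · exact Or.inl hvH
  by_cases hbig : ∀ k : ℕ, ∃ t : ℝ, 0 < t ∧ t < 1 / (k + 1) ∧
      ENNReal.ofReal (k * t ^ m) < ν (ball v t)
  · exact Or.inr (Or.inr hbig)
  push Not at hbig
  obtain ⟨k, hk⟩ := hbig
  refine Or.inr (Or.inl fun c hc => ?_)
  have hvF : v ∈ growthSet ν k := fun t ht htk => hk t ht htk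
  have hlim := hv k
  rw [indicator_of_notMem (by simpa using ⟨hvF, hvH⟩)] at hlim
  set c' : ℝ := c / (k * 20 ^ m + 1)
  have hc' : 0 < c' := by positivity
  have hev := hlim.eventually (gt_mem_nhds (ENNReal.ofReal_pos.2 hc'))
  obtain ⟨r₀, hr₀, hr⟩ := mem_nhdsGT_iff_exists_Ioo_subset.1 hev
  have hr₀' : (0 : ℝ) < r₀ := hr₀
  refine ⟨min (r₀ / 2) (1 / (5 * (k + 1))), by positivity, fun t ht htt => ?_⟩
  have ht1 : t < r₀ / 2 := htt.trans_le (min_le_left _ _)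
  have ht2 : t < 1 / (5 * (k + 1)) := htt.trans_le (min_le_right _ _)
  have ht3 : 5 * t < 1 / (k + 1) := by
    rw [lt_div_iff₀ (by positivity)] at ht2 ⊢
    linarith
  refine (outerMeasure_ball_le_of_mem_growthSet hν hvF ht3 ht).trans ?_
  have h1 : volume ((growthSet ν k \ H)ᶜ ∩ closedBall v (2 * t)) /
      volume (closedBall v (2 * t)) < ENNReal.ofReal c' :=
    hr (show 2 * t ∈ Ioo 0 r₀ from ⟨by positivity, by linarith⟩)
  have h2 : volume (ball v (2 * t) \ (growthSet ν k \ H)) ≤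
      ENNReal.ofReal c' * ENNReal.ofReal ((2 * (2 * t)) ^ m) := by
    have h3 := (ENNReal.div_le_iff (measure_closedBall_pos volume v (by positivity)).ne'
      measure_closedBall_lt_top.ne).1 h1.le
    rw [Real.volume_pi_closedBall _ (by positivity), Fintype.card_fin] at h3
    refine (measure_mono ?_).trans h3
    rintro y ⟨hy1, hy2⟩
    exact ⟨hy2, ball_subset_closedBall hy1⟩
  refine (mul_le_mul_right h2 _).trans ?_
  rw [← ENNReal.ofReal_mul hc'.le, ← ENNReal.ofReal_mul (by positivity)]
  apply ENNReal.ofReal_le_ofReal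
  have : (k : ℝ) * 5 ^ m * (c' * (2 * (2 * t)) ^ m) = (k * 20 ^ m) * c' * t ^ m := by
    have : (2 * (2 * t)) ^ m = 4 ^ m * t ^ m := by rw [← mul_pow]; ring_nf
    rw [this, show (20 : ℝ) ^ m = 5 ^ m * 4 ^ m by rw [← mul_pow]; norm_num]
    ring
  rw [this]
  have hcc : (k * 20 ^ m) * c' ≤ c := by
    have : (k * 20 ^ m + 1) * c' = c := by simp only [c']; field_simp
    nlinarith
  gcongr

lemma PurelyUnrectifiable.mono {n m : ℕ} {U V : Set (En n)} (h : PurelyUnrectifiable n m U)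
    (hVU : V ⊆ U) : PurelyUnrectifiable n m V := fun F hF =>
  measure_mono_null (inter_subset_inter_left F hVU) (h F hF)

lemma volume_image_le_hausdorffMeasure {X : Type*} [EMetricSpace X] [MeasurableSpace X]
    [BorelSpace X] {m : ℕ} {f : X → Fin m → ℝ} {C : NNReal} (hf : LipschitzWith C f) (S : Set X) :
    volume (f '' S) ≤ (C : ℝ≥0∞) ^ m * μH[m] S := by
  have h := hf.hausdorffMeasure_image_le (d := m) (by positivity) S
  have hv : (μH[(m : ℝ)] : Measure (Fin m → ℝ)) = volume := by
    simpa using hausdorffMeasure_pi_real (ι := Fin m)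
  rwa [hv, ENNReal.rpow_natCast] at h

/-- A set on which a linear map to `ℝᵐ` is bi-Lipschitz is `m`-rectifiable. -/
lemma isRectifiable_of_le_norm_map {n m : ℕ} (L : En n →L[ℝ] (Fin m → ℝ)) {S : Set (En n)}
    {c : ℝ} (hc : 0 < c) (h : ∀ x ∈ S, ∀ y ∈ S, c * ‖x - y‖ ≤ ‖L (x - y)‖) :
    IsRectifiable n m S := by
  have hinj : InjOn L S := fun x hx y hy hxy => by
    have := h x hx y hy
    rw [map_sub, hxy, sub_self, norm_zero] at this
    exact sub_eq_zero.1 (norm_le_zero_iff.1 (by nlinarith [norm_nonneg (x - y)]))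
  have hlip : LipschitzOnWith (Real.toNNReal c⁻¹) (Function.invFunOn L S) (L '' S) := by
    refine LipschitzOnWith.of_dist_le_mul ?_
    rintro _ ⟨x, hx, rfl⟩ _ ⟨y, hy, rfl⟩
    rw [hinj.leftInvOn_invFunOn hx, hinj.leftInvOn_invFunOn hy, dist_eq_norm, dist_eq_norm,
      Real.coe_toNNReal _ (by positivity), ← map_sub, inv_mul_eq_div, le_div_iff₀ hc, mul_comm]
    exact h x hx y hy
  obtain ⟨g, hg, heq⟩ := hlip.extend_finite_dimension
  refine ⟨fun _ y => g y.ofLp, fun _ => ⟨_, hg.comp (PiLp.lipschitzWith_ofLp 2 _)⟩, ?_⟩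
  convert measure_empty (μ := (μH[(m : ℝ)] : Measure (En n)))
  refine sdiff_eq_empty.2 fun x hx => mem_iUnion.2 ⟨0, WithLp.toLp 2 (L x), ?_⟩
  change g (L x) = x
  rw [← heq (mem_image_of_mem L hx), hinj.leftInvOn_invFunOn hx]

/-- The part of the ball of radius `r` around `a` that makes a small angle with the fibre of `L`. -/
def fiberCone {n m : ℕ} (L : En n →L[ℝ] (Fin m → ℝ)) (a : En n) (r s : ℝ) : Set (En n) :=
  {x | dist x a < r ∧ ‖L (x - a)‖ < s * ‖x - a‖}

lemma fiberCone_mono {n m : ℕ} (L : En n →L[ℝ] (Fin m → ℝ)) (a : En n) {r r' s s' : ℝ}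
    (hr : r ≤ r') (hs : s ≤ s') : fiberCone L a r s ⊆ fiberCone L a r' s' := fun x hx =>
  ⟨hx.1.trans_le hr, hx.2.trans_le (by gcongr)⟩

/-- Sparse cones force a purely unrectifiable set to have small density. -/
lemma hausdorffMeasure_le_of_fiberCone_le {n m : ℕ} (L : En n →L[ℝ] (Fin m → ℝ))
    {K B : Set (En n)} (hK : PurelyUnrectifiable n m K) (hBK : B ⊆ K) {s δ l d : ℝ} (hs : 0 < s)
    (hs1 : s ≤ 1) (hl : 0 ≤ l) (hd : 0 < d) (hdδ : 3 * d < δ)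
    (hB : ∀ a ∈ B, ∀ r, 0 < r → r < δ → μH[m] (K ∩ fiberCone L a r s) ≤
      ENNReal.ofReal (l * (r * s) ^ m))
    (hdiam : ∀ x ∈ B, ∀ y ∈ B, dist x y ≤ d) :
    μH[m] B ≤ ENNReal.ofReal (2 * 120 ^ m * (2 * (‖L‖ + 1)) ^ m * l * d ^ m) := by
  set B₀ := {x ∈ B | ∀ y ∈ B, s / 16 * ‖y - x‖ ≤ ‖L (y - x)‖}
  have hB₀ : μH[m] B₀ = 0 := by
    have h1 := hK B₀ (isRectifiable_of_le_norm_map L (c := s / 16) (by positivity)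
      fun x hx y hy => hy.2 x hx.1)
    rwa [inter_eq_right.2 (fun x hx => hBK hx.1)] at h1
  set h : En n → ℝ := fun x => sSup {t | ∃ y ∈ B, ‖L (y - x)‖ < s / 16 * ‖y - x‖ ∧ t = ‖y - x‖}
  have hbdd : ∀ x ∈ B,
      BddAbove {t | ∃ y ∈ B, ‖L (y - x)‖ < s / 16 * ‖y - x‖ ∧ t = ‖y - x‖} := by
    rintro x hx
    refine ⟨d, ?_⟩
    rintro t ⟨y, hy, -, rfl⟩
    rw [← dist_eq_norm]
    exact hdiam y hy x hx
  have hle : ∀ x ∈ B, ∀ y ∈ B, ‖L (y - x)‖ < s / 16 * ‖y - x‖ → ‖y - x‖ ≤ h x :=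
    fun x hx y hy hxy => le_csSup (hbdd x hx) ⟨y, hy, hxy, rfl⟩
  have hne : ∀ x ∈ B \ B₀,
      {t | ∃ y ∈ B, ‖L (y - x)‖ < s / 16 * ‖y - x‖ ∧ t = ‖y - x‖}.Nonempty := by
    rintro x ⟨hx, hx0⟩
    simp only [B₀, mem_ofPred_eq, not_and, not_forall, not_le] at hx0
    obtain ⟨y, hy, hxy⟩ := hx0 hx
    exact ⟨_, y, hy, hxy, rfl⟩
  have hpos : ∀ x ∈ B \ B₀, 0 < h x := by
    intro x hx
    obtain ⟨_, y, hy, hxy, -⟩ := hne x hx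
    have h1 := hle x hx.1 y hy hxy
    have h2 : 0 < ‖y - x‖ := by
      by_contra hcon
      have : ‖y - x‖ = 0 := le_antisymm (not_lt.1 hcon) (norm_nonneg _)
      rw [this] at hxy
      linarith [norm_nonneg (L (y - x))]
    linarith
  have hled : ∀ x ∈ B \ B₀, h x ≤ d := by
    intro x hx
    refine csSup_le (hne x hx) ?_
    rintro t ⟨y, hy, -, rfl⟩
    rw [← dist_eq_norm]
    exact hdiam y hy x hx.1
  have hcyl : ∀ x ∈ B \ B₀, μH[m] (L ⁻¹' closedBall (L x) (5 * (s * h x / 80)) ∩ (B \ B₀)) ≤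
      ENNReal.ofReal (2 * 120 ^ m * l) * ENNReal.ofReal ((2 * (s * h x / 80)) ^ m) := by
    intro x hx
    have hh := hpos x hx
    have hhd := hled x hx
    obtain ⟨_, ⟨y, hy, hxy, rfl⟩, hyh⟩ := exists_lt_of_lt_csSup (hne x hx)
      (show 3 / 4 * h x < h x by linarith)
    have hyx : ‖y - x‖ ≤ h x := hle x hx.1 y hy hxy
    have hsub : L ⁻¹' closedBall (L x) (5 * (s * h x / 80)) ∩ (B \ B₀) ⊆
        (K ∩ fiberCone L x (3 * h x) s) ∪ (K ∩ fiberCone L y (3 * h x) s) := by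
      rintro z ⟨hz, hzB, -⟩
      simp only [mem_preimage, mem_closedBall, dist_eq_norm] at hz
      rw [← map_sub] at hz
      have hzx : ‖z - x‖ ≤ h x := by
        by_contra hcon
        refine hcon (hle x hx.1 z hzB (hz.trans_lt ?_))
        nlinarith
      rcases lt_or_ge (‖z - x‖) (h x / 4) with hlt | hge
      · right
        have e1 : z - y = (z - x) - (y - x) := by abel
        have e2 : ‖y - x‖ ≤ ‖z - y‖ + ‖z - x‖ := by
          rw [show y - x = (z - x) - (z - y) by abel]
          linarith [norm_sub_le (z - x) (z - y)]
        have e3 : ‖z - y‖ ≤ ‖z - x‖ + ‖y - x‖ := by rw [e1]; exact norm_sub_le _ _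
        refine ⟨hBK hzB, by rw [dist_eq_norm]; linarith, ?_⟩
        have e4 : ‖L (z - y)‖ ≤ ‖L (z - x)‖ + ‖L (y - x)‖ := by
          rw [e1, map_sub]; exact norm_sub_le _ _
        nlinarith
      · left
        refine ⟨hBK hzB, by rw [dist_eq_norm]; linarith, hz.trans_lt ?_⟩
        nlinarith
    refine (measure_mono hsub).trans ((measure_union_le _ _).trans ?_)
    refine (add_le_add (hB x hx.1 (3 * h x) (by positivity) (by linarith))
      (hB y hy (3 * h x) (by positivity) (by linarith))).trans ?_
    rw [← ENNReal.ofReal_add (by positivity) (by positivity), ← ENNReal.ofReal_mul (by positivity)]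
    apply ENNReal.ofReal_le_ofReal
    have : (3 * h x * s) ^ m = 120 ^ m * (2 * (s * h x / 80)) ^ m := by
      rw [← mul_pow]; ring_nf
    rw [this]
    apply le_of_eq
    ring
  rcases B.eq_empty_or_nonempty with rfl | ⟨b, hb⟩
  · simp
  have hmain : μH[m] (B \ B₀) ≤ ENNReal.ofReal (2 * 120 ^ m * l) *
      volume (closedBall (L b) ((‖L‖ + 1) * d)) := by
    refine outerMeasure_le_of_vitali (μH[(m : ℝ)] : Measure (En n)).toOuterMeasure (B \ B₀)
      (fun x => L x) (fun x => s * h x / 80) d ?_ ?_ L hcyl ?_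
    · intro x hx
      have := hpos x hx
      have := hled x hx
      exact ⟨by positivity, by nlinarith⟩
    · intro x hx
      have := hpos x hx
      have := hled x hx
      apply closedBall_subset_closedBall'
      have h1 : dist (L x) (L b) ≤ ‖L‖ * dist x b := L.dist_le_opNorm x b
      have h2 := hdiam x hx.1 b hb
      have h3 : ‖L‖ * dist x b ≤ ‖L‖ * d := by gcongr
      nlinarith
    · intro x hx
      have := hpos x hx
      exact ⟨x, hx, mem_closedBall_self (by positivity)⟩
  have hsplit : μH[m] B ≤ μH[m] (B \ B₀) := by
    calc μH[m] B ≤ μH[m] ((B \ B₀) ∪ B₀) := measure_mono fun x hx => by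
          by_cases hx0 : x ∈ B₀
          · exact Or.inr hx0
          · exact Or.inl ⟨hx, hx0⟩
      _ ≤ _ := by simpa [hB₀] using measure_union_le (μ := μH[(m : ℝ)]) (B \ B₀) B₀
  refine hsplit.trans (hmain.trans (le_of_eq ?_))
  rw [Real.volume_pi_closedBall _ (by positivity), Fintype.card_fin,
    ← ENNReal.ofReal_mul (by positivity)]
  congr 1
  rw [show 2 * ((‖L‖ + 1) * d) = (2 * (‖L‖ + 1)) * d by ring, mul_pow]
  ring

/-- A set whose Hausdorff measure on small subsets is less than a fixed fraction of the power of
the diameter is null. -/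
lemma hausdorffMeasure_eq_zero_of_le_diam {X : Type*} [EMetricSpace X] [MeasurableSpace X]
    [BorelSpace X] {d : ℝ} (hd : 0 ≤ d) {A : Set X} (hA : MeasurableSet A) (hfin : μH[d] A ≠ ⊤)
    {η : ℝ≥0∞} (hη : 0 < η) (h : ∀ B ⊆ A, ediam B ≤ η → 2 * μH[d] B ≤ ediam B ^ d) :
    μH[d] A = 0 := by
  have hle : (2 : ℝ≥0∞) • (μH[d] : Measure X).restrict A ≤ μH[d] := by
    refine Measure.le_hausdorffMeasure d _ η hη fun s hs => ?_
    rw [Measure.smul_apply, Measure.restrict_apply' hA, smul_eq_mul]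
    exact (h _ inter_subset_right ((ediam_mono inter_subset_left).trans hs)).trans
      (ENNReal.rpow_le_rpow (ediam_mono inter_subset_left) hd)
  have := hle A
  rw [Measure.smul_apply, Measure.restrict_apply' hA, inter_self, smul_eq_mul, two_mul] at this
  by_contra hne
  exact absurd this (not_le.2 (ENNReal.lt_add_right hfin hne))

lemma measurable_measure_inter_section {α X : Type*} [MeasurableSpace α] [MeasurableSpace X]
    {μ : Measure X} {K : Set X} (hK : MeasurableSet K) (hfin : μ K < ⊤) {P : Set (α × X)}
    (hP : MeasurableSet P) : Measurable fun a => μ (K ∩ Prod.mk a ⁻¹' P) := by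
  have : IsFiniteMeasure (μ.restrict K) := ⟨by simpa using hfin⟩
  convert measurable_measure_prodMk_left (ν := μ.restrict K) hP using 2 with a
  rw [Measure.restrict_apply' hK, inter_comm]

/-- Cones around `a` in the fibre direction carry, at a suitable aperture, arbitrarily small
relative mass at all small scales. -/
def SparseCones {n m : ℕ} (K : Set (En n)) (L : En n →L[ℝ] (Fin m → ℝ)) (a : En n) : Prop :=
  ∀ k : ℕ, ∃ p q : ℕ, ∀ i ≥ q, μH[m] (K ∩ fiberCone L a ((1 / 2) ^ i) ((1 / 2) ^ p)) ≤
    ENNReal.ofReal ((1 / 2) ^ k * ((1 / 2) ^ i * (1 / 2) ^ p) ^ m)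

/-- Cones around `a` in the fibre direction carry unbounded relative mass. -/
def DenseCones {n m : ℕ} (K : Set (En n)) (L : En n →L[ℝ] (Fin m → ℝ)) (a : En n) : Prop :=
  ∀ k : ℕ, ∃ p ≥ k, ∃ i, ENNReal.ofReal (k * ((1 / 2) ^ i * (1 / 2) ^ p) ^ m) <
    μH[m] (K ∩ fiberCone L a ((1 / 2) ^ i) ((1 / 2) ^ p))

/-- The fibre through `a` meets `K` again within distance `2⁻ᵠ`. -/
def FiberReturns {n m : ℕ} (K : Set (En n)) (L : En n →L[ℝ] (Fin m → ℝ)) (a : En n) (q : ℕ) :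
    Prop :=
  ∃ x ∈ K, x ≠ a ∧ dist x a < (1 / 2) ^ q ∧ L x = L a

lemma hausdorffMeasure_sparseCones_eq_zero {n m : ℕ} (hm : 0 < m) {K : Set (En n)}
    (hK : MeasurableSet K) (hfin : μH[m] K < ⊤) (hKu : PurelyUnrectifiable n m K)
    (L : En n →L[ℝ] (Fin m → ℝ)) : μH[m] {a ∈ K | SparseCones K L a} = 0 := by
  obtain ⟨k, hk⟩ : ∃ k : ℕ,
      (1 / 2 : ℝ) ^ k * (2 * (2 * 120 ^ m * (2 * (‖L‖ + 1)) ^ m * 2 ^ m)) ≤ 1 := by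
    have hlim : Tendsto (fun k : ℕ => (1 / 2 : ℝ) ^ k *
        (2 * (2 * 120 ^ m * (2 * (‖L‖ + 1)) ^ m * 2 ^ m))) atTop (nhds 0) := by
      simpa using (tendsto_pow_atTop_nhds_zero_of_lt_one (r := (1 / 2 : ℝ)) (by norm_num)
        (by norm_num)).mul_const _
    exact (hlim.eventually (ge_mem_nhds one_pos)).exists
  set A : ℕ → ℕ → Set (En n) := fun p q => {a ∈ K | ∀ i ≥ q,
    μH[m] (K ∩ fiberCone L a ((1 / 2) ^ i) ((1 / 2) ^ p)) ≤
      ENNReal.ofReal ((1 / 2) ^ k * ((1 / 2) ^ i * (1 / 2) ^ p) ^ m)}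
  have hsub : {a ∈ K | SparseCones K L a} ⊆ ⋃ p, ⋃ q, A p q := by
    rintro a ⟨haK, ha⟩
    obtain ⟨p, q, h⟩ := ha k
    exact mem_iUnion₂.2 ⟨p, q, haK, h⟩
  refine measure_mono_null hsub (measure_iUnion_null fun p => measure_iUnion_null fun q => ?_)
  have hmeas : MeasurableSet (A p q) := by
    have hA : A p q = K ∩ ⋂ i, ⋂ (_ : i ≥ q),
        {a | μH[m] (K ∩ fiberCone L a ((1 / 2) ^ i) ((1 / 2) ^ p)) ≤
          ENNReal.ofReal ((1 / 2) ^ k * ((1 / 2) ^ i * (1 / 2) ^ p) ^ m)} := by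
      ext; simp [A]
    rw [hA]
    refine hK.inter (MeasurableSet.iInter fun i => MeasurableSet.iInter fun _ => ?_)
    refine measurableSet_le ?_ measurable_const
    refine measurable_measure_inter_section hK hfin
      (P := {z : En n × En n | z.2 ∈ fiberCone L z.1 ((1 / 2) ^ i) ((1 / 2) ^ p)}) ?_
    refine IsOpen.measurableSet (IsOpen.and ?_ ?_)
    · exact isOpen_lt (by fun_prop) (by fun_prop)
    · exact isOpen_lt (by fun_prop) (by fun_prop)
  refine hausdorffMeasure_eq_zero_of_le_diam (by positivity) hmeas
    ((measure_mono fun a ha => ha.1).trans_lt hfin).ne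
    (η := ENNReal.ofReal ((1 / 2) ^ q / 4)) (by simp) fun B hBA hBd => ?_
  have hbdd : Bornology.IsBounded B :=
    isBounded_iff_ediam_ne_top.2 (hBd.trans_lt ENNReal.ofReal_lt_top).ne
  rcases B.subsingleton_or_nontrivial with hB | hB
  · have : μH[m] B = 0 := by
      have := Measure.nullSingletonClass_hausdorff (En n) (show (0 : ℝ) < m by exact_mod_cast hm)
      exact hB.measure_zero _
    simp [this]
  have hdpos : 0 < diam B := by
    obtain ⟨x, hx, y, hy, hxy⟩ := hB
    exact (dist_pos.2 hxy).trans_le (dist_le_diam_of_mem hbdd hx hy)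
  have hdle : diam B ≤ (1 / 2) ^ q / 4 := ENNReal.toReal_le_of_le_ofReal (by positivity) hBd
  have hpq : (0 : ℝ) < (1 / 2) ^ q := by positivity
  have hmain := hausdorffMeasure_le_of_fiberCone_le L hKu (hBA.trans fun a ha => ha.1)
    (s := (1 / 2) ^ p) (δ := (1 / 2) ^ q) (l := (1 / 2) ^ k * 2 ^ m) (d := diam B) (by positivity)
    (pow_le_one₀ (by norm_num) (by norm_num)) (by positivity) hdpos (by linarith) ?_
    fun x hx y hy => dist_le_diam_of_mem hbdd hx hy
  · have hed : ediam B = ENNReal.ofReal (diam B) := by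
      rw [diam, ENNReal.ofReal_toReal (isBounded_iff_ediam_ne_top.1 hbdd)]
    calc 2 * μH[m] B ≤ ENNReal.ofReal 2 * ENNReal.ofReal (2 * 120 ^ m * (2 * (‖L‖ + 1)) ^ m *
          ((1 / 2) ^ k * 2 ^ m) * diam B ^ m) := by
          rw [ENNReal.ofReal_ofNat]; gcongr
      _ ≤ ENNReal.ofReal (diam B ^ m) := by
          rw [← ENNReal.ofReal_mul (by norm_num)]
          apply ENNReal.ofReal_le_ofReal
          nlinarith [pow_pos hdpos m]
      _ = ediam B ^ (m : ℝ) := by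
          rw [ENNReal.rpow_natCast, hed, ENNReal.ofReal_pow hdpos.le]
  · intro a ha r hr hrq
    have hr1 : r ≤ 1 := hrq.le.trans (pow_le_one₀ (by norm_num) (by norm_num))
    obtain ⟨i, hi1, hi2⟩ := exists_nat_pow_near_of_lt_one hr hr1 (y := (1 / 2 : ℝ)) (by norm_num)
      (by norm_num)
    have hiq : i ≥ q := by
      by_contra hcon
      have : (1 / 2 : ℝ) ^ q ≤ (1 / 2) ^ (i + 1) :=
        pow_le_pow_of_le_one (by norm_num) (by norm_num) (by omega)
      linarith
    refine (measure_mono (inter_subset_inter_right K (fiberCone_mono L a hi2 le_rfl))).trans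
      (((hBA ha).2 i hiq).trans (ENNReal.ofReal_le_ofReal ?_))
    rw [mul_assoc, ← mul_pow]
    rw [pow_succ] at hi1
    have : (1 / 2 : ℝ) ^ i * (1 / 2) ^ p ≤ 2 * (r * (1 / 2) ^ p) := by
      rw [← mul_assoc]
      gcongr
      linarith
    gcongr

lemma volume_image_denseCones_eq_zero {n m : ℕ} {K : Set (En n)}
    (hK : MeasurableSet K) (hfin : μH[m] K < ⊤)
    (L : En n →L[ℝ] (Fin m → ℝ)) : volume (L '' {a | DenseCones K L a}) = 0 := by
  have hKf : IsFiniteMeasure ((μH[(m : ℝ)] : Measure (En n)).restrict K) := ⟨by simpa using hfin⟩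
  set κ : Measure (Fin m → ℝ) := ((μH[(m : ℝ)] : Measure (En n)).restrict K).map L
  have hae : ∀ᵐ y : Fin m → ℝ, y ∉ L '' {a | DenseCones K L a} := by
    filter_upwards [Besicovitch.ae_tendsto_rnDeriv κ volume, κ.rnDeriv_lt_top volume] with y hy hlt
    rintro ⟨a, ha, rfl⟩
    obtain ⟨N, hN⟩ := ENNReal.exists_nat_gt hlt.ne
    obtain ⟨r₀, hr₀, hr⟩ := mem_nhdsGT_iff_exists_Ioo_subset.1 (hy.eventually (gt_mem_nhds hN))
    have hr₀' : (0 : ℝ) < r₀ := hr₀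
    obtain ⟨M, hM⟩ := exists_pow_lt_of_lt_one hr₀' (show (1 / 2 : ℝ) < 1 by norm_num)
    obtain ⟨p, hp, i, hi⟩ := ha (max M (N * 2 ^ m))
    set t : ℝ := (1 / 2) ^ i * (1 / 2) ^ p
    have ht : 0 < t := by positivity
    have htr : t < r₀ := by
      have h1 : (1 / 2 : ℝ) ^ p ≤ (1 / 2) ^ M :=
        pow_le_pow_of_le_one (by norm_num) (by norm_num) ((le_max_left _ _).trans hp)
      have h2 : (1 / 2 : ℝ) ^ i ≤ 1 := pow_le_one₀ (by norm_num) (by norm_num)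
      have h3 : (0 : ℝ) < (1 / 2) ^ p := by positivity
      simp only [t]
      nlinarith
    have h4 : κ (closedBall (L a) t) / volume (closedBall (L a) t) < N := hr ⟨ht, htr⟩
    have h5 := (ENNReal.div_le_iff (measure_closedBall_pos volume (L a) ht).ne'
      measure_closedBall_lt_top.ne).1 h4.le
    rw [Real.volume_pi_closedBall _ ht.le, Fintype.card_fin] at h5
    have h6 : μH[m] (K ∩ fiberCone L a ((1 / 2) ^ i) ((1 / 2) ^ p)) ≤ κ (closedBall (L a) t) := by
      rw [Measure.map_apply L.continuous.measurable measurableSet_closedBall,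
        Measure.restrict_apply' hK, inter_comm]
      refine measure_mono (inter_subset_inter_left K ?_)
      rintro x ⟨hx1, hx2⟩
      rw [mem_preimage, mem_closedBall, dist_eq_norm, ← map_sub]
      refine hx2.le.trans ?_
      rw [dist_eq_norm] at hx1
      simp only [t]
      rw [mul_comm]
      gcongr
    have h7 := hi.trans_le (h6.trans h5)
    rw [← ENNReal.ofReal_natCast, ← ENNReal.ofReal_mul (by positivity)] at h7
    have h8 := (ENNReal.ofReal_lt_ofReal_iff_of_nonneg (by positivity)).1 h7
    have h9 : ((N * 2 ^ m : ℕ) : ℝ) ≤ ((max M (N * 2 ^ m) : ℕ) : ℝ) :=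
      Nat.cast_le.2 (le_max_right _ _)
    push_cast at h8 h9
    rw [mul_pow 2 t m, ← mul_assoc] at h8
    nlinarith [pow_pos ht m]
  exact measure_mono_null (fun y hy => not_not.2 hy) (ae_iff.1 hae)

lemma volume_infinite_fibers_eq_zero {n m : ℕ} {K : Set (En n)} (hK : MeasurableSet K)
    (hfin : μH[m] K < ⊤) (L : En n →L[ℝ] (Fin m → ℝ)) :
    volume {y | (K ∩ L ⁻¹' {y}).Infinite} = 0 := by
  set Q : ℕ → En n → Fin n → ℤ := fun j x l => ⌊(2 : ℝ) ^ j * x l⌋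
  have hQm : ∀ j, Measurable (Q j) := fun j => by
    refine measurable_pi_lambda _ fun l => ?_
    exact Int.measurable_floor.comp (by fun_prop)
  set T : ℕ → (Fin n → ℤ) → Set (Fin m → ℝ) := fun j z =>
    toMeasurable volume (L '' (K ∩ Q j ⁻¹' {z}))
  set g : ℕ → (Fin m → ℝ) → ℝ≥0∞ := fun j y => ∑' z, (T j z).indicator 1 y
  have hgm : ∀ j, Measurable (g j) := fun j =>
    Measurable.tsum fun z => measurable_one.indicator (measurableSet_toMeasurable _ _)
  have hgint : ∀ j, ∫⁻ y, g j y ≤ (‖L‖₊ : ℝ≥0∞) ^ m * μH[m] K := by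
    intro j
    rw [lintegral_tsum fun z =>
      (measurable_one.indicator (measurableSet_toMeasurable _ _)).aemeasurable]
    calc ∑' z, ∫⁻ y, (T j z).indicator 1 y
        = ∑' z, volume (L '' (K ∩ Q j ⁻¹' {z})) := by
          congr 1 with z
          rw [lintegral_indicator_one (measurableSet_toMeasurable _ _), measure_toMeasurable]
      _ ≤ ∑' z, (‖L‖₊ : ℝ≥0∞) ^ m * μH[m] (K ∩ Q j ⁻¹' {z}) :=
          ENNReal.tsum_le_tsum fun z => volume_image_le_hausdorffMeasure L.lipschitz _
      _ = (‖L‖₊ : ℝ≥0∞) ^ m * μH[m] (⋃ z, K ∩ Q j ⁻¹' {z}) := by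
          rw [ENNReal.tsum_mul_left, measure_iUnion]
          · intro z z' hzz
            refine Disjoint.mono inter_subset_right inter_subset_right ?_
            exact Disjoint.preimage _ (by simpa using hzz)
          · exact fun z => hK.inter (hQm j (measurableSet_singleton z))
      _ ≤ _ := by
          gcongr
          exact iUnion_subset fun z => inter_subset_left
  have hlim : ∫⁻ y, liminf (fun j => g j y) atTop ≠ ⊤ := by
    refine ne_top_of_le_ne_top ?_ ((lintegral_liminf_le hgm).trans
      (liminf_le_of_frequently_le' (Frequently.of_forall hgint)))
    exact ENNReal.mul_ne_top (by simp) hfin.ne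
  have hae := ae_lt_top (Measurable.liminf hgm) hlim
  refine measure_mono_null (t := {y | ¬ liminf (fun j => g j y) atTop < ⊤}) ?_ (ae_iff.1 hae)
  intro y hy
  simp only [mem_ofPred_eq, not_lt, top_le_iff] at hy ⊢
  refine ENNReal.eq_top_of_forall_nnreal_le fun N => ?_
  obtain ⟨N', hN'⟩ := exists_nat_ge N
  obtain ⟨F, hF, hFc⟩ := hy.exists_subset_card_eq N'
  have hsep : ∀ᶠ j in atTop, InjOn (Q j) (F : Set (En n)) := by
    have hpair : ∀ x x' : En n, x ≠ x' → ∀ᶠ j in atTop, Q j x ≠ Q j x' := by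
      intro x x' hne
      obtain ⟨l, hl⟩ : ∃ l, x l ≠ x' l := by
        by_contra hcon
        push Not at hcon
        exact hne (PiLp.ext hcon)
      have habs : 0 < |x l - x' l| := abs_pos.2 (sub_ne_zero.2 hl)
      have htend : Tendsto (fun j : ℕ => (2 : ℝ) ^ j * |x l - x' l|) atTop atTop :=
        (tendsto_pow_atTop_atTop_of_one_lt (by norm_num)).atTop_mul_const habs
      filter_upwards [htend.eventually_ge_atTop 1] with j hj heq
      have h1 := Int.abs_sub_lt_one_of_floor_eq_floor (congrFun heq l)
      rw [← mul_sub, abs_mul, abs_of_pos (by positivity : (0 : ℝ) < 2 ^ j)] at h1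
      linarith
    have hall : ∀ᶠ j in atTop, ∀ x ∈ F, ∀ x' ∈ F, x ≠ x' → Q j x ≠ Q j x' := by
      rw [Filter.eventually_all_finset]
      intro x _
      rw [Filter.eventually_all_finset]
      intro x' _
      by_cases h : x = x'
      · exact Eventually.of_forall fun j hne => absurd h hne
      · filter_upwards [hpair x x' h] with j hj _ using hj
    filter_upwards [hall] with j hj x hx x' hx' heq
    by_contra hne
    exact hj x hx x' hx' hne heq
  refine le_liminf_of_le (by isBoundedDefault) ?_
  filter_upwards [hsep] with j hj
  classical
  calc (N : ℝ≥0∞) ≤ (N' : ℝ≥0∞) := by exact_mod_cast hN'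
    _ = ∑ z ∈ F.image (Q j), (1 : ℝ≥0∞) := by
        rw [Finset.sum_const, Finset.card_image_of_injOn hj, hFc]; simp
    _ = ∑ z ∈ F.image (Q j), (T j z).indicator 1 y := by
        refine Finset.sum_congr rfl fun z hz => ?_
        obtain ⟨x, hx, rfl⟩ := Finset.mem_image.1 hz
        rw [indicator_of_mem, Pi.one_apply]
        exact subset_toMeasurable _ _ ⟨x, ⟨(hF hx).1, rfl⟩, (hF hx).2⟩
    _ ≤ g j y := ENNReal.sum_le_tsum _

lemma volume_image_fiberReturns_eq_zero {n m : ℕ} {K : Set (En n)} (hK : MeasurableSet K)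
    (hfin : μH[m] K < ⊤) (L : En n →L[ℝ] (Fin m → ℝ)) :
    volume (L '' {a | ∀ q, FiberReturns K L a q}) = 0 := by
  refine measure_mono_null ?_ (volume_infinite_fibers_eq_zero hK hfin L)
  rintro _ ⟨a, ha, rfl⟩ hfinite
  have hcl : IsClosed ((K ∩ L ⁻¹' {L a}) \ {a}) := (hfinite.subset sdiff_subset).isClosed
  obtain ⟨ε, hε, hball⟩ := Metric.isOpen_iff.1 hcl.isOpen_compl a (by simp)
  obtain ⟨q, hq⟩ := exists_pow_lt_of_lt_one hε (show (1 / 2 : ℝ) < 1 by norm_num)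
  obtain ⟨x, hxK, hxa, hd, hL⟩ := ha q
  exact hball (show x ∈ ball a ε from hd.trans hq) ⟨⟨hxK, hL⟩, hxa⟩

/-- The linear map with matrix `w`. -/
def matMap {n m : ℕ} (w : Fin m → Fin n → ℝ) : En n →L[ℝ] (Fin m → ℝ) :=
  LinearMap.toContinuousLinearMap
    { toFun := fun x k => ∑ l, w k l * x l
      map_add' := fun x y => by ext k; simp [mul_add, Finset.sum_add_distrib]
      map_smul' := fun c x => by ext k; simp [Finset.mul_sum, mul_left_comm] }

lemma matMap_apply {n m : ℕ} (w : Fin m → Fin n → ℝ) (x : En n) (k : Fin m) :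
    matMap w x k = ∑ l, w k l * x l := rfl

lemma Continuous.matMap {α : Type*} [TopologicalSpace α] {n m : ℕ} {f : α → Fin m → Fin n → ℝ}
    {g : α → En n} (hf : Continuous f) (hg : Continuous g) :
    Continuous fun z => _root_.matMap (f z) (g z) := by
  refine continuous_pi fun k => ?_
  simp only [matMap_apply]
  fun_prop

/-- The matrix whose `j`-th column is `v`, all other columns being zero. -/
def columnMatrix {n m : ℕ} (j : Fin n) (v : Fin m → ℝ) : Fin m → Fin n → ℝ :=
  fun k l => if l = j then v k else 0

lemma measurable_columnMatrix {n m : ℕ} (j : Fin n) :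
    Measurable (columnMatrix j : (Fin m → ℝ) → Fin m → Fin n → ℝ) := by
  refine measurable_pi_lambda _ fun k => measurable_pi_lambda _ fun l => ?_
  unfold columnMatrix
  split_ifs
  · exact measurable_pi_apply k
  · exact measurable_const

lemma matMap_add_columnMatrix {n m : ℕ} (w : Fin m → Fin n → ℝ) (j : Fin n) (v : Fin m → ℝ)
    (x : En n) : matMap (w + columnMatrix j v) x = matMap w x + x j • v := by
  ext k
  simp [matMap_apply, columnMatrix, add_mul, Finset.sum_add_distrib, mul_comm]

/-- The sector around `a` in which the `j`-th coordinate dominates. -/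
def sector {n : ℕ} (a : En n) (j : Fin n) : Set (En n) := {x | ‖x - a‖ ≤ n * |x j - a j|}

lemma exists_mem_sector {n : ℕ} {a x : En n} (hx : x ≠ a) : ∃ j, x ∈ sector a j := by
  by_contra! hcon
  simp only [sector, mem_ofPred_eq, not_le] at hcon
  have hn : 0 < n := by
    rcases Nat.eq_zero_or_pos n with rfl | h
    · exact absurd (Subsingleton.elim x a) hx
    · exact h
  have h1 : ‖x - a‖ ≤ ∑ j, |x j - a j| := by
    rw [EuclideanSpace.norm_eq, Real.sqrt_le_left (Finset.sum_nonneg fun _ _ => abs_nonneg _)]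
    simpa using Finset.sum_sq_le_sq_sum_of_nonneg
      (s := Finset.univ) (f := fun j => |x j - a j|) (fun _ _ => abs_nonneg _)
  have : Nonempty (Fin n) := ⟨⟨0, hn⟩⟩
  have h2 : ∑ j : Fin n, (n : ℝ) * |x j - a j| < ∑ _j : Fin n, ‖x - a‖ :=
    Finset.sum_lt_sum_of_nonempty Finset.univ_nonempty fun j _ => hcon j
  rw [← Finset.mul_sum, Finset.sum_const, Finset.card_univ, Fintype.card_fin, nsmul_eq_mul] at h2
  have hn' : (0 : ℝ) < n := by exact_mod_cast hn
  nlinarith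

/-- Sparseness of the part of the cones lying in a sector, uniformly at scales below `2⁻ᵠ`. -/
def SparseInSector {n m : ℕ} (K : Set (En n)) (L : En n →L[ℝ] (Fin m → ℝ)) (a : En n)
    (j : Fin n) (q : ℕ) : Prop :=
  ∀ k : ℕ, ∃ p₀ : ℕ, ∀ p ≥ p₀, ∀ i ≥ q,
    μH[m] (K ∩ (sector a j ∩ fiberCone L a ((1 / 2) ^ i) ((1 / 2) ^ p))) ≤
      ENNReal.ofReal ((1 / 2) ^ k * ((1 / 2) ^ i * (1 / 2) ^ p) ^ m)

lemma sparseCones_of_sparseInSector {n m : ℕ} {K : Set (En n)} {L : En n →L[ℝ] (Fin m → ℝ)}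
    {a : En n} {q : ℕ} (h : ∀ j, SparseInSector K L a j q) : SparseCones K L a := by
  intro k
  choose p₀ hp₀ using fun j => h j (k + n)
  refine ⟨Finset.univ.sup p₀, q, fun i hi => ?_⟩
  set p := Finset.univ.sup p₀
  have hsub : K ∩ fiberCone L a ((1 / 2) ^ i) ((1 / 2) ^ p) ⊆
      ⋃ j, K ∩ (sector a j ∩ fiberCone L a ((1 / 2) ^ i) ((1 / 2) ^ p)) := by
    rintro x ⟨hxK, hx⟩
    have hne : x ≠ a := by
      rintro rfl
      simpa using hx.2
    obtain ⟨j, hj⟩ := exists_mem_sector hne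
    exact mem_iUnion.2 ⟨j, hxK, hj, hx⟩
  refine (measure_mono hsub).trans ((measure_iUnion_fintype_le _ _).trans ?_)
  refine (Finset.sum_le_sum fun j _ =>
    hp₀ j p (Finset.le_sup (Finset.mem_univ j)) i hi).trans ?_
  rw [Finset.sum_const, Finset.card_univ, Fintype.card_fin, nsmul_eq_mul,
    ← ENNReal.ofReal_natCast, ← ENNReal.ofReal_mul (by positivity)]
  apply ENNReal.ofReal_le_ofReal
  rw [pow_add, ← mul_assoc]
  gcongr
  have h2 : (n : ℝ) * (1 / 2) ^ n ≤ 1 := by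
    rw [one_div, inv_pow, ← div_eq_mul_inv, div_le_one (by positivity)]
    exact_mod_cast Nat.lt_two_pow_self.le
  have h3 : (0 : ℝ) < (1 / 2) ^ k := by positivity
  nlinarith

lemma ae_fiberReturns_or_dense_or_sparse {n m : ℕ} {K : Set (En n)} (hK : IsCompact K)
    (w : Fin m → Fin n → ℝ) (a : En n) (j : Fin n) (q : ℕ) :
    ∀ᵐ v : Fin m → ℝ, FiberReturns K (matMap (w + columnMatrix j v)) a q ∨
      DenseCones K (matMap (w + columnMatrix j v)) a ∨
      SparseInSector K (matMap (w + columnMatrix j v)) a j q := by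
  set C : Set (En n) := sector a j
  have hC : IsClosed C := isClosed_le (by fun_prop) (by fun_prop)
  set O : Set (En n) := {x | x j ≠ a j}
  have hO : IsOpen O := isOpen_ne_fun (by fun_prop) (by fun_prop)
  set θ : En n → Fin m → ℝ := fun x => -((x j - a j)⁻¹ • matMap w (x - a))
  have hθc : ContinuousOn θ O := by
    refine ContinuousOn.neg (ContinuousOn.smul (ContinuousOn.inv₀ (by fun_prop) fun x hx =>
      sub_ne_zero.2 hx) (by fun_prop))
  have hθ : ∀ v, ∀ x ∈ O, ‖matMap (w + columnMatrix j v) (x - a)‖ =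
      |x j - a j| * ‖v - θ x‖ := by
    intro v x hx
    have hne : x j - a j ≠ 0 := sub_ne_zero.2 hx
    rw [matMap_add_columnMatrix, ← Real.norm_eq_abs, ← norm_smul]
    have h1 : (x j - a j) • θ x = -matMap w (x - a) := by
      simp only [θ, smul_neg, smul_inv_smul₀ hne]
    rw [smul_sub, h1, sub_neg_eq_add, add_comm, PiLp.sub_apply]
  have hsec : ∀ x ∈ C, x ≠ a → x ∈ O := by
    intro x hx hne hxj
    have h1 : ‖x - a‖ ≤ n * |x j - a j| := hx
    rw [hxj, sub_self, abs_zero, mul_zero] at h1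
    exact hne (sub_eq_zero.1 (norm_le_zero_iff.1 h1))
  set Y : ℕ → Set (En n) := fun i => K ∩ C ∩ (O ∩ ball a ((1 / 2) ^ i))
  set ν : OuterMeasure (Fin m → ℝ) := ⨆ i : {i // i ≥ q},
    ENNReal.ofReal ((2 ^ (i : ℕ)) ^ m) • OuterMeasure.map θ
      (OuterMeasure.restrict (Y i) (μH[(m : ℝ)] : Measure (En n)).toOuterMeasure)
  have hνapp : ∀ D, ν D = ⨆ i : {i // i ≥ q}, ENNReal.ofReal ((2 ^ (i : ℕ)) ^ m) *
      μH[m] (θ ⁻¹' D ∩ Y i) := by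
    intro D
    simp [ν, OuterMeasure.iSup_apply]
  have hYmono : ∀ i ≥ q, Y i ⊆ Y q := fun i hi => by
    refine inter_subset_inter_right _ (inter_subset_inter_right _ (ball_subset_ball ?_))
    exact pow_le_pow_of_le_one (by norm_num) (by norm_num) hi
  have hHm : MeasurableSet (θ '' Y q) := by
    obtain ⟨F, hFc, hFs, hFU, -⟩ :=
      (hO.inter (isOpen_ball (x := a) (ε := (1 / 2) ^ q))).exists_iUnion_isClosed
    have hY : Y q = ⋃ k, K ∩ C ∩ F k := by rw [← inter_iUnion, hFU]
    rw [hY, image_iUnion]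
    refine MeasurableSet.iUnion fun k => IsClosed.measurableSet (IsCompact.isClosed ?_)
    refine ((hK.inter_right hC).inter_right (hFc k)).image_of_continuousOn (hθc.mono ?_)
    exact fun x hx => (hFs k hx.2).1
  have hνH : ν (θ '' Y q)ᶜ = 0 := by
    rw [hνapp, ENNReal.iSup_eq_zero]
    rintro ⟨i, hi⟩
    have : θ ⁻¹' (θ '' Y q)ᶜ ∩ Y i = ∅ := by
      rw [eq_empty_iff_forall_notMem]
      rintro x ⟨hx1, hx2⟩
      exact hx1 (mem_image_of_mem θ (hYmono i hi hx2))
    rw [this, measure_empty, mul_zero]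
  have h2i : ∀ i : ℕ, (2 : ℝ) ^ i * (1 / 2) ^ i = 1 := fun i => by
    rw [← mul_pow]; norm_num
  filter_upwards [ae_mem_or_density_zero_or_top ν hHm hνH] with v hv
  set L := matMap (w + columnMatrix j v)
  rcases hv with ⟨x, ⟨⟨hxK, hxC⟩, hxO, hxb⟩, hxv⟩ | hzero | htop
  · refine Or.inl ⟨x, hxK, ?_, hxb, ?_⟩
    · rintro rfl
      exact hxO rfl
    · have := hθ v x hxO
      rw [hxv, sub_self, norm_zero, mul_zero, norm_eq_zero, map_sub] at this
      exact sub_eq_zero.1 this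
  · refine Or.inr (Or.inr fun k => ?_)
    obtain ⟨t₀, ht₀, ht⟩ := hzero ((1 / 2) ^ k / (n + 1) ^ m) (by positivity)
    obtain ⟨p₀, hp₀⟩ := exists_pow_lt_of_lt_one (show 0 < t₀ / (n + 1) by positivity)
      (show (1 / 2 : ℝ) < 1 by norm_num)
    refine ⟨p₀, fun p hp i hi => ?_⟩
    have hpt : (n + 1) * (1 / 2 : ℝ) ^ p < t₀ := by
      have : (1 / 2 : ℝ) ^ p ≤ (1 / 2) ^ p₀ := pow_le_pow_of_le_one (by norm_num) (by norm_num) hp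
      rw [lt_div_iff₀ (by positivity)] at hp₀
      nlinarith
    have hb := ht _ (by positivity) hpt
    rw [hνapp] at hb
    have hbi := (le_iSup (fun i : {i // i ≥ q} => ENNReal.ofReal ((2 ^ (i : ℕ)) ^ m) *
      μH[m] (θ ⁻¹' ball v ((n + 1) * (1 / 2) ^ p) ∩ Y i)) ⟨i, hi⟩).trans hb
    have hsub : K ∩ (C ∩ fiberCone L a ((1 / 2) ^ i) ((1 / 2) ^ p)) ⊆
        θ ⁻¹' ball v ((n + 1) * (1 / 2) ^ p) ∩ Y i := by
      rintro x ⟨hxK, hxC, hx1, hx2⟩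
      have hne : x ≠ a := by
        rintro rfl
        simp at hx2
      have hxO := hsec x hxC hne
      refine ⟨?_, ⟨hxK, hxC⟩, hxO, hx1⟩
      rw [hθ v x hxO] at hx2
      rw [mem_preimage, mem_ball', dist_eq_norm]
      have hpos : 0 < |x j - a j| := abs_pos.2 (sub_ne_zero.2 hxO)
      have hxC' : ‖x - a‖ ≤ n * |x j - a j| := hxC
      have hp0 : (0 : ℝ) < (1 / 2) ^ p := by positivity
      refine lt_of_mul_lt_mul_left (hx2.trans_le ?_) hpos.le
      nlinarith
    refine (measure_mono hsub).trans ?_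
    calc μH[m] (θ ⁻¹' ball v ((n + 1) * (1 / 2) ^ p) ∩ Y i)
        = ENNReal.ofReal (((1 / 2) ^ i) ^ m) * (ENNReal.ofReal ((2 ^ i) ^ m) *
          μH[m] (θ ⁻¹' ball v ((n + 1) * (1 / 2) ^ p) ∩ Y i)) := by
          rw [← mul_assoc, ← ENNReal.ofReal_mul (by positivity), ← mul_pow, mul_comm (_ ^ i), h2i,
            one_pow, ENNReal.ofReal_one, one_mul]
      _ ≤ ENNReal.ofReal (((1 / 2) ^ i) ^ m) * ENNReal.ofReal
          ((1 / 2) ^ k / (n + 1) ^ m * ((n + 1) * (1 / 2) ^ p) ^ m) := by gcongr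
      _ = _ := by
          rw [← ENNReal.ofReal_mul (by positivity)]
          congr 1
          rw [mul_pow, mul_pow]
          field_simp
  · refine Or.inr (Or.inl fun k => ?_)
    obtain ⟨t, ht0, htk, ht⟩ := htop (k * 2 ^ m + 2 ^ k)
    have ht1 : t ≤ 1 := htk.le.trans (by
      rw [div_le_one (by positivity)]
      linarith [Nat.cast_nonneg (α := ℝ) (k * 2 ^ m + 2 ^ k)])
    obtain ⟨p, hp1, hp2⟩ := exists_nat_pow_near_of_lt_one ht0 ht1 (y := (1 / 2 : ℝ)) (by norm_num)
      (by norm_num)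
    rw [hνapp, lt_iSup_iff] at ht
    obtain ⟨⟨i, hi⟩, hti⟩ := ht
    refine ⟨p, ?_, i, ?_⟩
    · by_contra hcon
      have h1 : (1 / 2 : ℝ) ^ k ≤ (1 / 2) ^ (p + 1) :=
        pow_le_pow_of_le_one (by norm_num) (by norm_num) (by omega)
      have h2 : (1 / 2 : ℝ) ^ k < 1 / (((k * 2 ^ m + 2 ^ k : ℕ) : ℝ) + 1) := by linarith
      rw [lt_div_iff₀ (by positivity)] at h2
      push_cast at h2
      have h3 : (1 / 2 : ℝ) ^ k * 2 ^ k = 1 := by rw [mul_comm]; exact h2i k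
      have h4 : (0 : ℝ) < (1 / 2) ^ k := by positivity
      have h5 : (0 : ℝ) ≤ k * 2 ^ m := by positivity
      nlinarith
    · have hsub : θ ⁻¹' ball v t ∩ Y i ⊆
          K ∩ fiberCone L a ((1 / 2) ^ i) ((1 / 2) ^ p) := by
        rintro x ⟨hx1, ⟨hxK, hxC⟩, hxO, hxb⟩
        refine ⟨hxK, hxb, ?_⟩
        rw [hθ v x hxO]
        rw [mem_preimage, mem_ball', dist_eq_norm] at hx1
        have hpos : 0 < |x j - a j| := abs_pos.2 (sub_ne_zero.2 hxO)
        have hle : |x j - a j| ≤ ‖x - a‖ := PiLp.norm_apply_le (x - a) j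
        nlinarith [norm_nonneg (v - θ x)]
      refine lt_of_lt_of_le ?_ (measure_mono hsub)
      have hti' : ENNReal.ofReal (((1 / 2) ^ i) ^ m) *
          ENNReal.ofReal (((k * 2 ^ m + 2 ^ k : ℕ) : ℝ) * t ^ m) <
          ENNReal.ofReal (((1 / 2) ^ i) ^ m) *
            (ENNReal.ofReal ((2 ^ i) ^ m) * μH[m] (θ ⁻¹' ball v t ∩ Y i)) := by
        refine (ENNReal.mul_lt_mul_iff_right ?_ ENNReal.ofReal_ne_top).2 hti
        exact (ENNReal.ofReal_pos.2 (by positivity)).ne'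
      rw [← mul_assoc (ENNReal.ofReal (((1 / 2) ^ i) ^ m)) (ENNReal.ofReal ((2 ^ i) ^ m)),
        ← ENNReal.ofReal_mul (by positivity), ← ENNReal.ofReal_mul (by positivity), ← mul_pow,
        mul_comm ((1 / 2 : ℝ) ^ i) (2 ^ i), h2i, one_pow, ENNReal.ofReal_one, one_mul] at hti'
      refine lt_of_le_of_lt (ENNReal.ofReal_le_ofReal ?_) hti'
      rw [mul_pow, mul_left_comm]
      refine mul_le_mul_of_nonneg_left ?_ (by positivity)
      rw [pow_succ] at hp1
      calc (k : ℝ) * ((1 / 2) ^ p) ^ m ≤ k * (2 * t) ^ m := by gcongr; linarith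
        _ = k * 2 ^ m * t ^ m := by rw [mul_pow]; ring
        _ ≤ _ := by
          gcongr
          push_cast
          linarith [pow_pos (show (0 : ℝ) < 2 by norm_num) k]

lemma measurable_measure_fiberCone {n m : ℕ} {K : Set (En n)} (hK : MeasurableSet K)
    (hfin : μH[m] K < ⊤) (r s : ℝ) :
    Measurable fun z : En n × (Fin m → Fin n → ℝ) =>
      μH[m] (K ∩ fiberCone (matMap z.2) z.1 r s) := by
  set P : Set ((En n × (Fin m → Fin n → ℝ)) × En n) := {y |
      dist y.2 y.1.1 < r ∧ ‖matMap y.1.2 (y.2 - y.1.1)‖ < s * ‖y.2 - y.1.1‖}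
  have hmat : Continuous fun y : (En n × (Fin m → Fin n → ℝ)) × En n =>
      matMap y.1.2 (y.2 - y.1.1) := Continuous.matMap (by fun_prop) (by fun_prop)
  have hP : MeasurableSet P := by
    refine IsOpen.measurableSet (IsOpen.and ?_ ?_)
    · exact isOpen_lt (by fun_prop) (by fun_prop)
    · exact isOpen_lt hmat.norm (by fun_prop)
  have hsec : ∀ z, Prod.mk z ⁻¹' P = fiberCone (matMap z.2) z.1 r s := fun z => by
    ext x
    simp [P, fiberCone]
  simpa only [hsec] using measurable_measure_inter_section hK hfin hP

lemma measurable_measure_sector_fiberCone {n m : ℕ} {K : Set (En n)} (hK : MeasurableSet K)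
    (hfin : μH[m] K < ⊤) (j : Fin n) (r s : ℝ) :
    Measurable fun z : En n × (Fin m → Fin n → ℝ) =>
      μH[m] (K ∩ (sector z.1 j ∩ fiberCone (matMap z.2) z.1 r s)) := by
  set P : Set ((En n × (Fin m → Fin n → ℝ)) × En n) := {y |
      ‖y.2 - y.1.1‖ ≤ n * |y.2 j - y.1.1 j| ∧
      dist y.2 y.1.1 < r ∧ ‖matMap y.1.2 (y.2 - y.1.1)‖ < s * ‖y.2 - y.1.1‖}
  have hmat : Continuous fun y : (En n × (Fin m → Fin n → ℝ)) × En n =>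
      matMap y.1.2 (y.2 - y.1.1) := Continuous.matMap (by fun_prop) (by fun_prop)
  have hP : MeasurableSet P := by
    have hclosed : IsClosed {y : (En n × (Fin m → Fin n → ℝ)) × En n |
        ‖y.2 - y.1.1‖ ≤ n * |y.2 j - y.1.1 j|} := isClosed_le (by fun_prop) (by fun_prop)
    refine hclosed.measurableSet.inter
      (IsOpen.measurableSet (IsOpen.and ?_ ?_))
    · exact isOpen_lt (by fun_prop) (by fun_prop)
    · exact isOpen_lt hmat.norm (by fun_prop)
  have hsec : ∀ z, Prod.mk z ⁻¹' P = sector z.1 j ∩ fiberCone (matMap z.2) z.1 r s := fun z => by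
    ext x
    simp [P, fiberCone, sector]
  simpa only [hsec] using measurable_measure_inter_section hK hfin hP

lemma measurableSet_denseCones {n m : ℕ} {K : Set (En n)} (hK : MeasurableSet K)
    (hfin : μH[m] K < ⊤) : MeasurableSet
      {z : En n × (Fin m → Fin n → ℝ) | DenseCones K (matMap z.2) z.1} := by
  simp only [DenseCones]
  rw [measurableSet_setOfPred]
  refine Measurable.forall fun k => Measurable.exists fun p => measurable_const.and
    (Measurable.exists fun i => measurableSet_setOfPred.1 ?_)
  exact measurableSet_lt measurable_const (measurable_measure_fiberCone hK hfin _ _)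

lemma measurableSet_sparseInSector {n m : ℕ} {K : Set (En n)} (hK : MeasurableSet K)
    (hfin : μH[m] K < ⊤) (j : Fin n) (q : ℕ) : MeasurableSet
      {z : En n × (Fin m → Fin n → ℝ) | SparseInSector K (matMap z.2) z.1 j q} := by
  simp only [SparseInSector]
  rw [measurableSet_setOfPred]
  refine Measurable.forall fun k => Measurable.exists fun p₀ => Measurable.forall fun p =>
    Measurable.forall fun _ => Measurable.forall fun i => Measurable.forall fun _ =>
    measurableSet_setOfPred.1 ?_
  exact measurableSet_le (measurable_measure_sector_fiberCone hK hfin _ _ _) measurable_const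

lemma measurableSet_fiberReturns {n m : ℕ} {K : Set (En n)} (hK : IsCompact K) (q : ℕ) :
    MeasurableSet {z : En n × (Fin m → Fin n → ℝ) | FiberReturns K (matMap z.2) z.1 q} := by
  have hopen : IsOpen {y : (En n × (Fin m → Fin n → ℝ)) × K |
      (y.2 : En n) ≠ y.1.1 ∧ dist (y.2 : En n) y.1.1 < (1 / 2) ^ q} :=
    IsOpen.and (isOpen_ne_fun (by fun_prop) (by fun_prop)) (isOpen_lt (by fun_prop) (by fun_prop))
  have hclosed : IsClosed {y : (En n × (Fin m → Fin n → ℝ)) × K |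
      matMap y.1.2 (y.2 : En n) = matMap y.1.2 y.1.1} :=
    isClosed_eq (Continuous.matMap (by fun_prop) (by fun_prop))
      (Continuous.matMap (by fun_prop) (by fun_prop))
  obtain ⟨F, hFc, -, hFU, -⟩ := hopen.exists_iUnion_isClosed
  have : CompactSpace K := isCompact_iff_compactSpace.1 hK
  have heq : {z : En n × (Fin m → Fin n → ℝ) | FiberReturns K (matMap z.2) z.1 q} =
      ⋃ k, Prod.fst '' (F k ∩ {y | matMap y.1.2 (y.2 : En n) = matMap y.1.2 y.1.1}) := by
    rw [← image_iUnion, ← iUnion_inter, hFU]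
    ext z
    constructor
    · rintro ⟨x, hx, h1, h2, h3⟩
      exact ⟨(z, ⟨x, hx⟩), ⟨⟨h1, h2⟩, h3⟩, rfl⟩
    · rintro ⟨⟨z, x, hx⟩, ⟨⟨h1, h2⟩, h3⟩, rfl⟩
      exact ⟨x, hx, h1, h2, h3⟩
  rw [heq]
  exact MeasurableSet.iUnion fun k =>
    (isClosedMap_fst_of_compactSpace _ ((hFc k).inter hclosed)).measurableSet

/-- Besicovitch–Federer: almost every linear projection of a purely unrectifiable compact set of
finite measure is Lebesgue null. -/
theorem ae_volume_matMap_image_eq_zero {n m : ℕ} (hm : 0 < m) {K : Set (En n)} (hK : IsCompact K)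
    (hfin : μH[m] K < ⊤) (hKu : PurelyUnrectifiable n m K) :
    ∀ᵐ w : Fin m → Fin n → ℝ, volume (matMap w '' K) = 0 := by
  have hKm := hK.measurableSet
  set P : Fin n → ℕ → Set (En n × (Fin m → Fin n → ℝ)) := fun j q =>
    {z | FiberReturns K (matMap z.2) z.1 q} ∪ ({z | DenseCones K (matMap z.2) z.1} ∪
      {z | SparseInSector K (matMap z.2) z.1 j q})
  have hPm : ∀ j q, MeasurableSet (P j q) := fun j q =>
    (measurableSet_fiberReturns hK q).union ((measurableSet_denseCones hKm hfin).union
      (measurableSet_sparseInSector hKm hfin j q))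
  have : IsFiniteMeasure ((μH[m] : Measure (En n)).restrict K) := ⟨by simpa using hfin⟩
  have hsec : ∀ a j q, ∀ᵐ w : Fin m → Fin n → ℝ, (a, w) ∈ P j q := fun a j q =>
    measure_eq_zero_of_forall_slice_null volume (volume : Measure (Fin m → ℝ))
      (NeZero.ne _) (measurable_columnMatrix j) (measurable_prodMk_left (hPm j q)).compl fun w =>
        ae_fiberReturns_or_dense_or_sparse hK w a j q
  have hae : ∀ᵐ w : Fin m → Fin n → ℝ, ∀ᵐ a ∂((μH[m] : Measure (En n)).restrict K),
      ∀ j q, (a, w) ∈ P j q := by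
    refine (Measure.ae_ae_comm ?_).1 (Eventually.of_forall fun a =>
      ae_all_iff.2 fun j => ae_all_iff.2 fun q => hsec a j q)
    rw [measurableSet_setOfPred]
    exact Measurable.forall fun j => Measurable.forall fun q => measurableSet_setOfPred.1 (hPm j q)
  filter_upwards [hae] with w hw
  set L := matMap w
  set N : Set (En n) := {a ∈ K | ¬ ∀ j q, (a, w) ∈ P j q}
  have hN : μH[m] N = 0 := by
    rw [ae_iff, Measure.restrict_apply' hKm] at hw
    refine measure_mono_null (fun a ha => ?_) hw
    exact ⟨ha.2, ha.1⟩
  have hLnull : ∀ S : Set (En n), μH[m] S = 0 → volume (L '' S) = 0 := fun S hS => by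
    simpa [hS] using volume_image_le_hausdorffMeasure L.lipschitz S
  have hsub : L '' K ⊆ L '' N ∪ (L '' {a ∈ K | SparseCones K L a} ∪
      (L '' {a | DenseCones K L a} ∪ L '' {a | ∀ q, FiberReturns K L a q})) := by
    rw [← image_union, ← image_union, ← image_union]
    refine image_mono fun a ha => ?_
    by_cases hgood : ∀ j q, (a, w) ∈ P j q
    · right
      by_cases hD : DenseCones K L a
      · exact Or.inr (Or.inl hD)
      by_cases hF : ∀ q, FiberReturns K L a q
      · exact Or.inr (Or.inr hF)
      push Not at hF
      obtain ⟨q, hq⟩ := hF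
      refine Or.inl ⟨ha, sparseCones_of_sparseInSector (q := q) fun j => ?_⟩
      rcases hgood j q with h | h | h
      · exact absurd h hq
      · exact absurd h hD
      · exact h
    · exact Or.inl ⟨ha, hgood⟩
  refine measure_mono_null hsub ?_
  simp only [measure_union_null_iff]
  exact ⟨hLnull _ hN, hLnull _ (hausdorffMeasure_sparseCones_eq_zero hm hKm hfin hKu L),
    volume_image_denseCones_eq_zero hKm hfin L, volume_image_fiberReturns_eq_zero hKm hfin L⟩

lemma ae_comp_of_ae {n m : ℕ} {σ : Fin m → Fin n} (hσ : σ.Injective)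
    {p : (Fin m → Fin n → ℝ) → Prop} (h : ∀ᵐ w, p w) :
    ∀ᵐ Φ : Fin n → Fin n → ℝ, p (Φ ∘ σ) := by
  set N := toMeasurable volume {w | ¬ p w}
  have hN : volume N = 0 := (measure_toMeasurable _).trans h
  have hcomp : Measurable fun Φ : Fin n → Fin n → ℝ => Φ ∘ σ :=
    measurable_pi_lambda _ fun k => measurable_pi_apply (σ k)
  have hT : Measurable fun v : Fin m → Fin n → ℝ => Function.extend σ v 0 := by
    refine measurable_pi_lambda _ fun i => ?_
    by_cases hi : ∃ k, σ k = i
    · obtain ⟨k, rfl⟩ := hi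
      simpa only [hσ.extend_apply] using measurable_pi_apply k
    · simpa only [Function.extend_apply' _ _ _ hi] using measurable_const
  have hnull : volume {Φ : Fin n → Fin n → ℝ | Φ ∘ σ ∈ N} = 0 := by
    refine measure_eq_zero_of_forall_slice_null volume (volume : Measure (Fin m → Fin n → ℝ))
      (NeZero.ne _) hT (hcomp (measurableSet_toMeasurable _ _)) fun w => ?_
    have heq : {v : Fin m → Fin n → ℝ | w + Function.extend σ v 0 ∈
        {Φ : Fin n → Fin n → ℝ | Φ ∘ σ ∈ N}} = (fun v => w ∘ σ + v) ⁻¹' N := by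
      ext v
      have : (w + Function.extend σ v 0) ∘ σ = w ∘ σ + v := by
        ext k
        simp [hσ.extend_apply]
      simp only [mem_ofPred_eq, mem_preimage, this]
    rw [heq, measure_preimage_add, hN]
  exact measure_mono_null (fun Φ hΦ => subset_toMeasurable volume {w | ¬ p w} hΦ) hnull

lemma norm_le_mul_norm_ofLp {n : ℕ} (x : En n) : ‖x‖ ≤ n * ‖x.ofLp‖ := by
  rw [EuclideanSpace.norm_eq, Real.sqrt_le_left (by positivity)]
  calc ∑ i, ‖x i‖ ^ 2 ≤ (∑ i, ‖x i‖) ^ 2 :=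
        Finset.sum_sq_le_sq_sum_of_nonneg fun _ _ => norm_nonneg _
    _ ≤ (n * ‖x.ofLp‖) ^ 2 := by
        gcongr
        refine (Finset.sum_le_card_nsmul _ _ _ fun i _ => norm_le_pi_norm x.ofLp i).trans ?_
        simp

lemma norm_ofLp_le_norm {n : ℕ} (x : En n) : ‖x.ofLp‖ ≤ ‖x‖ :=
  (pi_norm_le_iff_of_nonneg (norm_nonneg _)).2 fun i => PiLp.norm_apply_le x i

/-- Coordinates close to the standard ones in which all coordinate `m`-projections of `K` are
null. -/
lemma exists_coordinates_projections_null {n m : ℕ} (hm : 0 < m) {K : Set (En n)}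
    (hK : IsCompact K) (hfin : μH[m] K < ⊤) (hKu : PurelyUnrectifiable n m K) :
    ∃ A : En n ≃L[ℝ] (Fin n → ℝ), (∀ x, ‖A x‖ ≤ 2 * ‖x‖) ∧ (∀ y, ‖A.symm y‖ ≤ 2 * n * ‖y‖) ∧
      ∀ σ : Fin m → Fin n, σ.Injective → volume ((fun y => y ∘ σ) '' (A '' K)) = 0 := by
  have hae : ∀ᵐ Φ : Fin n → Fin n → ℝ, ∀ σ : Fin m → Fin n, σ.Injective →
      volume (matMap (Φ ∘ σ) '' K) = 0 := by
    refine ae_all_iff.2 fun σ => ?_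
    by_cases hσ : σ.Injective
    · exact (ae_comp_of_ae hσ (ae_volume_matMap_image_eq_zero hm hK hfin hKu)).mono fun _ h _ => h
    · exact Eventually.of_forall fun _ h => absurd h hσ
  set I : Fin n → Fin n → ℝ := fun i j => if i = j then 1 else 0
  obtain ⟨Φ, hΦ, hΦσ⟩ := (Measure.dense_of_ae hae).exists_mem_open
    (isOpen_ball (x := I) (ε := 1 / (2 * (n + 1)))) ⟨I, mem_ball_self (by positivity)⟩
  have hdiff : ∀ x : En n, ‖matMap Φ x - x.ofLp‖ ≤ 1 / 2 * ‖x.ofLp‖ := by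
    intro x
    refine (pi_norm_le_iff_of_nonneg (by positivity)).2 fun k => ?_
    have h1 : (matMap Φ x - x.ofLp) k = ∑ l, (Φ k l - I k l) * x l := by
      simp [matMap_apply, I, sub_mul, Finset.sum_sub_distrib]
    rw [h1]
    have h2 : ∀ l, ‖(Φ k l - I k l) * x l‖ ≤ 1 / (2 * (n + 1)) * ‖x.ofLp‖ := fun l => by
      rw [norm_mul]
      gcongr
      · rw [← dist_eq_norm]
        exact ((dist_le_pi_dist (Φ k) (I k) l).trans (dist_le_pi_dist Φ I k)).trans hΦσ.le
      · exact norm_le_pi_norm x.ofLp l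
    refine (norm_sum_le_of_le _ fun l _ => h2 l).trans ?_
    rw [Finset.sum_const, Finset.card_univ, Fintype.card_fin, nsmul_eq_mul, ← mul_assoc]
    gcongr
    field_simp
    linarith
  have hlow : ∀ x : En n, ‖x‖ ≤ 2 * n * ‖matMap Φ x‖ := by
    intro x
    have h1 := hdiff x
    have h2 : ‖x.ofLp‖ ≤ ‖matMap Φ x‖ + ‖matMap Φ x - x.ofLp‖ := by
      rw [norm_sub_rev]
      exact norm_le_norm_add_norm_sub' _ _
    calc ‖x‖ ≤ n * ‖x.ofLp‖ := norm_le_mul_norm_ofLp x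
      _ ≤ n * (2 * ‖matMap Φ x‖) := by gcongr; linarith
      _ = _ := by ring
  have hinj : Function.Injective (matMap Φ : En n →ₗ[ℝ] (Fin n → ℝ)) := by
    refine (injective_iff_map_eq_zero _).2 fun x hx => norm_le_zero_iff.1 ?_
    have h1 := hlow x
    rwa [show matMap Φ x = 0 from hx, norm_zero, mul_zero] at h1
  set A := (LinearMap.linearEquivOfInjective _ hinj (by simp)).toContinuousLinearEquiv
  have hA : ∀ x, A x = matMap Φ x := fun x => rfl
  refine ⟨A, fun x => ?_, fun y => ?_, fun σ hσ => ?_⟩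
  · have h1 := hdiff x
    have h2 := norm_ofLp_le_norm x
    have h3 : ‖A x‖ ≤ ‖x.ofLp‖ + ‖matMap Φ x - x.ofLp‖ := norm_le_norm_add_norm_sub' _ _
    linarith [norm_nonneg x]
  · have := hlow (A.symm y)
    rwa [← hA, A.apply_symm_apply] at this
  · rw [image_image]
    exact hΦ σ hσ

/-- The staircase which is flat except on the last `N`-th of every unit interval. -/
def stair (N : ℕ) (u : ℝ) : ℝ := ⌊u⌋ + max 0 (N * (Int.fract u - 1) + 1)

lemma stair_eq_floor {N : ℕ} (hN : 0 < N) {u : ℝ} (hu : Int.fract u ≤ 1 - 1 / N) :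
    stair N u = ⌊u⌋ := by
  have hN' : (0 : ℝ) < N := by exact_mod_cast hN
  rw [stair, max_eq_left, add_zero]
  have : (N : ℝ) * (Int.fract u - 1) ≤ N * (-(1 / N)) := by gcongr; linarith
  rw [mul_neg, mul_one_div_cancel hN'.ne'] at this
  linarith

lemma abs_stair_sub_le {N : ℕ} (u : ℝ) : |stair N u - u| ≤ 1 := by
  have h1 := Int.self_sub_floor u
  have h2 := Int.fract_nonneg u
  have h3 := (Int.fract_lt_one u).le
  have h4 : max 0 ((N : ℝ) * (Int.fract u - 1) + 1) ≤ 1 :=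
    max_le zero_le_one (by nlinarith [Nat.cast_nonneg (α := ℝ) N])
  have h5 := le_max_left 0 ((N : ℝ) * (Int.fract u - 1) + 1)
  rw [stair, abs_le]
  constructor <;> linarith

lemma stair_sub_mem_Icc {N : ℕ} (hN : 0 < N) {u v : ℝ} (huv : u ≤ v) :
    stair N v - stair N u ∈ Icc 0 (N * (v - u)) := by
  have hN' : (1 : ℝ) ≤ N := by exact_mod_cast hN
  have hu := Int.self_sub_floor u
  have hv := Int.self_sub_floor v
  have hu0 := Int.fract_nonneg u
  have hu1 := Int.fract_lt_one u
  have hv0 := Int.fract_nonneg v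
  have hv1 := Int.fract_lt_one v
  have hfl : ⌊u⌋ ≤ ⌊v⌋ := Int.floor_le_floor huv
  unfold stair
  rcases hfl.eq_or_lt with h | h
  · rw [h] at hu ⊢
    have hf : Int.fract u ≤ Int.fract v := by linarith
    constructor
    · have : max 0 ((N : ℝ) * (Int.fract u - 1) + 1) ≤ max 0 (N * (Int.fract v - 1) + 1) := by
        gcongr
      linarith
    · have : max 0 ((N : ℝ) * (Int.fract v - 1) + 1) ≤
          max 0 (N * (Int.fract u - 1) + 1) + N * (v - u) := by
        refine max_le (add_nonneg (le_max_left _ _) (by nlinarith)) ?_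
        have := le_max_right 0 ((N : ℝ) * (Int.fract u - 1) + 1)
        rw [show v - u = Int.fract v - Int.fract u by linarith]
        linarith
      linarith
  · have h' : (⌊u⌋ : ℝ) + 1 ≤ ⌊v⌋ := by exact_mod_cast h
    have h1 := le_max_left 0 ((N : ℝ) * (Int.fract v - 1) + 1)
    have h2 := le_max_right 0 ((N : ℝ) * (Int.fract u - 1) + 1)
    have h3 : max 0 ((N : ℝ) * (Int.fract u - 1) + 1) ≤ 1 := max_le zero_le_one (by nlinarith)
    have h4 : max 0 ((N : ℝ) * (Int.fract v - 1) + 1) ≤ N * Int.fract v :=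
      max_le (by positivity) (by nlinarith)
    constructor
    · linarith
    · have h5 : ((⌊v⌋ : ℝ) - (⌊u⌋ + 1)) ≤ N * (⌊v⌋ - (⌊u⌋ + 1)) := by nlinarith
      rw [show v - u = ⌊v⌋ + Int.fract v - (⌊u⌋ + Int.fract u) by linarith]
      linarith

lemma abs_stair_sub_stair_le {N : ℕ} (hN : 0 < N) (u v : ℝ) :
    |stair N u - stair N v| ≤ N * |u - v| := by
  rcases le_total u v with h | h
  · obtain ⟨h1, h2⟩ := stair_sub_mem_Icc hN h
    rwa [abs_sub_comm, abs_of_nonneg h1, abs_sub_comm, abs_of_nonneg (sub_nonneg.2 h)]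
  · obtain ⟨h1, h2⟩ := stair_sub_mem_Icc hN h
    rwa [abs_of_nonneg h1, abs_of_nonneg (sub_nonneg.2 h)]

/-- The staircase of mesh `δ` with offset `a / N`. -/
def gridStair (N : ℕ) (δ : ℝ) (a : Fin N) (t : ℝ) : ℝ := δ * stair N (t / δ + a / N)

/-- `t` lies in the steep part of the staircase with offset `a / N`. -/
def Steep (N : ℕ) (δ : ℝ) (a : Fin N) (t : ℝ) : Prop := 1 - 1 / (N : ℝ) < Int.fract (t / δ + a / N)

lemma Steep.eq {N : ℕ} {δ t : ℝ} {a b : Fin N} (ha : Steep N δ a t) (hb : Steep N δ b t) :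
    a = b := by
  wlog hab : a ≤ b generalizing a b
  · exact (this hb ha (le_of_not_ge hab)).symm
  by_contra hne
  have hlt : a < b := lt_of_le_of_ne hab hne
  have hN : (0 : ℝ) < N := by exact_mod_cast a.pos
  unfold Steep at ha hb
  have ha1 := Int.fract_lt_one (t / δ + a / N)
  have hb1 := Int.fract_lt_one (t / δ + b / N)
  have ha2 := Int.self_sub_floor (t / δ + a / N)
  have hb2 := Int.self_sub_floor (t / δ + b / N)
  set fa := Int.fract (t / δ + a / N)
  set fb := Int.fract (t / δ + b / N)
  have h1 : 1 / (N : ℝ) ≤ b / N - a / N := by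
    rw [← sub_div]
    gcongr
    have : (a : ℝ) + 1 ≤ b := by exact_mod_cast hlt
    linarith
  have h2 : (b : ℝ) / N - a / N ≤ 1 - 1 / N := by
    rw [← sub_div, le_sub_iff_add_le, ← add_div, div_le_one hN]
    have : (b : ℝ) + 1 ≤ N := by exact_mod_cast b.2
    linarith [Nat.cast_nonneg (α := ℝ) (a : ℕ)]
  have h3 : (0 : ℝ) < ((⌊t / δ + b / N⌋ - ⌊t / δ + a / N⌋ : ℤ) : ℝ) := by push_cast; linarith
  have h4 : ((⌊t / δ + b / N⌋ - ⌊t / δ + a / N⌋ : ℤ) : ℝ) < 1 := by push_cast; linarith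
  have h5 : 0 < ⌊t / δ + b / N⌋ - ⌊t / δ + a / N⌋ := by exact_mod_cast h3
  have h6 : ⌊t / δ + b / N⌋ - ⌊t / δ + a / N⌋ < 1 := by exact_mod_cast h4
  omega

lemma measurableSet_steep (N : ℕ) (δ : ℝ) (a : Fin N) : MeasurableSet {t | Steep N δ a t} :=
  measurableSet_lt measurable_const (measurable_fract.comp (by fun_prop))

lemma dist_gridStair_le {N : ℕ} {δ : ℝ} (hδ : 0 < δ) (a : Fin N) (t : ℝ) :
    dist (gridStair N δ a t) t ≤ 2 * δ := by
  have hN : (0 : ℝ) < N := by exact_mod_cast a.pos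
  have h1 := abs_le.1 (abs_stair_sub_le (N := N) (t / δ + a / N))
  have h2 : (a : ℝ) / N ≤ 1 := by
    rw [div_le_one hN]
    exact_mod_cast a.2.le
  have h3 : (0 : ℝ) ≤ (a : ℝ) / N := by positivity
  have h4 : gridStair N δ a t - t = δ * (stair N (t / δ + a / N) - t / δ) := by
    rw [gridStair, mul_sub, mul_div_cancel₀ _ hδ.ne']
  rw [Real.dist_eq, h4, abs_mul, abs_of_pos hδ, mul_comm]
  gcongr
  rw [abs_le]
  constructor <;> linarith

lemma dist_gridStair_gridStair_le {N : ℕ} {δ : ℝ} (hδ : 0 < δ) (a : Fin N) (t u : ℝ) :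
    dist (gridStair N δ a t) (gridStair N δ a u) ≤ N * dist t u := by
  rw [Real.dist_eq, Real.dist_eq, gridStair, gridStair, ← mul_sub, abs_mul, abs_of_pos hδ]
  calc δ * |stair N (t / δ + a / N) - stair N (u / δ + a / N)|
      ≤ δ * (N * |t / δ + a / N - (u / δ + a / N)|) := by
        gcongr
        exact abs_stair_sub_stair_le a.pos _ _
    _ = N * |t - u| := by
        rw [add_sub_add_right_eq_sub, ← sub_div, abs_div, abs_of_pos hδ]
        field_simp

lemma exists_gridStair_eq {N : ℕ} {δ : ℝ} {a : Fin N} {t : ℝ} (h : ¬ Steep N δ a t) :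
    ∃ z : ℤ, gridStair N δ a t = δ * z :=
  ⟨_, by rw [gridStair, stair_eq_floor a.pos (not_lt.1 h)]⟩

/-- The coordinatewise staircase with offsets `α`. -/
def gridMap {n N : ℕ} (δ : ℝ) (α : Fin n → Fin N) (y : Fin n → ℝ) : Fin n → ℝ :=
  fun i => gridStair N δ (α i) (y i)

lemma lipschitzWith_gridMap {n N : ℕ} {δ : ℝ} (hδ : 0 < δ) (α : Fin n → Fin N) :
    LipschitzWith N (gridMap δ α) := by
  refine LipschitzWith.of_dist_le_mul fun x y => (dist_pi_le_iff (by positivity)).2 fun i => ?_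
  refine (dist_gridStair_gridStair_le hδ (α i) (x i) (y i)).trans ?_
  rw [NNReal.coe_natCast]
  gcongr
  exact dist_le_pi_dist x y i

lemma dist_gridMap_le {n N : ℕ} {δ : ℝ} (hδ : 0 < δ) (α : Fin n → Fin N) (y : Fin n → ℝ) :
    dist (gridMap δ α y) y ≤ 2 * δ :=
  (dist_pi_le_iff (by positivity)).2 fun i => dist_gridStair_le hδ (α i) (y i)

/-- The points with at least `m + 1` steep coordinates. -/
def steepSet {n N : ℕ} (m : ℕ) (δ : ℝ) (α : Fin n → Fin N) : Set (Fin n → ℝ) :=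
  {y | ∃ J : Finset (Fin n), m + 1 ≤ J.card ∧ ∀ i ∈ J, Steep N δ (α i) (y i)}

lemma measurableSet_steepSet {n N : ℕ} (m : ℕ) (δ : ℝ) (α : Fin n → Fin N) :
    MeasurableSet (steepSet m δ α) := by
  unfold steepSet
  rw [measurableSet_setOfPred]
  refine Measurable.exists fun J => measurable_const.and (Measurable.forall fun i =>
    Measurable.forall fun _ => measurableSet_setOfPred.1 ?_)
  exact (measurableSet_steep N δ (α i)).preimage (measurable_pi_apply i)

open Classical in
lemma card_steep_mul_le {n N : ℕ} (m : ℕ) (δ : ℝ) (y : Fin n → ℝ) :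
    (Finset.univ.filter fun α : Fin n → Fin N => y ∈ steepSet m δ α).card * N ^ (m + 1) ≤
      2 ^ n * N ^ n := by
  rcases Nat.eq_zero_or_pos N with rfl | hN
  · simp
  set T : Finset (Fin n) → Finset (Fin n → Fin N) := fun J =>
    Finset.univ.filter fun α => ∀ i ∈ J, Steep N δ (α i) (y i)
  have hT : ∀ J, (T J).card * N ^ J.card ≤ N ^ n := by
    intro J
    have h1 : T J = Fintype.piFinset fun i => if i ∈ J then
        Finset.univ.filter fun a => Steep N δ a (y i) else Finset.univ := by
      ext α
      simp only [T, Finset.mem_filter, Finset.mem_univ, true_and, Fintype.mem_piFinset]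
      refine forall_congr' fun i => ?_
      by_cases hi : i ∈ J <;> simp [hi]
    have h2 : N ^ J.card = ∏ i, if i ∈ J then N else 1 := by
      rw [Finset.prod_ite_mem, Finset.univ_inter, Finset.prod_const]
    rw [h1, Fintype.card_piFinset, h2, ← Finset.prod_mul_distrib]
    refine (Finset.prod_le_pow_card _ _ N fun i _ => ?_).trans_eq (by simp)
    by_cases hi : i ∈ J
    · simp only [hi, if_true]
      refine (Nat.mul_le_mul_right N ?_).trans_eq (one_mul N)
      exact Finset.card_le_one.2 fun a ha b hb =>
        (Finset.mem_filter.1 ha).2.eq (Finset.mem_filter.1 hb).2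
    · simp [hi]
  have hsub : (Finset.univ.filter fun α : Fin n → Fin N => y ∈ steepSet m δ α) ⊆
      (Finset.univ.filter fun J : Finset (Fin n) => m + 1 ≤ J.card).biUnion T := by
    intro α hα
    obtain ⟨J, hJ, hs⟩ := (Finset.mem_filter.1 hα).2
    exact Finset.mem_biUnion.2 ⟨J, by simpa using hJ, by simpa [T] using hs⟩
  calc _ ≤ (∑ J with m + 1 ≤ J.card, (T J).card) * N ^ (m + 1) := by
        gcongr
        exact (Finset.card_le_card hsub).trans Finset.card_biUnion_le
    _ = ∑ J with m + 1 ≤ J.card, (T J).card * N ^ (m + 1) := Finset.sum_mul _ _ _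
    _ ≤ ∑ J : Finset (Fin n) with m + 1 ≤ J.card, N ^ n := by
        refine Finset.sum_le_sum fun J hJ => le_trans ?_ (hT J)
        gcongr
        exact (Finset.mem_filter.1 hJ).2
    _ ≤ ∑ _J : Finset (Fin n), N ^ n := Finset.sum_le_sum_of_subset (Finset.filter_subset _ _)
    _ = 2 ^ n * N ^ n := by simp

lemma exists_offset_measure_steepSet_le {n N : ℕ} (m : ℕ) (hN : 0 < N) (δ : ℝ)
    (μ : Measure (Fin n → ℝ)) :
    ∃ α : Fin n → Fin N, μ (steepSet m δ α) * N ^ (m + 1) ≤ 2 ^ n * μ univ := by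
  classical
  by_contra! hcon
  have : Nonempty (Fin n → Fin N) := ⟨fun _ => ⟨0, hN⟩⟩
  have h1 := ENNReal.sum_lt_sum_of_nonempty (s := (Finset.univ : Finset (Fin n → Fin N)))
    Finset.univ_nonempty fun α _ => hcon α
  refine h1.not_ge ?_
  calc ∑ α : Fin n → Fin N, μ (steepSet m δ α) * N ^ (m + 1)
      = ∫⁻ y, (∑ α : Fin n → Fin N, (steepSet m δ α).indicator 1 y) * N ^ (m + 1) ∂μ := by
        rw [lintegral_mul_const' _ _ (by finiteness), lintegral_finsetSum _ fun α _ =>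
          measurable_one.indicator (measurableSet_steepSet m δ α), Finset.sum_mul]
        simp [lintegral_indicator_one (measurableSet_steepSet m δ _)]
    _ ≤ ∫⁻ y, 2 ^ n * N ^ n ∂μ := by
        refine lintegral_mono fun y => ?_
        have h2 : ∑ α : Fin n → Fin N, (steepSet m δ α).indicator (1 : (Fin n → ℝ) → ℝ≥0∞) y =
            (Finset.univ.filter fun α : Fin n → Fin N => y ∈ steepSet m δ α).card := by
          simp [Set.indicator_apply]
        simp only [h2]
        exact_mod_cast card_steep_mul_le m δ y
    _ = ∑ _α : Fin n → Fin N, 2 ^ n * μ univ := by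
        simp
        ring

lemma hausdorffMeasure_gridMap_diff_steepSet {n m N : ℕ} (hmn : m ≤ n) {δ : ℝ} (hδ : 0 < δ)
    (α : Fin n → Fin N) {X : Set (Fin n → ℝ)}
    (hX : ∀ σ : Fin m → Fin n, σ.Injective → volume ((fun y => y ∘ σ) '' X) = 0) :
    μH[m] (gridMap δ α '' (X \ steepSet m δ α)) = 0 := by
  classical
  set f : (Fin m → Fin n) → (Fin n → ℤ) → (Fin m → ℝ) → Fin n → ℝ := fun σ z v i =>
    if h : ∃ k, σ k = i then gridStair N δ (α i) (v h.choose) else δ * z i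
  have hf : ∀ σ z, LipschitzWith N (f σ z) := by
    intro σ z
    refine LipschitzWith.of_dist_le_mul fun x y => (dist_pi_le_iff (by positivity)).2 fun i => ?_
    by_cases h : ∃ k, σ k = i
    · simp only [f, dif_pos h]
      refine (dist_gridStair_gridStair_le hδ (α i) _ _).trans ?_
      rw [NNReal.coe_natCast]
      gcongr
      exact dist_le_pi_dist x y _
    · simp only [f, dif_neg h, dist_self]
      positivity
  have hsub : gridMap δ α '' (X \ steepSet m δ α) ⊆
      ⋃ σ : {σ : Fin m → Fin n // σ.Injective}, ⋃ z : Fin n → ℤ,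
        f σ z '' ((fun y => y ∘ σ.1) '' X) := by
    rintro - ⟨y, ⟨hyX, hy⟩, rfl⟩
    set J : Finset (Fin n) := Finset.univ.filter fun i => Steep N δ (α i) (y i)
    have hJ : J.card ≤ m := by
      by_contra! hcon
      exact hy ⟨J, hcon, fun i hi => (Finset.mem_filter.1 hi).2⟩
    obtain ⟨J', hJJ', -, hJ'⟩ := Finset.exists_subsuperset_card_eq (Finset.subset_univ J) hJ
      (by simpa using hmn)
    set σ : Fin m → Fin n := fun k => J'.orderEmbOfFin hJ' k
    have hσ : ∀ i, (∃ k, σ k = i) ↔ i ∈ J' := fun i => by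
      have := Finset.range_orderEmbOfFin J' hJ'
      rw [← Finset.mem_coe, ← this]
      rfl
    have hflat : ∀ i, ∃ z : ℤ, i ∉ J' → gridStair N δ (α i) (y i) = δ * z := by
      intro i
      by_cases hi : i ∈ J'
      · exact ⟨0, fun h => absurd hi h⟩
      · have hns : ¬ Steep N δ (α i) (y i) := fun h => hi (hJJ' (by simpa [J] using h))
        obtain ⟨z, hz⟩ := exists_gridStair_eq hns
        exact ⟨z, fun _ => hz⟩
    choose z hz using hflat
    refine mem_iUnion.2 ⟨⟨σ, (J'.orderEmbOfFin hJ').injective⟩, mem_iUnion.2 ⟨z, y ∘ σ,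
      mem_image_of_mem _ hyX, ?_⟩⟩
    ext i
    by_cases h : ∃ k, σ k = i
    · simp only [f, dif_pos h, gridMap, Function.comp_apply, h.choose_spec]
    · simp only [f, dif_neg h, gridMap, hz i (mt (hσ i).2 h)]
  refine measure_mono_null hsub (measure_iUnion_null fun σ => measure_iUnion_null fun z => ?_)
  have h0 : μH[m] ((fun y => y ∘ σ.1) '' X) = 0 := by
    have := hX σ.1 σ.2
    rwa [← hausdorffMeasure_pi_real, Fintype.card_fin] at this
  have h1 := (hf σ z).hausdorffMeasure_image_le (Nat.cast_nonneg (α := ℝ) m)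
    ((fun y => y ∘ σ.1) '' X)
  rw [h0, mul_zero] at h1
  exact le_antisymm h1 (zero_le)

/-- A Lipschitz map close to the identity which nearly annihilates a set all of whose coordinate
`m`-projections are null. -/
lemma exists_gridMap_hausdorffMeasure_le {n m N : ℕ} (hmn : m ≤ n) (hN : 0 < N) {δ : ℝ}
    (hδ : 0 < δ) {X : Set (Fin n → ℝ)} (hXm : MeasurableSet X)
    (hX : ∀ σ : Fin m → Fin n, σ.Injective → volume ((fun y => y ∘ σ) '' X) = 0) :
    ∃ S : (Fin n → ℝ) → Fin n → ℝ, LipschitzWith N S ∧ (∀ y, dist (S y) y ≤ 2 * δ) ∧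
      N * μH[m] (S '' X) ≤ 2 ^ n * μH[m] X := by
  obtain ⟨α, hα⟩ := exists_offset_measure_steepSet_le m hN δ
    ((μH[m] : Measure (Fin n → ℝ)).restrict X)
  refine ⟨gridMap δ α, lipschitzWith_gridMap hδ α, dist_gridMap_le hδ α, ?_⟩
  rw [Measure.restrict_apply' hXm, Measure.restrict_apply_univ] at hα
  have h1 : μH[m] (gridMap δ α '' X) ≤ (N : ℝ≥0∞) ^ m * μH[m] (steepSet m δ α ∩ X) := by
    have hsub : gridMap δ α '' X ⊆ gridMap δ α '' (X \ steepSet m δ α) ∪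
        gridMap δ α '' (steepSet m δ α ∩ X) := by
      rw [← image_union, inter_comm, sdiff_union_inter]
    refine (measure_mono hsub).trans ((measure_union_le _ _).trans ?_)
    rw [hausdorffMeasure_gridMap_diff_steepSet hmn hδ α hX, zero_add]
    simpa using (lipschitzWith_gridMap hδ α).hausdorffMeasure_image_le
      (Nat.cast_nonneg (α := ℝ) m) (steepSet m δ α ∩ X)
  calc (N : ℝ≥0∞) * μH[m] (gridMap δ α '' X)
      ≤ N * ((N : ℝ≥0∞) ^ m * μH[m] (steepSet m δ α ∩ X)) := by gcongr
    _ = μH[m] (steepSet m δ α ∩ X) * N ^ (m + 1) := by ring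
    _ ≤ _ := hα

/-- A Lipschitz map close to the identity which nearly annihilates a purely unrectifiable compact
set. -/
lemma exists_lipschitz_hausdorffMeasure_image_le {n m N : ℕ} (hm : 0 < m) (hmn : m ≤ n)
    (hN : 0 < N) {τ : ℝ} (hτ : 0 < τ) {K : Set (En n)} (hK : IsCompact K) (hfin : μH[m] K < ⊤)
    (hKu : PurelyUnrectifiable n m K) :
    ∃ f : En n → En n, LipschitzWith (4 * n * N) f ∧ (∀ x, dist (f x) x ≤ τ) ∧
      N * μH[m] (f '' K) ≤ (4 * n) ^ m * 2 ^ n * μH[m] K := by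
  obtain ⟨A, hA, hA', hσ⟩ := exists_coordinates_projections_null hm hK hfin hKu
  have hn : (0 : ℝ) < n := by exact_mod_cast hm.trans_le hmn
  obtain ⟨S, hS, hSd, hSm⟩ := exists_gridMap_hausdorffMeasure_le hmn hN
    (show 0 < τ / (4 * n) by positivity) (hK.image A.continuous).measurableSet hσ
  have hAl : LipschitzWith 2 A := by
    refine LipschitzWith.of_dist_le_mul fun x y => ?_
    rw [dist_eq_norm, dist_eq_norm, ← map_sub]
    exact hA _
  have hAl' : LipschitzWith (2 * n) A.symm := by
    refine LipschitzWith.of_dist_le_mul fun x y => ?_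
    rw [dist_eq_norm, dist_eq_norm, ← map_sub]
    exact_mod_cast hA' _
  refine ⟨fun x => A.symm (S (A x)), ?_, fun x => ?_, ?_⟩
  · refine (hAl'.comp (hS.comp hAl)).weaken (le_of_eq ?_)
    ring
  · have h1 := hAl'.dist_le_mul (S (A x)) (A x)
    rw [A.symm_apply_apply] at h1
    refine h1.trans ?_
    push_cast
    calc 2 * (n : ℝ) * dist (S (A x)) (A x) ≤ 2 * n * (2 * (τ / (4 * n))) := by
          gcongr
          exact hSd _
      _ = τ := by field_simp; norm_num
  · have hm0 : (0 : ℝ) ≤ m := Nat.cast_nonneg m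
    have h1 : μH[m] ((fun x => A.symm (S (A x))) '' K) ≤
        (2 * n) ^ m * μH[m] (S '' (A '' K)) := by
      have := hAl'.hausdorffMeasure_image_le hm0 (S '' (A '' K))
      rw [image_image, image_image] at this
      simpa using this
    have h2 : μH[m] (A '' K) ≤ 2 ^ m * μH[m] K := by
      simpa using hAl.hausdorffMeasure_image_le hm0 K
    calc N * μH[m] ((fun x => A.symm (S (A x))) '' K)
        ≤ N * ((2 * n) ^ m * μH[m] (S '' (A '' K))) := by gcongr
      _ = (2 * n) ^ m * (N * μH[m] (S '' (A '' K))) := by ring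
      _ ≤ (2 * n) ^ m * (2 ^ n * (2 ^ m * μH[m] K)) :=
          mul_le_mul_right (hSm.trans (mul_le_mul_right h2 _)) _
      _ = (2 * n * 2) ^ m * 2 ^ n * μH[m] K := by rw [mul_pow (2 * (n : ℝ≥0∞)) 2]; ring
      _ = _ := by rw [show (2 : ℝ≥0∞) * n * 2 = 4 * n by ring]

lemma exists_lipschitz_eqOn_eq_off_thickening {n : ℕ} {f : En n → En n} {Λ : NNReal}
    (hf : LipschitzWith Λ f) {K : Set (En n)} (hK : K.Nonempty) {ρ τ : ℝ} (hρ : 0 < ρ)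
    (hτ : τ ≤ ρ) (hfd : ∀ x, dist (f x) x ≤ τ) :
    ∃ g : En n → En n, LipschitzWith (Λ + 3) g ∧ (∀ x, dist (g x) x ≤ τ) ∧
      (∀ x ∈ K, g x = f x) ∧ ∀ x ∉ thickening ρ K, g x = x := by
  set χ : En n → ℝ := fun x => max 0 (1 - infDist x K / ρ)
  have hχ0 : ∀ x, 0 ≤ χ x := fun x => le_max_left _ _
  have hχ1 : ∀ x, χ x ≤ 1 := fun x => max_le zero_le_one
    (sub_le_self _ (div_nonneg infDist_nonneg hρ.le))
  have hχl : ∀ x y, |χ x - χ y| ≤ dist x y / ρ := by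
    intro x y
    have h1 : |χ x - χ y| ≤ |(1 - infDist x K / ρ) - (1 - infDist y K / ρ)| := by
      simpa only [χ, max_comm (0 : ℝ)] using abs_max_sub_max_le_abs _ _ (0 : ℝ)
    refine h1.trans ?_
    rw [show 1 - infDist x K / ρ - (1 - infDist y K / ρ) = (infDist y K - infDist x K) / ρ by ring,
      abs_div, abs_of_pos hρ, dist_comm]
    gcongr
    simpa [Real.dist_eq] using (lipschitz_infDist_pt K).dist_le_mul y x
  simp only [dist_eq_norm] at hfd
  refine ⟨fun x => x + χ x • (f x - x), ?_, fun x => ?_, fun x hx => ?_, fun x hx => ?_⟩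
  · refine LipschitzWith.of_dist_le_mul fun x y => ?_
    have h1 : (x + χ x • (f x - x)) - (y + χ y • (f y - y)) =
        (x - y) + (χ x • ((f x - f y) - (x - y)) + (χ x - χ y) • (f y - y)) := by
      module
    have h2 : ‖f x - f y‖ ≤ Λ * ‖x - y‖ := by
      simpa [dist_eq_norm] using hf.dist_le_mul x y
    have h3 : ‖χ x • ((f x - f y) - (x - y))‖ ≤ 1 * (Λ * ‖x - y‖ + ‖x - y‖) := by
      rw [norm_smul, Real.norm_of_nonneg (hχ0 x)]
      gcongr
      · exact hχ1 x
      · exact (norm_sub_le _ _).trans (by gcongr)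
    have h4 : ‖(χ x - χ y) • (f y - y)‖ ≤ ‖x - y‖ := by
      rw [norm_smul, Real.norm_eq_abs]
      calc |χ x - χ y| * ‖f y - y‖ ≤ dist x y / ρ * ρ := by
            gcongr
            · exact hχl x y
            · exact (hfd y).trans hτ
        _ = ‖x - y‖ := by rw [div_mul_cancel₀ _ hρ.ne', dist_eq_norm]
    rw [dist_eq_norm, dist_eq_norm, h1]
    refine (norm_add_le _ _).trans ((add_le_add_right (norm_add_le _ _) _).trans ?_)
    push_cast
    linarith
  · rw [dist_eq_norm, add_sub_cancel_left, norm_smul, Real.norm_of_nonneg (hχ0 x)]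
    exact (mul_le_of_le_one_left (norm_nonneg _) (hχ1 x)).trans (hfd x)
  · simp [χ, infDist_zero_of_mem hx]
  · rw [mem_thickening_iff_infDist_lt hK, not_lt] at hx
    have : χ x = 0 := max_eq_left (by rw [sub_nonpos]; exact (one_le_div hρ).2 hx)
    simp [this]

lemma PurelyUnrectifiable.eq_empty_of_zero {n : ℕ} {U : Set (En n)}
    (hU : PurelyUnrectifiable n 0 U) : U = ∅ := by
  rw [eq_empty_iff_forall_notMem]
  intro x hx
  have h := hU {x} ⟨fun _ _ => x, fun _ => ⟨0, LipschitzWith.const x⟩, by simp⟩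
  rw [inter_eq_right.2 (singleton_subset_iff.2 hx), Nat.cast_zero,
    Measure.hausdorffMeasure_zero_singleton] at h
  exact one_ne_zero h

lemma hausdorffMeasure_eq_zero_of_finrank_lt {n m : ℕ} (h : n < m) (S : Set (En n)) :
    μH[m] S = 0 := by
  refine hausdorffMeasure_of_dimH_lt (d := m) (lt_of_le_of_lt (dimH_mono (subset_univ S)) ?_)
  rw [Real.dimH_univ_eq_finrank]
  simpa using h

theorem stmt1 (n m : ℕ) (E U : Set (En n)) (hE : MeasurableSet E)
    (hfin : μH[m] E < ⊤) (hcl : μH[(m : ℝ) + 1] (closure E) = 0)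
    (hU : MeasurableSet U) (hUE : U ⊆ E) (hUpure : PurelyUnrectifiable n m U) :
    ∀ ε : ℝ, 0 < ε → ∃ ψ : En n → En n,
      (∃ L : NNReal, LipschitzWith L ψ) ∧
      (∀ x, dist (ψ x) x < ε) ∧
      (∀ x ∉ Metric.thickening ε U, ψ x = x) ∧
      μH[m] (ψ '' (E \ U)) < μH[m] (E \ U) + ENNReal.ofReal ε ∧
      μH[m] (ψ '' U) < ENNReal.ofReal ε := by
  intro ε hε
  have hε' : 0 < ENNReal.ofReal ε := ENNReal.ofReal_pos.2 hε
  have hEUfin : μH[m] (E \ U) < ⊤ := (measure_mono sdiff_subset).trans_lt hfin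
  by_cases hsmall : μH[m] U < ENNReal.ofReal ε
  · refine ⟨id, ⟨1, LipschitzWith.id⟩, fun x => by simpa using hε, fun x _ => rfl, ?_, ?_⟩
    · rw [image_id]
      exact ENNReal.lt_add_right hEUfin.ne hε'.ne'
    · rwa [image_id]
  have hm : 0 < m := by
    by_contra! h0
    obtain rfl : m = 0 := by omega
    simp [hUpure.eq_empty_of_zero, hε] at hsmall
  have hmn : m ≤ n := by
    by_contra! h
    exact hsmall (by rwa [hausdorffMeasure_eq_zero_of_finrank_lt h])
  set e : ℝ≥0∞ := ENNReal.ofReal ε / 2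
  have he : 0 < e := ENNReal.half_pos hε'.ne'
  have hee : e + e = ENNReal.ofReal ε := ENNReal.add_halves _
  have hetop : e ≠ ⊤ := (ENNReal.div_lt_top ENNReal.ofReal_ne_top two_ne_zero).ne
  obtain ⟨N, hNpos, hN⟩ : ∃ N : ℕ, 0 < N ∧ (4 * n) ^ m * 2 ^ n * μH[m] E < N * e := by
    have hC : (4 * n : ℝ≥0∞) ^ m * 2 ^ n * μH[m] E / e ≠ ⊤ :=
      (ENNReal.div_lt_top (by finiteness) he.ne').ne
    obtain ⟨N, hN⟩ := ENNReal.exists_nat_gt hC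
    refine ⟨N, ?_, ?_⟩
    · rcases Nat.eq_zero_or_pos N with rfl | h
      · simp at hN
      · exact h
    · exact (ENNReal.div_lt_iff (Or.inl he.ne') (Or.inl hetop)).1 hN
  set Λ : NNReal := 4 * n * N + 3
  have hΛ : (1 : ℝ≥0∞) ≤ (Λ : ℝ≥0∞) ^ m := by
    refine one_le_pow₀ ?_
    exact_mod_cast le_add_left (show (1 : NNReal) ≤ 3 by norm_num)
  have hΛtop : (Λ : ℝ≥0∞) ^ m ≠ ⊤ := by finiteness
  set d : ℝ≥0∞ := e / (Λ : ℝ≥0∞) ^ m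
  have hd : d ≠ 0 := (ENNReal.div_pos he.ne' hΛtop).ne'
  have hΛd : (Λ : ℝ≥0∞) ^ m * d = e := ENNReal.mul_div_cancel (by positivity) hΛtop
  have : IsFiniteMeasure ((μH[m] : Measure (En n)).restrict E) := ⟨by simpa using hfin⟩
  have hcompact : ∀ A ⊆ E, MeasurableSet A →
      ∃ K ⊆ A, IsCompact K ∧ μH[m] (A \ K) < d := by
    intro A hAE hA
    obtain ⟨K, hKA, hK, hlt⟩ := hA.exists_isCompact_sdiff_lt
      (μ := (μH[m] : Measure (En n)).restrict E) (measure_ne_top _ _) hd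
    exact ⟨K, hKA, hK, by rwa [Measure.restrict_eq_self _ (sdiff_subset.trans hAE)] at hlt⟩
  obtain ⟨K, hKU, hK, hKd⟩ := hcompact U hUE hU
  obtain ⟨C, hCE, hC, hCd⟩ := hcompact (E \ U) sdiff_subset (hE.diff hU)
  have hKne : K.Nonempty := by
    rw [nonempty_iff_ne_empty]
    rintro rfl
    rw [sdiff_empty] at hKd
    refine hsmall (hKd.trans_le ?_)
    calc d ≤ (Λ : ℝ≥0∞) ^ m * d := le_mul_of_one_le_left' hΛ
      _ = e := hΛd
      _ ≤ _ := ENNReal.half_le_self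
  have hKC : Disjoint K C := Set.disjoint_left.2 fun x hxK hxC => (hCE hxC).2 (hKU hxK)
  obtain ⟨r, hr, hrd⟩ := hKC.exists_thickenings hK hC.isClosed
  set ρ := min r ε
  have hρ : 0 < ρ := lt_min hr hε
  have hKfin : μH[m] K < ⊤ := (measure_mono (hKU.trans hUE)).trans_lt hfin
  obtain ⟨f, hf, hfd, hfK⟩ := exists_lipschitz_hausdorffMeasure_image_le hm hmn hNpos
    (half_pos hρ) hK hKfin (hUpure.mono hKU)
  obtain ⟨g, hg, hgd, hgK, hgt⟩ := exists_lipschitz_eqOn_eq_off_thickening hf hKne hρ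
    (half_le_self hρ.le) hfd
  have hgC : ∀ x ∈ C, g x = x := fun x hx => hgt x fun hxK =>
    Set.disjoint_left.1 hrd (thickening_mono (min_le_left _ _) _ hxK)
      (self_subset_thickening hr _ hx)
  have hgd' : ∀ A B : Set (En n), μH[m] (A \ B) < d → μH[m] (g '' (A \ B)) ≤ e := by
    intro A B h
    have h1 := hg.hausdorffMeasure_image_le (Nat.cast_nonneg (α := ℝ) m) (A \ B)
    rw [ENNReal.rpow_natCast] at h1
    exact h1.trans ((mul_le_mul_right h.le _).trans_eq hΛd)
  have hsplit : ∀ A B : Set (En n), μH[m] (g '' A) ≤ μH[m] (g '' B) + μH[m] (g '' (A \ B)) := by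
    intro A B
    refine (measure_mono ?_).trans (measure_union_le _ _)
    rw [← image_union]
    exact image_mono fun x hx => by by_cases hB : x ∈ B <;> simp [hB, hx]
  refine ⟨g, ⟨_, hg⟩, fun x => ?_, fun x hx => ?_, ?_, ?_⟩
  · have := hgd x
    have h2 : ρ ≤ ε := min_le_right _ _
    linarith
  · exact hgt x fun h => hx ((thickening_mono (min_le_right _ _) _).trans
      (thickening_subset_of_subset _ hKU) h)
  · have hCimg : g '' C = C := by
      rw [image_congr hgC, image_id']
    calc μH[m] (g '' (E \ U)) ≤ μH[m] C + e := by
          refine (hsplit _ C).trans ?_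
          rw [hCimg]
          gcongr
          exact hgd' _ _ hCd
      _ ≤ μH[m] (E \ U) + e := by gcongr
      _ < _ := by
          refine (ENNReal.add_lt_add_iff_left hEUfin.ne).2 ?_
          exact ENNReal.half_lt_self hε'.ne' ENNReal.ofReal_ne_top
  · have hKimg : μH[m] (g '' K) < e := by
      rw [image_congr hgK]
      have h1 : N * μH[m] (f '' K) < N * e := by
        refine (hfK.trans ?_).trans_lt hN
        gcongr
        exact hKU.trans hUE
      exact lt_of_mul_lt_mul_left' h1
    calc μH[m] (g '' U) ≤ μH[m] (g '' K) + e :=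
          (hsplit _ K).trans (by gcongr; exact hgd' _ _ hKd)
      _ < e + e := (ENNReal.add_lt_add_iff_right hetop).2 hKimg
      _ = _ := hee
end
end
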